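/- Let N ≥ 2 and d ≥ 1. For each i ∈ {1,…,d}, let (μ_{t,i})_{t∈{1,…,N}} be probability measures on ℝ with finite first moments such that each consecutive pair μ_{t,i} ⪯_c μ_{t+1,i} is in convex order and irreducible. Let c : ℝ^{Nd} → ℝ be lower semi-continuous and satisfy |c(x)| ≤ Σ_{t=1}^N Σ_{i=1}^d v_{t,i}(x_{t,i}) for some continuous functions v_{t,i} ∈ L¹(μ_{t,i}). Then there exist measurable functions φ_{t,i} : ℝ → ℝ ∪ {−∞} which are real-valued μ_{t,i}-almost surely, and real-valued measurable functions h_{t,i} : ℝ^{td} → ℝ for t ∈ {1,…,N−1} (with h_{N,i} ≡ 0), such that Σ_{t=1}^N Σ_{i=1}^d [φ_{t,i}(x_{t,i}) + h_{t,i}(x_1,…,x_t)(x_{t+1,i} − x_{t,i})] ≤ c(x) for every x = (x_1,…,x_N) ∈ (ℝ^d)^N, and such that equality Σ_{t=1}^N Σ_{i=1}^d [φ_{t,i}(x_{t,i}) + h_{t,i}(x_1,…,x_t)(x_{t+1,i} − x_{t,i})] = c(x) holds π-almost surely for every π ∈ VMT(μ) that minimizes ∫ c dπ over VMT(μ). 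-/

import Mathlib

open MeasureTheory Filter

noncomputable section

/-- Convex order for probability measures on ℝ. -/
def ConvexOrder1 (μ ν : Measure ℝ) : Prop :=
  ∀ f : ℝ → ℝ, ConvexOn ℝ Set.univ f → Integrable f μ → Integrable f ν →
    ∫ x, f x ∂μ ≤ ∫ x, f x ∂ν

/-- Potential function u_μ(x) = ∫ |x - y| dμ(y). -/
def potentialFn (μ : Measure ℝ) (x : ℝ) : ℝ := ∫ y, |x - y| ∂μ

/-- Irreducibility of a pair μ ⪯_c ν: the set I = {u_μ < u_ν} is a connected
(open) interval of full μ-measure. -/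
def IrreduciblePair (μ ν : Measure ℝ) : Prop :=
  IsPreconnected {x | potentialFn μ x < potentialFn ν x} ∧
  μ {x | potentialFn μ x < potentialFn ν x} = 1

/-- Vectorial martingale transports: probability measures on (ℝ^d)^N whose coordinate
process is an ℝ^d-valued martingale in its natural filtration with the given
one-dimensional marginals. -/
def VMT (N d : ℕ) (μ : Fin N → Fin d → Measure ℝ) :
    Set (Measure (Fin N → Fin d → ℝ)) :=
  {π | IsProbabilityMeasure π ∧
    (∀ t i, π.map (fun x => x t i) = μ t i) ∧
    ∀ (t : ℕ) (ht : t + 1 < N),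
      π[(fun x => x ⟨t + 1, ht⟩) |
        MeasurableSpace.comap
          (fun (x : Fin N → Fin d → ℝ) (s : Fin (t + 1)) =>
            x ⟨s.val, by have := s.isLt; omega⟩) inferInstance]
        =ᵐ[π] fun x => x ⟨t, by omega⟩}

/-- Payout of the semi-static hedging portfolio (φ, h) along the path x, valued in
ℝ ∪ {−∞} (resp. ℝ ∪ {+∞}) via EReal; the t = N trading term vanishes by convention. -/
def portfolioPayout (N d : ℕ) (φ : Fin N → Fin d → ℝ → EReal)
    (h : (t : ℕ) → Fin d → (Fin t → Fin d → ℝ) → ℝ)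
    (x : Fin N → Fin d → ℝ) : EReal :=
  ∑ t : Fin N, ∑ i : Fin d,
    (φ t i (x t i) +
      ((if ht : (t : ℕ) + 1 < N then
          h ((t : ℕ) + 1) i (fun s => x ⟨s.val, by have := s.isLt; have := t.isLt; omega⟩) *
            (x ⟨(t : ℕ) + 1, ht⟩ i - x t i)
        else 0 : ℝ) : EReal))


namespace VM

/-- Path space. -/
abbrev Pth (N d : ℕ) := Fin N → Fin d → ℝ

/-- Coordinate with a natural number time index. -/
def X {N d : ℕ} (t : ℕ) (i : Fin d) (x : Pth N d) : ℝ := if h : t < N then x ⟨t, h⟩ i else 0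

/-- Adaptedness: dependence on the coordinates up to time `t` only. -/
def Adp {N d : ℕ} {β : Type*} (t : ℕ) (H : Pth N d → β) : Prop :=
  ∀ x y : Pth N d, (∀ s : Fin N, (s : ℕ) ≤ t → x s = y s) → H x = H y

/-- Gains of the trading strategy `H`. -/
def trade {N d : ℕ} (H : ℕ → Fin d → Pth N d → ℝ) (x : Pth N d) : ℝ :=
  ∑ t ∈ Finset.range (N - 1), ∑ i, H t i x * (X (t + 1) i x - X t i x)

/-- Static part. -/
def stat {N d : ℕ} (φ : ℕ → Fin d → ℝ → ℝ) (x : Pth N d) : ℝ :=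
  ∑ t ∈ Finset.range N, ∑ i, φ t i (X t i x)

/-- Admissible strategies: measurable, adapted, bounded. -/
def GoodH {N d : ℕ} (H : ℕ → Fin d → Pth N d → ℝ) : Prop :=
  ∀ t i, Measurable (H t i) ∧ Adp t (H t i) ∧ ∃ C, ∀ x, |H t i x| ≤ C

/-- Admissible static positions. -/
def GoodP (N : ℕ) {d : ℕ} (μ : ℕ → Fin d → Measure ℝ) (φ : ℕ → Fin d → ℝ → ℝ) : Prop :=
  ∀ t i, Measurable (φ t i) ∧ (t < N → Integrable (φ t i) (μ t i))

/-- Value of static position. -/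
def val (N : ℕ) {d : ℕ} (μ : ℕ → Fin d → Measure ℝ) (φ : ℕ → Fin d → ℝ → ℝ) : ℝ :=
  ∑ t ∈ Finset.range N, ∑ i, ∫ y, φ t i y ∂(μ t i)

/-- Martingale measures with given marginals, tested against bounded adapted functions. -/
structure Mart {N d : ℕ} (μ : ℕ → Fin d → Measure ℝ) (π : Measure (Pth N d)) : Prop where
  prob : IsProbabilityMeasure π
  marg : ∀ t < N, ∀ i, π.map (X t i) = μ t i
  int : ∀ t < N, ∀ i, Integrable (X t i) π
  mart : ∀ t, t + 1 < N → ∀ i, ∀ H : Pth N d → ℝ, Measurable H → Adp t H → (∃ C, ∀ x, |H x| ≤ C) →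
    ∫ x, H x * (X (t + 1) i x - X t i x) ∂π = 0

section
variable {N d : ℕ}

lemma continuous_X (t : ℕ) (i : Fin d) : Continuous (X (N := N) t i) := by
  unfold X
  split_ifs with h
  · fun_prop
  · fun_prop

@[fun_prop]
lemma measurable_X (t : ℕ) (i : Fin d) : Measurable (X (N := N) t i) := (continuous_X t i).measurable

lemma adp_X {s t : ℕ} (h : s ≤ t) (i : Fin d) : Adp t (X (N := N) s i) := by
  intro x y hxy
  unfold X
  split_ifs with h'
  · rw [hxy ⟨s, h'⟩ h]
  · rfl

lemma Adp.mono {β : Type*} {s t : ℕ} (h : s ≤ t) {H : Pth N d → β} (hH : Adp s H) : Adp t H :=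
  fun x y hxy => hH x y fun r hr => hxy r (hr.trans h)

variable {μ : ℕ → Fin d → Measure ℝ} {π : Measure (Pth N d)}

lemma measurable_stat {φ : ℕ → Fin d → ℝ → ℝ} (hφ : ∀ t i, Measurable (φ t i)) :
    Measurable (stat (N := N) φ) := by
  unfold stat
  refine Finset.measurable_sum _ fun t _ => Finset.measurable_sum _ fun i _ => ?_
  exact (hφ t i).comp (measurable_X t i)

lemma measurable_trade {H : ℕ → Fin d → Pth N d → ℝ} (hH : ∀ t i, Measurable (H t i)) :
    Measurable (trade H) := by
  unfold trade
  refine Finset.measurable_sum _ fun t _ => Finset.measurable_sum _ fun i _ => ?_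
  have := hH t i
  fun_prop

lemma Mart.integrable_comp (hπ : Mart μ π) {t : ℕ} (ht : t < N) (i : Fin d) {f : ℝ → ℝ}
    (hf : Integrable f (μ t i)) : Integrable (fun x => f (X t i x)) π := by
  rw [← hπ.marg t ht i] at hf
  exact hf.comp_measurable (measurable_X t i)

lemma Mart.integral_comp (hπ : Mart μ π) {t : ℕ} (ht : t < N) (i : Fin d) {f : ℝ → ℝ}
    (hf : Measurable f) : ∫ x, f (X t i x) ∂π = ∫ y, f y ∂(μ t i) := by
  rw [← hπ.marg t ht i, integral_map (measurable_X t i).aemeasurable hf.aestronglyMeasurable]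

lemma Mart.integrable_incr (hπ : Mart μ π) {t : ℕ} (ht : t + 1 < N) (i : Fin d)
    {H : Pth N d → ℝ} (hm : Measurable H) (hb : ∃ C, ∀ x, |H x| ≤ C) :
    Integrable (fun x => H x * (X (t + 1) i x - X t i x)) π := by
  obtain ⟨C, hC⟩ := hb
  exact Integrable.bdd_mul ((hπ.int (t+1) ht i).sub (hπ.int t (by omega) i))
    hm.aestronglyMeasurable (Eventually.of_forall hC)

lemma Mart.stat (hπ : Mart μ π) {φ : ℕ → Fin d → ℝ → ℝ} (hφ : GoodP N μ φ) :
    Integrable (stat φ) π ∧ ∫ x, VM.stat φ x ∂π = val N μ φ := by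
  have h1 : ∀ t ∈ Finset.range N, ∀ i, Integrable (fun x => φ t i (X t i x)) π := fun t ht i =>
    hπ.integrable_comp (Finset.mem_range.1 ht) i ((hφ t i).2 (Finset.mem_range.1 ht))
  constructor
  · exact integrable_finsetSum _ fun t ht => integrable_finsetSum _ fun i _ => h1 t ht i
  · unfold VM.stat val
    rw [integral_finsetSum _ fun t ht => integrable_finsetSum _ fun i _ => h1 t ht i]
    refine Finset.sum_congr rfl fun t ht => ?_
    rw [integral_finsetSum _ fun i _ => h1 t ht i]
    exact Finset.sum_congr rfl fun i _ => hπ.integral_comp (Finset.mem_range.1 ht) i (hφ t i).1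

lemma Mart.trade (hπ : Mart μ π) {H : ℕ → Fin d → Pth N d → ℝ} (hH : GoodH H) :
    Integrable (trade H) π ∧ ∫ x, VM.trade H x ∂π = 0 := by
  have h1 : ∀ t ∈ Finset.range (N - 1), ∀ i,
      Integrable (fun x => H t i x * (X (t + 1) i x - X t i x)) π := fun t ht i =>
    hπ.integrable_incr (by have := Finset.mem_range.1 ht; omega) i (hH t i).1 (hH t i).2.2
  constructor
  · exact integrable_finsetSum _ fun t ht => integrable_finsetSum _ fun i _ => h1 t ht i
  · unfold VM.trade
    rw [integral_finsetSum _ fun t ht => integrable_finsetSum _ fun i _ => h1 t ht i]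
    refine Finset.sum_eq_zero fun t ht => ?_
    rw [integral_finsetSum _ fun i _ => h1 t ht i]
    exact Finset.sum_eq_zero fun i _ => hπ.mart t (by have := Finset.mem_range.1 ht; omega) i _
      (hH t i).1 (hH t i).2.1 (hH t i).2.2

lemma val_add {φ ψ : ℕ → Fin d → ℝ → ℝ} (hφ : GoodP N μ φ) (hψ : GoodP N μ ψ) :
    val N μ (fun t i y => φ t i y + ψ t i y) = val N μ φ + val N μ ψ := by
  unfold val
  rw [← Finset.sum_add_distrib]
  refine Finset.sum_congr rfl fun t ht => ?_
  rw [← Finset.sum_add_distrib]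
  refine Finset.sum_congr rfl fun i _ => ?_
  exact integral_add ((hφ t i).2 (Finset.mem_range.1 ht)) ((hψ t i).2 (Finset.mem_range.1 ht))

lemma val_smul (a : ℝ) (φ : ℕ → Fin d → ℝ → ℝ) :
    val N μ (fun t i y => a * φ t i y) = a * val N μ φ := by
  unfold val
  simp only [integral_const_mul, Finset.mul_sum]

lemma stat_add (φ ψ : ℕ → Fin d → ℝ → ℝ) (x : Pth N d) :
    stat (fun t i y => φ t i y + ψ t i y) x = stat φ x + stat ψ x := by
  unfold stat
  simp only [Finset.sum_add_distrib]

lemma stat_smul (a : ℝ) (φ : ℕ → Fin d → ℝ → ℝ) (x : Pth N d) :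
    stat (fun t i y => a * φ t i y) x = a * stat φ x := by
  unfold stat
  simp only [Finset.mul_sum]

lemma trade_add (H K : ℕ → Fin d → Pth N d → ℝ) (x : Pth N d) :
    trade (fun t i y => H t i y + K t i y) x = trade H x + trade K x := by
  unfold trade
  simp only [Finset.sum_add_distrib, add_mul]

lemma trade_smul (a : ℝ) (H : ℕ → Fin d → Pth N d → ℝ) (x : Pth N d) :
    trade (fun t i y => a * H t i y) x = a * trade H x := by
  unfold trade
  simp only [Finset.mul_sum, mul_assoc]

lemma GoodP.add {φ ψ : ℕ → Fin d → ℝ → ℝ} (hφ : GoodP N μ φ) (hψ : GoodP N μ ψ) :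
    GoodP N μ (fun t i y => φ t i y + ψ t i y) := fun t i =>
  ⟨(hφ t i).1.add (hψ t i).1, fun h => ((hφ t i).2 h).add ((hψ t i).2 h)⟩

lemma GoodP.smul (a : ℝ) {φ : ℕ → Fin d → ℝ → ℝ} (hφ : GoodP N μ φ) :
    GoodP N μ (fun t i y => a * φ t i y) := fun t i =>
  ⟨(hφ t i).1.const_mul a, fun h => ((hφ t i).2 h).const_mul a⟩

lemma GoodH.add {H K : ℕ → Fin d → Pth N d → ℝ} (hH : GoodH H) (hK : GoodH K) :
    GoodH (fun t i y => H t i y + K t i y) := by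
  intro t i
  obtain ⟨h1, h2, C, h3⟩ := hH t i
  obtain ⟨k1, k2, D, k3⟩ := hK t i
  refine ⟨h1.add k1, fun x y hxy => ?_, C + D, fun x => ?_⟩
  · simp only [h2 x y hxy, k2 x y hxy]
  · exact (abs_add_le _ _).trans (add_le_add (h3 x) (k3 x))

lemma GoodH.smul (a : ℝ) {H : ℕ → Fin d → Pth N d → ℝ} (hH : GoodH H) :
    GoodH (fun t i y => a * H t i y) := by
  intro t i
  obtain ⟨h1, h2, C, h3⟩ := hH t i
  refine ⟨h1.const_mul a, fun x y hxy => ?_, |a| * C, fun x => ?_⟩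
  · simp only [h2 x y hxy]
  · rw [abs_mul]; exact mul_le_mul_of_nonneg_left (h3 x) (abs_nonneg a)

lemma GoodH.const (a : ℕ → Fin d → ℝ) : GoodH (N := N) (fun t i _ => a t i) := fun t i =>
  ⟨measurable_const, fun _ _ _ => rfl, |a t i|, fun _ => le_rfl⟩

lemma GoodP.zero : GoodP N μ (fun _ _ _ => (0 : ℝ)) := fun _ _ =>
  ⟨measurable_const, fun _ => integrable_zero _ _ _⟩

end
end VM


namespace VM

section
variable {N d : ℕ}

/-- Restriction of a path to the times up to `t`. -/
def rest (t : ℕ) (x : Pth N d) : Fin (t + 1) → Fin d → ℝ := fun s i => X s i x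

/-- Extension of a partial path by zero. -/
def extd (N : ℕ) {d : ℕ} (t : ℕ) (z : Fin t → Fin d → ℝ) : Pth N d :=
  fun s i => if h : (s : ℕ) < t then z ⟨s, h⟩ i else 0

lemma continuous_rest (t : ℕ) : Continuous (rest (N := N) (d := d) t) := by
  unfold rest
  exact continuous_pi fun s => continuous_pi fun i => continuous_X _ _

lemma measurable_extd (t : ℕ) : Measurable (extd N (d := d) t) := by
  unfold extd
  refine measurable_pi_lambda _ fun s => measurable_pi_lambda _ fun i => ?_
  split_ifs with h
  · fun_prop
  · fun_prop

lemma extd_rest {β : Type*} {t : ℕ} {H : Pth N d → β} (hH : Adp t H) (x : Pth N d) :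
    H (extd N (t + 1) (rest t x)) = H x := by
  refine hH _ _ fun s hs => ?_
  funext i
  simp [extd, rest, X, Nat.lt_succ_of_le hs]

lemma adp_rest {β : Type*} {t : ℕ} (g : (Fin (t + 1) → Fin d → ℝ) → β) :
    Adp t (fun x : Pth N d => g (rest t x)) := by
  intro x y hxy
  have : rest t x = rest t y := by
    funext s i
    exact adp_X (Nat.lt_succ_iff.1 s.2) i x y hxy
  simp only [this]

/-- Orthogonality to continuous adapted test functions extends to measurable ones. -/
lemma mart_of_cont {ρ : Measure (Pth N d)} [IsFiniteMeasure ρ] {t : ℕ} {D : Pth N d → ℝ}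
    (hDm : Measurable D) (hD : Integrable D ρ)
    (h : ∀ H : Pth N d → ℝ, Continuous H → Adp t H → (∃ C, ∀ x, |H x| ≤ C) →
      ∫ x, H x * D x ∂ρ = 0) :
    ∀ H : Pth N d → ℝ, Measurable H → Adp t H → (∃ C, ∀ x, |H x| ≤ C) →
      ∫ x, H x * D x ∂ρ = 0 := by
  have hrm : Measurable (rest (N := N) (d := d) t) := (continuous_rest t).measurable
  let nu : (Pth N d → ℝ) → Measure (Fin (t + 1) → Fin d → ℝ) := fun f =>
    (ρ.withDensity fun x => ENNReal.ofReal (f x)).map (rest t)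
  have key : ∀ f : Pth N d → ℝ, Measurable f → Integrable f ρ → (∀ x, 0 ≤ f x) →
      ∀ g : (Fin (t + 1) → Fin d → ℝ) → ℝ, Measurable g →
      ∫ z, g z ∂(nu f) = ∫ x, g (rest t x) * f x ∂ρ := by
    intro f hf hfi h0 g hg
    rw [integral_map hrm.aemeasurable hg.aestronglyMeasurable,
      integral_withDensity_eq_integral_toReal_smul hf.ennreal_ofReal
        (Eventually.of_forall fun _ => ENNReal.ofReal_lt_top)]
    refine integral_congr_ae (Eventually.of_forall fun x => ?_)
    simp only [ENNReal.toReal_ofReal (h0 x), smul_eq_mul, mul_comm]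
  have hpm : Measurable fun x => max (D x) 0 := hDm.max measurable_const
  have hnm : Measurable fun x => max (-D x) 0 := hDm.neg.max measurable_const
  have hpi : Integrable (fun x => max (D x) 0) ρ := hD.pos_part
  have hni : Integrable (fun x => max (-D x) 0) ρ := hD.neg_part
  have hdec : ∀ x, D x = max (D x) 0 - max (-D x) 0 := fun x =>
    (max_zero_sub_max_neg_zero_eq_self (D x)).symm
  have f1 : IsFiniteMeasure (nu fun x => max (D x) 0) := by
    have := isFiniteMeasure_withDensity_ofReal hpi.2
    exact Measure.isFiniteMeasure_map _ _
  have f2 : IsFiniteMeasure (nu fun x => max (-D x) 0) := by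
    have := isFiniteMeasure_withDensity_ofReal hni.2
    exact Measure.isFiniteMeasure_map _ _
  have split : ∀ g : (Fin (t + 1) → Fin d → ℝ) → ℝ, Measurable g → (∃ C, ∀ z, |g z| ≤ C) →
      ∫ x, g (rest t x) * D x ∂ρ =
        ∫ z, g z ∂(nu fun x => max (D x) 0) - ∫ z, g z ∂(nu fun x => max (-D x) 0) := by
    rintro g hg ⟨C, hC⟩
    have hgr : AEStronglyMeasurable (fun x => g (rest t x)) ρ :=
      (hg.comp hrm).aestronglyMeasurable
    have hb : ∀ᵐ x ∂ρ, ‖g (rest t x)‖ ≤ C := Eventually.of_forall fun x => hC _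
    rw [key _ hpm hpi (fun x => le_max_right _ _) g hg,
      key _ hnm hni (fun x => le_max_right _ _) g hg,
      ← integral_sub (hpi.bdd_mul hgr hb) (hni.bdd_mul hgr hb)]
    refine integral_congr_ae (Eventually.of_forall fun x => ?_)
    simp only [← mul_sub, ← hdec]
  have heq : (nu fun x => max (D x) 0) = nu fun x => max (-D x) 0 := by
    refine ext_of_forall_integral_eq_of_IsFiniteMeasure fun g => ?_
    have hb : ∃ C, ∀ z, |g z| ≤ C := ⟨‖g‖, fun z => g.norm_coe_le_norm z⟩
    have h1 := split g g.continuous.measurable hb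
    rw [h (fun x => g (rest t x)) (g.continuous.comp (continuous_rest t)) (adp_rest _)
      (hb.imp fun C hC x => hC _)] at h1
    linarith
  intro H hH hA hb
  have h1 := split (fun z => H (extd N (t + 1) z)) (hH.comp (measurable_extd _))
    (hb.imp fun C hC x => hC _)
  rw [heq, sub_self] at h1
  simpa only [extd_rest hA] using h1

end

section
variable {N d : ℕ}

lemma adp_comap {t : ℕ} (ht : t + 1 < N) {H : Pth N d → ℝ} (hH : Measurable H) (hA : Adp t H) :
    Measurable[MeasurableSpace.comap
          (fun (x : Fin N → Fin d → ℝ) (s : Fin (t + 1)) =>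
            x ⟨s.val, by have := s.isLt; omega⟩) inferInstance] H := by
  have : H = (fun z => H (extd N (t + 1) z)) ∘ (fun (x : Fin N → Fin d → ℝ) (s : Fin (t + 1)) =>
            x ⟨s.val, by have := s.isLt; omega⟩) := by
    funext x
    rw [← extd_rest hA x]
    simp only [Function.comp]
    congr 1
    funext s i
    have h2 : (s:ℕ) < N := s.2
    simp [extd, rest, X]
  rw [this]
  exact (hH.comp (measurable_extd _)).comp (comap_measurable _)

variable (μ : Fin N → Fin d → Measure ℝ)

/-- Extension of the marginal family to natural time indices. -/
def muN (t : ℕ) (i : Fin d) : Measure ℝ := if h : t < N then μ ⟨t, h⟩ i else Measure.dirac 0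

variable {μ} {π : Measure (Pth N d)}

lemma mart_of_vmt (hmom : ∀ t i, Integrable id (μ t i)) (hπ : π ∈ VMT N d μ) : Mart (muN μ) π := by
  obtain ⟨hp, hm, hmart⟩ := hπ
  have hint : ∀ t < N, ∀ i, Integrable (X (N := N) t i) π := by
    intro t ht i
    have h1 := hmom ⟨t, ht⟩ i
    rw [← hm ⟨t, ht⟩ i] at h1
    have h2 := h1.comp_measurable (by fun_prop)
    refine h2.congr (Eventually.of_forall fun x => ?_)
    simp [X, ht]
  refine ⟨hp, fun t ht i => ?_, hint, ?_⟩
  · simp only [muN, ht, dite_true, ← hm ⟨t, ht⟩ i]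
    congr 1
    funext x
    simp [X, ht]
  · intro t ht i H hH hA hb
    have hmle : MeasurableSpace.comap
          (fun (x : Fin N → Fin d → ℝ) (s : Fin (t + 1)) =>
            x ⟨s.val, by have := s.isLt; omega⟩) inferInstance ≤
            (inferInstance : MeasurableSpace (Fin N → Fin d → ℝ)) := by
      refine Measurable.comap_le ?_
      fun_prop
    have hHm := adp_comap ht hH hA
    have h0 := hmart t ht
    generalize MeasurableSpace.comap
          (fun (x : Fin N → Fin d → ℝ) (s : Fin (t + 1)) =>
            x ⟨s.val, by have := s.isLt; omega⟩) inferInstance = m at *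
    have hi : ∀ s (hs : s < N), Integrable (fun x : Pth N d => x ⟨s, hs⟩) π := by
      intro s hs
      refine Integrable.of_eval fun j => ?_
      refine (hint s hs j).congr (Eventually.of_forall fun x => ?_)
      simp [X, hs]
    have h1 := ContinuousLinearMap.comp_condExp_comm (m := m) (hi (t+1) ht)
      (ContinuousLinearMap.proj (R := ℝ) (φ := fun _ : Fin d => ℝ) i)
    have h2 : π[(fun x => X (t + 1) i x)|m] =ᵐ[π] fun x => X t i x := by
      have e : (ContinuousLinearMap.proj (R := ℝ) (φ := fun _ : Fin d => ℝ) i) ∘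
          (fun x : Pth N d => x ⟨t+1, ht⟩) = fun x => X (t + 1) i x := by
        funext x; simp [X, ht]
      rw [e] at h1
      filter_upwards [h1, h0] with x h1 h0
      rw [← h1]
      have ht' : t < N := by omega
      simp [h0, X, ht']
    have hHs : StronglyMeasurable[m] H := hHm.stronglyMeasurable
    have hIH : ∀ s < N, Integrable (fun x => H x * X s i x) π := fun s hs => by
      obtain ⟨C, hC⟩ := hb
      exact (hint s hs i).bdd_mul hH.aestronglyMeasurable (Eventually.of_forall hC)
    have h3 := condExp_mul_of_stronglyMeasurable_left (μ := π) (g := X (t+1) i) hHs (hIH _ ht)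
      (hint _ ht i)
    have h4 : ∫ x, H x * X (t+1) i x ∂π = ∫ x, H x * X t i x ∂π := by
      rw [← integral_condExp hmle]
      refine integral_congr_ae ?_
      refine h3.trans ?_
      filter_upwards [h2] with x hx
      simp only [Pi.mul_apply, hx]
    simp only [mul_sub]
    rw [integral_sub (hIH _ ht) (hIH _ (by omega)), h4, sub_self]

lemma vmt_of_mart (hπ : Mart (muN μ) π) : π ∈ VMT N d μ := by
  have hp := hπ.prob
  refine ⟨hπ.prob, fun t i => ?_, fun t ht => ?_⟩
  · have := hπ.marg t t.2 i
    simp only [muN, t.2, dite_true] at this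
    rw [← this]
    congr 1
    funext x
    simp [X]
  · have hmle : MeasurableSpace.comap
          (fun (x : Fin N → Fin d → ℝ) (s : Fin (t + 1)) =>
            x ⟨s.val, by have := s.isLt; omega⟩) inferInstance ≤
            (inferInstance : MeasurableSpace (Fin N → Fin d → ℝ)) := by
      refine Measurable.comap_le ?_
      fun_prop
    have hi : ∀ s (hs : s < N), Integrable (fun x : Pth N d => x ⟨s, hs⟩) π := by
      intro s hs
      refine Integrable.of_eval fun j => ?_
      refine (hπ.int s hs j).congr (Eventually.of_forall fun x => ?_)
      simp [X, hs]
    have ht' : t < N := by omega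
    symm
    refine ae_eq_condExp_of_forall_setIntegral_eq hmle (hi _ ht) (fun s _ _ => (hi _ _).integrableOn)
      (fun s hs _ => ?_) ?_
    · funext j
      have hev : ∀ r (hr : r < N), (∫ x in s, x ⟨r, hr⟩ ∂π) j = ∫ x in s, x ⟨r, hr⟩ j ∂π := by
        intro r hr
        have h1 : ∀ j, Integrable (fun x : Pth N d => x ⟨r, hr⟩ j) (π.restrict s) := fun j =>
          (((ContinuousLinearMap.proj (R := ℝ) (φ := fun _ : Fin d => ℝ) j).integrable_comp
            (hi r hr))).integrableOn
        exact eval_integral h1 j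
      rw [hev t ht', hev (t+1) ht]
      have hsm := hmle _ hs
      obtain ⟨B, hB, rfl⟩ := hs
      have h := hπ.mart t ht j (fun x => Set.indicator ((fun (x : Fin N → Fin d → ℝ) (s : Fin (t + 1)) =>
            x ⟨s.val, by have := s.isLt; omega⟩) ⁻¹' B) (fun _ => (1:ℝ)) x) (measurable_const.indicator hsm) ?_ ⟨1, fun x => ?_⟩
      · have e : ∀ x : Pth N d, Set.indicator ((fun (x : Fin N → Fin d → ℝ) (s : Fin (t + 1)) =>
            x ⟨s.val, by have := s.isLt; omega⟩) ⁻¹' B) (fun _ => (1:ℝ)) x * (X (t+1) j x - X t j x) =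
            Set.indicator ((fun (x : Fin N → Fin d → ℝ) (s : Fin (t + 1)) =>
            x ⟨s.val, by have := s.isLt; omega⟩) ⁻¹' B) (fun x => X (t+1) j x - X t j x) x := by
          intro x
          by_cases hx : x ∈ ((fun (x : Fin N → Fin d → ℝ) (s : Fin (t + 1)) =>
            x ⟨s.val, by have := s.isLt; omega⟩) ⁻¹' B)
          · simp only [Set.indicator_of_mem hx, one_mul]
          · simp only [Set.indicator_of_notMem hx, zero_mul]
        simp only [e] at h
        rw [integral_indicator hsm, integral_sub (hπ.int _ ht j).integrableOn (hπ.int _ ht' j).integrableOn] at h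
        simp only [X, ht, ht', dite_true] at h
        linarith
      · intro x y hxy
        have : (fun s : Fin (t + 1) => x ⟨s.val, by have := s.isLt; omega⟩) =
          (fun s : Fin (t + 1) => y ⟨s.val, by have := s.isLt; omega⟩) := by
          funext s
          exact hxy _ (Nat.lt_succ_iff.1 s.2)
        exact congrArg (fun z => Set.indicator B (fun _ => (1:ℝ)) z) this
      · simp only [Set.indicator]
        split_ifs <;> simp
    · refine Measurable.aestronglyMeasurable ?_
      have e : (fun x : Fin N → Fin d → ℝ => x ⟨t, ht'⟩) = (fun z : Fin (t+1) → Fin d → ℝ => z (Fin.last t)) ∘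
        (fun (x : Fin N → Fin d → ℝ) (s : Fin (t + 1)) => x ⟨s.val, by have := s.isLt; omega⟩) := rfl
      rw [e]
      exact Measurable.comp (by fun_prop) (comap_measurable _)

end
end VM


namespace VM

lemma hb_attain {E : Type*} [AddCommGroup E] [Module ℝ E] (p : E → ℝ)
    (hhom : ∀ c : ℝ, 0 < c → ∀ x, p (c • x) = c * p x) (hadd : ∀ x y, p (x + y) ≤ p x + p y)
    (e : E) : ∃ l : E →ₗ[ℝ] ℝ, (∀ x, l x ≤ p x) ∧ l e = p e := by
  have h0 : p 0 = 0 := by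
    have := hhom 2 (by norm_num) 0
    rw [smul_zero] at this
    linarith
  by_cases he : e = 0
  · obtain ⟨g, -, hg⟩ := exists_extension_of_le_sublinear (⟨⊥, 0⟩ : E →ₗ.[ℝ] ℝ) p hhom hadd (by
      rintro ⟨x, hx⟩
      have hx0 : x = 0 := (Submodule.mem_bot ℝ).1 hx
      subst hx0
      exact h0.ge)
    exact ⟨g, hg, by rw [he, map_zero, h0]⟩
  · obtain ⟨g, hg1, hg⟩ := exists_extension_of_le_sublinear
      (LinearPMap.mkSpanSingleton (K := ℝ) e (p e) he) p hhom hadd (by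
      rintro ⟨x, hx⟩
      obtain ⟨a, rfl⟩ := Submodule.mem_span_singleton.1 hx
      have e1 : (LinearPMap.mkSpanSingleton (K := ℝ) e (p e) he) ⟨a • e, hx⟩ = a * p e :=
        LinearPMap.mkSpanSingleton'_apply e (p e) _ a hx
      rw [e1]
      change a * p e ≤ p (a • e)
      rcases lt_trichotomy a 0 with ha | ha | ha
      · have h1 := hadd (a • e) ((-a) • e)
        rw [← add_smul, add_neg_cancel, zero_smul, h0, hhom (-a) (by linarith)] at h1
        linarith
      · simp [ha, h0]
      · rw [hhom a ha])
    refine ⟨g, hg, ?_⟩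
    have := hg1 ⟨e, Submodule.mem_span_singleton_self e⟩
    rw [this]
    exact LinearPMap.mkSpanSingleton_apply ℝ ℝ he (p e)

/-- Lower semicontinuous nonnegative functions are increasing limits of continuous ones. -/
lemma lsc_approx {α : Type*} [PseudoMetricSpace α] {c : α → ℝ} (hc : LowerSemicontinuous c)
    (h0 : ∀ x, 0 ≤ c x) : ∃ f : ℕ → α → ℝ, (∀ n, Continuous (f n)) ∧ (∀ n x, 0 ≤ f n x) ∧
      (∀ n x, f n x ≤ c x) ∧ (∀ x, Monotone fun n => f n x) ∧
      ∀ x, Tendsto (fun n => f n x) atTop (nhds (c x)) := by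
  let f : ℕ → α → ℝ := fun n x => ⨅ y, (c y + n * dist x y)
  have hb : ∀ (n : ℕ) x, BddBelow (Set.range fun y => c y + (n:ℝ) * dist x y) := fun n x =>
    ⟨0, by rintro _ ⟨y, rfl⟩; have := h0 y; exact add_nonneg this (mul_nonneg n.cast_nonneg dist_nonneg)⟩
  have hle : ∀ n x, f n x ≤ c x := fun n x => by
    have := ciInf_le (hb n x) x
    simpa using this
  have hnn : ∀ n x, 0 ≤ f n x := fun n x =>
    Real.iInf_nonneg fun y => by have := h0 y; positivity
  have hmono : ∀ x, Monotone fun n => f n x := by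
    intro x m n hmn
    have : Nonempty α := ⟨x⟩
    refine ciInf_mono (hb m x) fun y => ?_
    gcongr
  refine ⟨f, fun n => ?_, hnn, hle, hmono, fun x => ?_⟩
  · refine (LipschitzWith.of_le_add_mul (n : NNReal) fun x z => ?_).continuous
    have : Nonempty α := ⟨x⟩
    have h : f n x - n * dist x z ≤ f n z := by
      refine le_ciInf fun y => ?_
      have h1 := ciInf_le (hb n x) y
      have h2 := dist_triangle x z y
      have h3 : (n:ℝ) * dist x y ≤ n * (dist x z + dist z y) := by gcongr
      change f n x ≤ _ at h1
      linarith
    simp only [NNReal.coe_natCast]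
    linarith
  · rw [tendsto_order]
    refine ⟨fun a ha => ?_, fun a ha => Eventually.of_forall fun n => (hle n x).trans_lt ha⟩
    obtain ⟨b, hab, hbc⟩ := exists_between ha
    obtain ⟨ε, hε, hball⟩ := Metric.eventually_nhds_iff.1 (hc x b hbc)
    obtain ⟨n0, hn0⟩ := exists_nat_gt (|b| / ε)
    filter_upwards [eventually_ge_atTop n0] with n hn
    refine hab.trans_le ?_
    have : Nonempty α := ⟨x⟩
    refine le_ciInf fun y => ?_
    by_cases hy : dist y x < ε
    · have := hball hy
      have : 0 ≤ (n:ℝ) * dist x y := by positivity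
      linarith
    · have h1 : ε ≤ dist x y := by rw [dist_comm]; linarith
      have h2 : |b| < n0 * ε := by rwa [div_lt_iff₀ hε] at hn0
      have h3 : (n0:ℝ) * ε ≤ n * dist x y := by gcongr
      have := h0 y
      have := le_abs_self b
      linarith

section
variable {N d : ℕ} {μ : ℕ → Fin d → Measure ℝ} {π : Measure (Pth N d)}

/-- Set of superhedging prices. -/
def hset (N : ℕ) {d : ℕ} (μ : ℕ → Fin d → Measure ℝ) (F : Pth N d → ℝ) : Set ℝ :=
  {r | ∃ φ H, GoodP N μ φ ∧ GoodH H ∧ (∀ x, F x ≤ stat φ x + trade H x) ∧ r = val N μ φ}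

lemma hset_add {F G : Pth N d → ℝ} {r s : ℝ} (hr : r ∈ hset N μ F) (hs : s ∈ hset N μ G) :
    r + s ∈ hset N μ (F + G) := by
  obtain ⟨φ, H, h1, h2, h3, rfl⟩ := hr
  obtain ⟨ψ, K, k1, k2, k3, rfl⟩ := hs
  refine ⟨_, _, h1.add k1, h2.add k2, fun x => ?_, (val_add h1 k1).symm⟩
  rw [stat_add, trade_add, Pi.add_apply]
  linarith [h3 x, k3 x]

lemma hset_smul {F : Pth N d → ℝ} {r a : ℝ} (ha : 0 ≤ a) (hr : r ∈ hset N μ F) :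
    a * r ∈ hset N μ (a • F) := by
  obtain ⟨φ, H, h1, h2, h3, rfl⟩ := hr
  refine ⟨_, _, h1.smul a, h2.smul a, fun x => ?_, (val_smul a φ).symm⟩
  rw [stat_smul, trade_smul, Pi.smul_apply, smul_eq_mul, ← mul_add]
  exact mul_le_mul_of_nonneg_left (h3 x) ha

lemma hset_lower (hπ : Mart μ π) {F G : Pth N d → ℝ} (hG : Integrable G π) (hGF : ∀ x, G x ≤ F x)
    {r : ℝ} (hr : r ∈ hset N μ F) : ∫ x, G x ∂π ≤ r := by
  obtain ⟨φ, H, h1, h2, h3, rfl⟩ := hr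
  have := integral_mono hG ((hπ.stat h1).1.add (hπ.trade h2).1) fun x => (hGF x).trans (h3 x)
  rwa [integral_add' (hπ.stat h1).1 (hπ.trade h2).1, (hπ.stat h1).2, (hπ.trade h2).2,
    add_zero] at this

/-- Functions of bounded growth. -/
def growth {α : Type*} (W : α → ℝ) : Submodule ℝ (α → ℝ) where
  carrier := {F | ∃ K, ∀ x, |F x| ≤ K * W x}
  add_mem' := by
    rintro F G ⟨K, hK⟩ ⟨L, hL⟩
    exact ⟨K + L, fun x => by
      rw [add_mul]; exact (abs_add_le _ _).trans (add_le_add (hK x) (hL x))⟩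
  zero_mem' := ⟨0, fun x => by simp⟩
  smul_mem' := by
    rintro a F ⟨K, hK⟩
    exact ⟨|a| * K, fun x => by
      rw [Pi.smul_apply, smul_eq_mul, abs_mul, mul_assoc]
      exact mul_le_mul_of_nonneg_left (hK x) (abs_nonneg a)⟩

/-- Hahn-Banach step: a linear functional dominated by the superhedging price. -/
lemma exists_functional (hπ : Mart μ π) {W : Pth N d → ℝ} (hW : Integrable W π)
    (hne : ∀ F ∈ growth W, (hset N μ F).Nonempty) (F₀ : growth W) :
    ∃ l : growth W →ₗ[ℝ] ℝ, (∀ F : growth W, ∀ r ∈ hset N μ F.1, l F ≤ r) ∧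
      ∀ ε > 0, ∃ r ∈ hset N μ F₀.1, r < l F₀ + ε := by
  obtain ⟨p, hp⟩ : ∃ p : growth W → ℝ, ∀ F, p F = sInf (hset N μ F.1) := ⟨_, fun _ => rfl⟩
  have hbd : ∀ F : growth W, BddBelow (hset N μ F.1) := by
    rintro ⟨F, K, hK⟩
    refine ⟨∫ x, -(K * W x) ∂π, fun r hr => ?_⟩
    exact hset_lower hπ (hW.const_mul K).neg (fun x => (abs_le.1 (hK x)).1) hr
  have hne' : ∀ F : growth W, (hset N μ F.1).Nonempty := fun F => hne F.1 F.2
  have hlt : ∀ F : growth W, ∀ ε > 0, ∃ r ∈ hset N μ F.1, r < p F + ε := by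
    intro F ε hε
    rw [hp]
    exact exists_lt_of_csInf_lt (hne' F) (lt_add_of_pos_right _ hε)
  have hle : ∀ F : growth W, ∀ r ∈ hset N μ F.1, p F ≤ r := by
    intro F r hr
    rw [hp]
    exact csInf_le (hbd F) hr
  have hadd : ∀ F G, p (F + G) ≤ p F + p G := by
    intro F G
    refine le_of_forall_pos_le_add fun ε hε => ?_
    obtain ⟨r, hr, hr'⟩ := hlt F _ (half_pos hε)
    obtain ⟨s, hs, hs'⟩ := hlt G _ (half_pos hε)
    have := hle (F + G) (r + s) (hset_add hr hs)
    linarith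
  have hhom' : ∀ a : ℝ, 0 < a → ∀ F, p (a • F) ≤ a * p F := by
    intro a ha F
    rw [← div_le_iff₀' ha, hp F]
    refine le_csInf (hne' F) fun r hr => ?_
    rw [div_le_iff₀' ha]
    exact hle (a • F) _ (hset_smul ha.le hr)
  have hhom : ∀ a : ℝ, 0 < a → ∀ F, p (a • F) = a * p F := by
    intro a ha F
    refine le_antisymm (hhom' a ha F) ?_
    have := hhom' a⁻¹ (inv_pos.2 ha) (a • F)
    rw [smul_smul, inv_mul_cancel₀ ha.ne', one_smul] at this
    rwa [le_inv_mul_iff₀ ha] at this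
  obtain ⟨l, hl1, hl2⟩ := hb_attain p hhom hadd F₀
  refine ⟨l, fun F r hr => (hl1 F).trans (hle F r hr), fun ε hε => ?_⟩
  rw [hl2]
  exact hlt F₀ ε hε

end
end VM


namespace VM

/-- Cutoff functions. -/
def cut {α : Type*} (W : α → ℝ) (n : ℕ) (x : α) : ℝ := max 0 (min 1 (2 - W x / (n + 1)))

section
variable {α : Type*} {W : α → ℝ}

lemma cut_nonneg (n : ℕ) (x : α) : 0 ≤ cut W n x := le_max_left _ _
lemma cut_le_one (n : ℕ) (x : α) : cut W n x ≤ 1 := max_le zero_le_one (min_le_left _ _)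

lemma cut_eq_one {n : ℕ} {x : α} (h : W x ≤ n + 1) : cut W n x = 1 := by
  have hn : (0:ℝ) < n + 1 := by positivity
  have : W x / (n + 1) ≤ 1 := by rwa [div_le_one hn]
  unfold cut
  rw [min_eq_left (by linarith), max_eq_right zero_le_one]

lemma cut_eq_zero {n : ℕ} {x : α} (h : 2 * (n + 1) ≤ W x) : cut W n x = 0 := by
  have hn : (0:ℝ) < n + 1 := by positivity
  have : 2 ≤ W x / (n + 1) := by rwa [le_div_iff₀ hn]
  unfold cut
  rw [max_eq_left]
  exact (min_le_right _ _).trans (by linarith)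

lemma cut_mono (h0 : ∀ x, 0 ≤ W x) (x : α) : Monotone fun n => cut W n x := by
  intro m n hmn
  unfold cut
  refine max_le_max le_rfl (min_le_min le_rfl ?_)
  have := h0 x
  gcongr

lemma cut_tendsto (x : α) : Tendsto (fun n => cut W n x) atTop (nhds 1) := by
  refine tendsto_const_nhds.congr' ?_
  obtain ⟨n0, hn0⟩ := exists_nat_gt (W x)
  filter_upwards [eventually_ge_atTop n0] with n hn
  have : (n0:ℝ) ≤ n := by exact_mod_cast hn
  exact (cut_eq_one (by linarith)).symm

lemma growth_of_le {F G : α → ℝ} (hG : G ∈ growth W) (h : ∀ x, |F x| ≤ G x) : F ∈ growth W := by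
  obtain ⟨K, hK⟩ := hG
  exact ⟨K, fun x => (h x).trans ((le_abs_self _).trans (hK x))⟩

variable [TopologicalSpace α] [T2Space α] [MeasurableSpace α] [BorelSpace α]
  [LocallyCompactSpace α]

open CompactlySupported in
lemma cc_growth (hW1 : ∀ x, 1 ≤ W x) (f : C_c(α, ℝ)) : (f : α → ℝ) ∈ growth W := by
  obtain ⟨C, hC⟩ := f.hasCompactSupport.exists_bound_of_continuous f.continuous
  refine ⟨|C|, fun x => ?_⟩
  have h1 := hC x
  rw [Real.norm_eq_abs] at h1
  have h2 := hW1 x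
  have h3 := le_abs_self C
  have h4 := abs_nonneg C
  nlinarith

open CompactlySupported in
lemma riesz_growth (hWc : Continuous W) (hW1 : ∀ x, 1 ≤ W x) (hcomp : ∀ R, IsCompact {x | W x ≤ R})
    (l : growth W →ₗ[ℝ] ℝ) (hpos : ∀ F : growth W, (∀ x, 0 ≤ F.1 x) → 0 ≤ l F)
    (htail : ∀ ε > 0, ∃ n, ∀ F : growth W, (∀ x, F.1 x = W x * (1 - cut W n x)) → l F ≤ ε) :
    ∃ ρ : Measure α, ∀ F : growth W, Continuous F.1 → Integrable F.1 ρ ∧ ∫ x, F.1 x ∂ρ = l F := by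
  have hW0 : ∀ x, 0 ≤ W x := fun x => zero_le_one.trans (hW1 x)
  have hmono : ∀ F G : growth W, (∀ x, F.1 x ≤ G.1 x) → l F ≤ l G := by
    intro F G h
    have := hpos (G - F) fun x => sub_nonneg.2 (h x)
    rw [map_sub] at this
    linarith
  let Λ : C_c(α, ℝ) →ₚ[ℝ] ℝ := PositiveLinearMap.mk₀
    { toFun := fun f => l ⟨f, cc_growth hW1 f⟩
      map_add' := fun f g => by
        rw [← map_add]; rfl
      map_smul' := fun a f => by
        rw [RingHom.id_apply, ← map_smul]; rfl }
    (fun f hf => hpos _ hf)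
  have hΛ : ∀ f : C_c(α, ℝ), Λ f = l ⟨f, cc_growth hW1 f⟩ := fun f => rfl
  refine ⟨RealRMK.rieszMeasure Λ, ?_⟩
  set ρ := RealRMK.rieszMeasure Λ
  have hcutc : ∀ n, Continuous (cut W n) := fun n => by
    unfold cut
    fun_prop
  have hcg : ∀ (F : growth W) n, (fun x => F.1 x * cut W n x) ∈ growth W := by
    rintro ⟨F, K, hK⟩ n
    refine ⟨K, fun x => ?_⟩
    rw [abs_mul, abs_of_nonneg (cut_nonneg n x)]
    exact (mul_le_of_le_one_right (abs_nonneg _) (cut_le_one n x)).trans (hK x)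
  -- integrals of cut functions
  have hcut : ∀ (F : growth W), Continuous F.1 → ∀ n,
      Integrable (fun x => F.1 x * cut W n x) ρ ∧
      ∫ x, F.1 x * cut W n x ∂ρ = l ⟨_, hcg F n⟩ := by
    intro F hF n
    let f : C_c(α, ℝ) := ⟨⟨fun x => F.1 x * cut W n x, hF.mul (hcutc n)⟩, by
      refine HasCompactSupport.intro (hcomp (2 * (n + 1))) fun x hx => ?_
      have hx' : 2 * ((n:ℝ) + 1) ≤ W x := le_of_lt (not_le.1 hx)
      simp [cut_eq_zero hx']⟩
    have h1 := RealRMK.integral_rieszMeasure Λ f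
    refine ⟨f.continuous.integrable_of_hasCompactSupport f.hasCompactSupport, ?_⟩
    rw [hΛ] at h1
    exact h1
  -- nonnegative continuous functions
  have hnn : ∀ F : growth W, Continuous F.1 → (∀ x, 0 ≤ F.1 x) →
      Integrable F.1 ρ ∧ ∫ x, F.1 x ∂ρ ≤ l F := by
    intro F hF h0
    have hlim := lintegral_tendsto_of_tendsto_of_monotone (μ := ρ)
      (f := fun n x => ENNReal.ofReal (F.1 x * cut W n x)) (F := fun x => ENNReal.ofReal (F.1 x))
      (fun n => (ENNReal.continuous_ofReal.comp (hF.mul (hcutc n))).aemeasurable)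
      (Eventually.of_forall fun x m n hmn => ENNReal.ofReal_le_ofReal
        (mul_le_mul_of_nonneg_left (cut_mono hW0 x hmn) (h0 x)))
      (Eventually.of_forall fun x => by
        have := (cut_tendsto (W := W) x).const_mul (F.1 x)
        rw [mul_one] at this
        exact (ENNReal.continuous_ofReal.tendsto _).comp this)
    have hle : ∫⁻ x, ENNReal.ofReal (F.1 x) ∂ρ ≤ ENNReal.ofReal (l F) := by
      refine le_of_tendsto' hlim fun n => ?_
      rw [← ofReal_integral_eq_lintegral_ofReal (hcut F hF n).1
        (Eventually.of_forall fun x => mul_nonneg (h0 x) (cut_nonneg n x)), (hcut F hF n).2]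
      refine ENNReal.ofReal_le_ofReal (hmono _ _ fun x => ?_)
      exact mul_le_of_le_one_right (h0 x) (cut_le_one n x)
    have hint : Integrable F.1 ρ := by
      refine ⟨hF.aestronglyMeasurable, ?_⟩
      rw [hasFiniteIntegral_iff_ofReal (Eventually.of_forall h0)]
      exact hle.trans_lt ENNReal.ofReal_lt_top
    refine ⟨hint, ?_⟩
    rwa [← ofReal_integral_eq_lintegral_ofReal hint (Eventually.of_forall h0),
      ENNReal.ofReal_le_ofReal_iff (hpos F h0)] at hle
  let WW : growth W := ⟨W, 1, fun x => by rw [one_mul, abs_of_nonneg (hW0 x)]⟩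
  have hWge : l WW ≤ ∫ x, W x ∂ρ := by
    refine le_of_forall_pos_le_add fun ε hε => ?_
    obtain ⟨n, hn⟩ := htail ε hε
    have h1 : l WW = l ⟨_, hcg WW n⟩ + l (WW - ⟨_, hcg WW n⟩) := by
      rw [← map_add]; congr 1; abel
    have h2 := hn (WW - ⟨_, hcg WW n⟩) fun x => by
      change W x - W x * cut W n x = _
      ring
    have h3 := (hcut WW hWc n)
    have h4 : ∫ x, WW.1 x * cut W n x ∂ρ ≤ ∫ x, W x ∂ρ :=
      integral_mono h3.1 (hnn WW hWc hW0).1 fun x =>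
        mul_le_of_le_one_right (hW0 x) (cut_le_one n x)
    rw [h3.2] at h4
    linarith
  have hWi := (hnn WW hWc hW0).1
  intro F hF
  obtain ⟨K, hK⟩ := F.2
  have e1 := hnn (K • WW + F) ((hWc.const_smul K).add hF) fun x => by
    have := (abs_le.1 (hK x)).1
    change 0 ≤ K * W x + F.1 x
    linarith
  have e2 := hnn (K • WW - F) ((hWc.const_smul K).sub hF) fun x => by
    have := (abs_le.1 (hK x)).2
    change 0 ≤ K * W x - F.1 x
    linarith
  have hKi : Integrable (fun x => K * W x) ρ := hWi.const_mul K
  have hFi : Integrable F.1 ρ := by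
    have := e1.1.sub hKi
    refine this.congr (Eventually.of_forall fun x => ?_)
    change K * W x + F.1 x - K * W x = F.1 x
    ring
  refine ⟨hFi, ?_⟩
  have i1 : ∫ x, (K • WW + F).1 x ∂ρ = K * ∫ x, W x ∂ρ + ∫ x, F.1 x ∂ρ := by
    rw [← integral_const_mul, ← integral_add hKi hFi]; rfl
  have i2 : ∫ x, (K • WW - F).1 x ∂ρ = K * ∫ x, W x ∂ρ - ∫ x, F.1 x ∂ρ := by
    rw [← integral_const_mul, ← integral_sub hKi hFi]; rfl
  have i3 : ∫ x, W x ∂ρ = l WW := le_antisymm (hnn WW hWc hW0).2 hWge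
  have e1' := e1.2
  have e2' := e2.2
  rw [i1, map_add, map_smul, i3, smul_eq_mul] at e1'
  rw [i2, map_sub, map_smul, i3, smul_eq_mul] at e2'
  linarith

end
end VM


namespace VM

section
variable {N d : ℕ} {μ : ℕ → Fin d → Measure ℝ}

/-- Growth control functions. -/
def ww (v : ℕ → Fin d → ℝ → ℝ) (t : ℕ) (i : Fin d) (y : ℝ) : ℝ := |v t i y| + |y| + 1

lemma ww_pos (v : ℕ → Fin d → ℝ → ℝ) (t : ℕ) (i : Fin d) (y : ℝ) : 1 ≤ ww v t i y := by
  unfold ww; have := abs_nonneg (v t i y); have := abs_nonneg y; linarith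

lemma stat_single {φ : ℕ → Fin d → ℝ → ℝ} (h0 : ∀ t i y, 0 ≤ φ t i y) {t : ℕ} (ht : t < N)
    (i : Fin d) (x : Pth N d) : φ t i (X t i x) ≤ stat φ x := by
  unfold stat
  refine le_trans ?_ (Finset.single_le_sum (f := fun t => ∑ i, φ t i (X t i x)) (fun t _ => Finset.sum_nonneg fun i _ => h0 t i _) (Finset.mem_range.2 ht))
  exact Finset.single_le_sum (f := fun i => φ t i (X t i x)) (fun i _ => h0 t i _) (Finset.mem_univ i)

lemma stat_mono {φ ψ : ℕ → Fin d → ℝ → ℝ} (x : Pth N d) (h : ∀ t i y, φ t i y ≤ ψ t i y) :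
    stat φ x ≤ stat ψ x :=
  Finset.sum_le_sum fun t _ => Finset.sum_le_sum fun i _ => h t i _

lemma continuous_stat {φ : ℕ → Fin d → ℝ → ℝ} (h : ∀ t i, Continuous (φ t i)) :
    Continuous (stat (N := N) φ) := by
  unfold stat
  exact continuous_finsetSum _ fun t _ => continuous_finsetSum _ fun i _ =>
    (h t i).comp (continuous_X t i)

lemma stat_compact (v : ℕ → Fin d → ℝ → ℝ) (hv : ∀ t i, Continuous (v t i)) (R : ℝ) :
    IsCompact {x : Pth N d | stat (ww v) x ≤ R} := by
  have hc : ∀ t i, Continuous (ww v t i) := fun t i => by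
    unfold ww; have := hv t i; fun_prop
  refine Metric.isCompact_of_isClosed_isBounded
    (isClosed_le (continuous_stat hc) continuous_const) ?_
  refine (Metric.isBounded_closedBall (x := (0 : Pth N d)) (r := |R|)).subset fun x hx => ?_
  rw [mem_closedBall_zero_iff, pi_norm_le_iff_of_nonneg (abs_nonneg R)]
  intro t
  rw [pi_norm_le_iff_of_nonneg (abs_nonneg R)]
  intro i
  have h1 := stat_single (φ := ww v) (fun t i y => zero_le_one.trans (ww_pos v t i y)) t.2 i x
  have h2 : |X (t:ℕ) i x| ≤ ww v t i (X t i x) := by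
    unfold ww; have := abs_nonneg (v t i (X t i x)); linarith
  have h3 : X (t:ℕ) i x = x t i := by simp [X]
  rw [h3] at h2 h1
  exact (h2.trans h1).trans (le_trans hx (le_abs_self R))

lemma tail_le (v : ℕ → Fin d → ℝ → ℝ) (n : ℕ) (hN : 0 < N) (hd : 0 < d) (x : Pth N d) :
    stat (ww v) x * (1 - cut (stat (ww v)) n x) ≤
      stat (fun t i y => if (n:ℝ) + 1 < N * d * ww v t i y then N * d * ww v t i y else 0) x := by
  set M : ℝ := N * d
  have hM : 0 < M := by positivity
  have h0 : ∀ (t : ℕ) (i : Fin d) (y : ℝ), 0 ≤ (if (n:ℝ) + 1 < M * ww v t i y then M * ww v t i y else 0) := by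
    intro t i y
    have := ww_pos v t i y
    split_ifs
    · positivity
    · exact le_rfl
  have hW0 : 0 ≤ stat (ww v) x := Finset.sum_nonneg fun t _ => Finset.sum_nonneg fun i _ =>
    zero_le_one.trans (ww_pos v t i _)
  by_cases hx : stat (ww v) x ≤ n + 1
  · rw [cut_eq_one hx]
    simp only [sub_self, mul_zero]
    exact Finset.sum_nonneg fun t _ => Finset.sum_nonneg fun i _ => h0 t i _
  · push Not at hx
    have hle : stat (ww v) x * (1 - cut (stat (ww v)) n x) ≤ stat (ww v) x :=
      mul_le_of_le_one_right hW0 (by have := cut_nonneg (W := stat (ww v)) n x; linarith)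
    obtain ⟨t, ht, i, hi⟩ : ∃ t, t < N ∧ ∃ i, stat (ww v) x ≤ M * ww v t i (X t i x) := by
      by_contra hcon
      push Not at hcon
      have : ∑ t ∈ Finset.range N, ∑ i : Fin d, M * ww v t i (X t i x) <
          ∑ t ∈ Finset.range N, ∑ i : Fin d, stat (ww v) x := by
        refine Finset.sum_lt_sum_of_nonempty ⟨0, Finset.mem_range.2 hN⟩ fun t ht => ?_
        have : Nonempty (Fin d) := ⟨⟨0, hd⟩⟩
        exact Finset.sum_lt_sum_of_nonempty Finset.univ_nonempty fun i _ =>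
          hcon t (Finset.mem_range.1 ht) i
      simp only [← Finset.mul_sum, Finset.sum_const, Finset.card_range, Finset.card_univ,
        Fintype.card_fin, nsmul_eq_mul, ← mul_assoc] at this
      refine lt_irrefl _ (this.trans_le ?_)
      rw [mul_comm (d:ℝ)]
      exact le_rfl
    refine hle.trans (le_trans ?_ (stat_single h0 ht i x))
    rw [if_pos (hx.trans_le hi)]
    exact hi

lemma tail_val (v : ℕ → Fin d → ℝ → ℝ) (hp : ∀ t < N, ∀ i, Integrable (ww v t i) (μ t i))
    (hm : ∀ t i, Measurable (ww v t i)) (M : ℝ) (hM : 0 ≤ M) :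
    Tendsto (fun n : ℕ => val N μ (fun t i y => if (n:ℝ) + 1 < M * ww v t i y then M * ww v t i y else 0))
      atTop (nhds 0) := by
  have hz : ∑ t ∈ Finset.range N, ∑ i : Fin d, ∫ y, (0:ℝ) ∂(μ t i) = 0 := by simp
  refine Tendsto.mono_right ?_ (le_of_eq (congrArg nhds hz))
  unfold val
  refine tendsto_finsetSum _ fun t ht => tendsto_finsetSum _ fun i _ => ?_
  refine tendsto_integral_of_dominated_convergence (fun y => M * ww v t i y) (fun n => ?_)
    ((hp t (Finset.mem_range.1 ht) i).const_mul M) (fun n => Eventually.of_forall fun y => ?_)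
    (Eventually.of_forall fun y => ?_)
  · refine Measurable.aestronglyMeasurable ?_
    exact Measurable.ite (measurableSet_lt measurable_const ((hm t i).const_mul M))
      ((hm t i).const_mul M) measurable_const
  · have := ww_pos v t i y
    have : 0 ≤ M * ww v t i y := by positivity
    beta_reduce
    split_ifs
    · rw [Real.norm_of_nonneg this]
    · simpa using this
  · obtain ⟨n0, hn0⟩ := exists_nat_gt (M * ww v t i y)
    refine tendsto_const_nhds.congr' ?_
    filter_upwards [eventually_ge_atTop n0] with n hn
    have : (n0:ℝ) ≤ n := by exact_mod_cast hn
    rw [if_neg (by linarith)]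

/-- Strong duality (approximate dual optimizers). -/
lemma exists_subhedge {π : Measure (Pth N d)} (hN : 0 < N) (hd : 0 < d) (hπ : Mart μ π)
    {c : Pth N d → ℝ} (hc : LowerSemicontinuous c) {v : ℕ → Fin d → ℝ → ℝ}
    (hvc : ∀ t i, Continuous (v t i)) (hvi : ∀ t < N, ∀ i, Integrable (v t i) (μ t i))
    (hcb : ∀ x, |c x| ≤ stat v x)
    (hmin : ∀ ρ : Measure (Pth N d), Mart μ ρ → ∫ x, c x ∂π ≤ ∫ x, c x ∂ρ) :
    ∀ ε > 0, ∃ φ H, GoodP N μ φ ∧ GoodH H ∧ (∀ x, stat φ x + trade H x ≤ c x) ∧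
      ∫ x, c x ∂π - ε < val N μ φ := by
  intro ε hε
  have hprobμ : ∀ t < N, ∀ i, IsProbabilityMeasure (μ t i) := fun t ht i => by
    have := hπ.prob
    rw [← hπ.marg t ht i]
    exact Measure.isProbabilityMeasure_map (measurable_X t i).aemeasurable
  have hwc : ∀ t i, Continuous (ww v t i) := fun t i => by
    unfold ww; have := hvc t i; fun_prop
  have hwm : ∀ t i, Measurable (ww v t i) := fun t i => (hwc t i).measurable
  have hwi : ∀ t < N, ∀ i, Integrable (ww v t i) (μ t i) := fun t ht i => by
    have := hprobμ t ht i
    have h1 : Integrable (fun y : ℝ => y) (μ t i) := by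
      have h2 := hπ.int t ht i
      rw [← hπ.marg t ht i]
      exact (integrable_map_measure (by fun_prop) (measurable_X t i).aemeasurable).2 h2
    exact ((hvi t ht i).abs.add h1.abs).add (integrable_const 1)
  have hwP : GoodP N μ (ww v) := fun t i => ⟨hwm t i, fun h => hwi t h i⟩
  set W : Pth N d → ℝ := stat (ww v) with hW
  have hWc : Continuous W := continuous_stat hwc
  have hW1 : ∀ x, 1 ≤ W x := fun x =>
    (ww_pos v 0 ⟨0, hd⟩ _).trans (stat_single (fun t i y => zero_le_one.trans (ww_pos v t i y)) hN ⟨0, hd⟩ x)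
  have hsingle : ∀ t < N, ∀ i x, ww v t i (X t i x) ≤ W x := fun t ht i x =>
    stat_single (fun t i y => zero_le_one.trans (ww_pos v t i y)) ht i x
  have hWi : Integrable W π := (hπ.stat hwP).1
  have hH0 : GoodH (N := N) (d := d) (fun t i _ => (fun _ _ => (0:ℝ)) t i) := GoodH.const _
  have htr0 : ∀ x : Pth N d, trade (fun t i _ => (fun _ _ => (0:ℝ)) t i) x = 0 := fun x => by
    simp [trade]
  have hne : ∀ F ∈ growth W, (hset N μ F).Nonempty := by
    rintro F ⟨K, hK⟩
    refine ⟨_, _, _, hwP.smul K, hH0, fun x => ?_, rfl⟩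
    rw [stat_smul, htr0, add_zero]
    exact (le_abs_self _).trans (hK x)
  have hvW : ∀ x, stat v x ≤ W x := fun x => stat_mono x fun t i y => by
    unfold ww; have := le_abs_self (v t i y); have := abs_nonneg y; linarith
  have hvg : stat v ∈ growth W := ⟨1, fun x => by
    rw [abs_of_nonneg ((abs_nonneg _).trans (hcb x)), one_mul]; exact hvW x⟩
  have hcg : c ∈ growth W := growth_of_le hvg hcb
  obtain ⟨l, hl, hl0⟩ := exists_functional hπ hWi hne (-⟨c, hcg⟩)
  have hpos : ∀ F : growth W, (∀ x, 0 ≤ F.1 x) → 0 ≤ l F := by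
    intro F hF
    have := hl (-F) 0 ⟨_, _, GoodP.zero, hH0, fun x => by
      rw [htr0]
      simp only [stat, Finset.sum_const_zero, add_zero]
      exact neg_nonpos.2 (hF x), by simp [val]⟩
    rw [map_neg] at this
    linarith
  have hlmono : ∀ F G : growth W, (∀ x, F.1 x ≤ G.1 x) → l F ≤ l G := by
    intro F G h
    have := hpos (G - F) fun x => sub_nonneg.2 (h x)
    rw [map_sub] at this
    linarith
  have htail : ∀ ε > 0, ∃ n, ∀ F : growth W, (∀ x, F.1 x = W x * (1 - cut W n x)) → l F ≤ ε := by
    intro ε hε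
    have h1 := (tail_val (N := N) v hwi hwm (N * d) (by positivity)).eventually_lt_const hε
    obtain ⟨n, hn⟩ := h1.exists
    refine ⟨n, fun F hF => (hl F _ ⟨_, _, ?_, hH0, fun x => ?_, rfl⟩).trans hn.le⟩
    · intro t i
      refine ⟨Measurable.ite (measurableSet_lt measurable_const ((hwm t i).const_mul _))
        ((hwm t i).const_mul _) measurable_const, fun ht => ?_⟩
      refine Integrable.mono' ((hwi t ht i).const_mul (N * d : ℝ)) (Measurable.aestronglyMeasurable (Measurable.ite (measurableSet_lt measurable_const ((hwm t i).const_mul _))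
        ((hwm t i).const_mul _) measurable_const)) (Eventually.of_forall fun y => ?_)
      have := ww_pos v t i y
      have : 0 ≤ (N * d : ℝ) * ww v t i y := by positivity
      beta_reduce
      split_ifs
      · rw [Real.norm_of_nonneg this]
      · simpa using this
    · rw [hF, htr0, add_zero]
      exact tail_le v n hN hd x
  obtain ⟨ρ, hρ⟩ := riesz_growth hWc hW1 (stat_compact v hvc) l hpos htail
  have hbdg : ∀ F : Pth N d → ℝ, (∃ C, ∀ x, |F x| ≤ C) → F ∈ growth W := by
    rintro F ⟨C, hC⟩
    refine ⟨|C|, fun x => (hC x).trans ((le_abs_self C).trans ?_)⟩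
    exact le_mul_of_one_le_right (abs_nonneg C) (hW1 x)
  -- marginals identity for l
  have hlP : ∀ φ : ℕ → Fin d → ℝ → ℝ, GoodP N μ φ → ∀ F : growth W, (∀ x, F.1 x = stat φ x) →
      l F = val N μ φ := by
    intro φ hφ F hF
    refine le_antisymm (hl F _ ⟨φ, _, hφ, hH0, fun x => ?_, rfl⟩) ?_
    · rw [htr0, hF, add_zero]
    · have h2 := hl (-F) _ ⟨_, _, hφ.smul (-1), hH0, fun x => ?_, rfl⟩
      · rw [map_neg, val_smul] at h2
        linarith
      · rw [htr0, stat_smul]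
        change -F.1 x ≤ _
        rw [hF]
        linarith
  have hlsingle : ∀ g : ℝ → ℝ, Continuous g → (∃ C, ∀ y, |g y| ≤ C) → ∀ t < N, ∀ i,
      ∫ x, g (X t i x) ∂ρ = ∫ y, g y ∂(μ t i) := by
    intro g hg hb t ht i
    have := hprobμ t ht i
    have e1 := hρ ⟨fun x => g (X t i x), hbdg _ (hb.imp fun C hC x => hC _)⟩
      (hg.comp (continuous_X t i))
    have hgi : Integrable g (μ t i) := by
      obtain ⟨C, hC⟩ := hb
      exact Integrable.of_bound hg.aestronglyMeasurable C (Eventually.of_forall hC)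
    have e2 := hlP (fun s j y => if s = t ∧ j = i then g y else 0) (fun s j => by
      by_cases h : s = t ∧ j = i
      · simp only [h, and_self, if_true]
        exact ⟨hg.measurable, fun _ => hgi⟩
      · simp only [h, if_false]
        exact ⟨measurable_const, fun _ => integrable_zero _ _ _⟩)
      ⟨fun x => g (X t i x), hbdg _ (hb.imp fun C hC x => hC _)⟩ (fun x => by
        simp only [stat, ite_and]
        rw [Finset.sum_eq_single t]
        · simp
        · intro s _ hs; simp [hs]
        · intro h; exact absurd (Finset.mem_range.2 ht) h)
    rw [e1.2, e2]
    simp only [val]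
    rw [Finset.sum_eq_single t, Finset.sum_eq_single i]
    · simp
    · intro j _ hj; simp [hj]
    · intro h; exact absurd (Finset.mem_univ _) h
    · intro s _ hs; simp [hs]
    · intro h; exact absurd (Finset.mem_range.2 ht) h
  have hconst : ∀ a : ℝ, Integrable (fun _ : Pth N d => a) ρ := fun a =>
    (hρ ⟨fun _ => a, hbdg _ ⟨|a|, fun _ => le_rfl⟩⟩ continuous_const).1
  have hfin : IsFiniteMeasure ρ := by
    have := hconst 1
    rw [integrable_const_iff] at this
    rcases this with h | h
    · exact absurd h one_ne_zero
    · exact h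
  have hprob : IsProbabilityMeasure ρ := by
    have := hlsingle (fun _ => 1) continuous_const ⟨1, fun _ => by simp⟩ 0 hN ⟨0, hd⟩
    have := hprobμ 0 hN ⟨0, hd⟩
    simp only [integral_const, smul_eq_mul, mul_one, probReal_univ] at *
    exact ⟨by rw [← ENNReal.toReal_eq_one_iff]; assumption⟩
  have hXg : ∀ t < N, ∀ i x, |X t i x| ≤ W x := fun t ht i x => by
    refine le_trans ?_ (hsingle t ht i x)
    unfold ww; have := abs_nonneg (v t i (X t i x)); linarith
  have hint : ∀ t < N, ∀ i, Integrable (X t i) ρ := fun t ht i =>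
    (hρ ⟨X t i, 1, fun x => by rw [one_mul]; exact hXg t ht i x⟩ (continuous_X t i)).1
  have hMart : Mart μ ρ := by
    refine ⟨hprob, fun t ht i => ?_, hint, fun t ht i => ?_⟩
    · have := hprobμ t ht i
      have : IsFiniteMeasure (ρ.map (X t i)) := Measure.isFiniteMeasure_map _ _
      refine ext_of_forall_integral_eq_of_IsFiniteMeasure fun g => ?_
      rw [integral_map (measurable_X t i).aemeasurable g.continuous.aestronglyMeasurable]
      exact hlsingle g g.continuous ⟨‖g‖, fun z => g.norm_coe_le_norm z⟩ t ht i
    · refine mart_of_cont (by fun_prop) ((hint _ ht i).sub (hint t (by omega) i)) ?_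
      intro H hH hA hb
      have hgr : (fun x => H x * (X (t+1) i x - X t i x)) ∈ growth W := by
        obtain ⟨C, hC⟩ := hb
        refine ⟨C * 2, fun x => ?_⟩
        rw [abs_mul, mul_assoc]
        have h1 := hXg (t+1) ht i x
        have h2 := hXg t (by omega) i x
        exact mul_le_mul (hC x) ((abs_sub _ _).trans (by linarith)) (abs_nonneg _)
          ((abs_nonneg _).trans (hC x))
      have e1 := hρ ⟨_, hgr⟩ (hH.mul ((continuous_X _ i).sub (continuous_X _ i)))
      rw [e1.2]
      have hgood : ∀ a : ℝ, GoodH (N := N) (fun s j x => if s = t ∧ j = i then a * H x else 0) := by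
        intro a s j
        by_cases h : s = t ∧ j = i
        · simp only [h, and_self, if_true]
          refine ⟨(hH.measurable).const_mul a, fun x y hxy => by simp only [hA x y hxy], ?_⟩
          obtain ⟨C, hC⟩ := hb
          exact ⟨|a| * C, fun x => by
            rw [abs_mul]; exact mul_le_mul_of_nonneg_left (hC x) (abs_nonneg a)⟩
        · simp only [h, if_false]
          exact ⟨measurable_const, fun _ _ _ => rfl, 0, fun _ => by simp⟩
      have htr : ∀ a x, trade (fun s j x => if s = t ∧ j = i then a * H x else 0) x =
          a * (H x * (X (t+1) i x - X t i x)) := by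
        intro a x
        simp only [trade, ite_and]
        rw [Finset.sum_eq_single t, Finset.sum_eq_single i]
        · simp [mul_assoc]
        · intro j _ hj; simp [hj]
        · intro h; exact absurd (Finset.mem_univ _) h
        · intro s _ hs; simp [hs]
        · intro h; exact absurd (Finset.mem_range.2 (by omega)) h
      refine le_antisymm ?_ ?_
      · have := hl ⟨_, hgr⟩ 0 ⟨_, _, GoodP.zero, hgood 1, fun x => by
          rw [htr]; simp [stat], by simp [val]⟩
        exact this
      · have := hl (-⟨_, hgr⟩) 0 ⟨_, _, GoodP.zero, hgood (-1), fun x => by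
          rw [htr]; simp [stat], by simp [val]⟩
        rw [map_neg] at this
        linarith
  -- the integral of c is at most l c
  have hvP : GoodP N μ v := fun t i => ⟨(hvc t i).measurable, fun h => hvi t h i⟩
  have hcl : ∫ x, c x ∂ρ ≤ l ⟨c, hcg⟩ := by
    have hlsc : LowerSemicontinuous fun x => c x + stat v x :=
      hc.add (continuous_stat hvc).lowerSemicontinuous
    obtain ⟨f, f1, f2, f3, f4, f5⟩ := lsc_approx hlsc fun x => by
      have := (abs_le.1 (hcb x)).1; linarith
    have hsv := (hMart.stat hvP).1
    have hcm : Measurable c := hc.measurable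
    have hci : Integrable c ρ := hsv.mono' hcm.aestronglyMeasurable (Eventually.of_forall hcb)
    have hfb : ∀ n x, |f n x - stat v x| ≤ stat v x := fun n x => by
      have := f2 n x; have := f3 n x; have := (abs_le.1 (hcb x)).2
      rw [abs_le]; constructor <;> linarith
    have hg : ∀ n, (fun x => f n x - stat v x) ∈ growth W := fun n => growth_of_le hvg (hfb n)
    have e := fun n => hρ ⟨_, hg n⟩ ((f1 n).sub (continuous_stat hvc))
    have hlim : Tendsto (fun n => ∫ x, (f n x - stat v x) ∂ρ) atTop (nhds (∫ x, c x ∂ρ)) := by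
      refine tendsto_integral_of_dominated_convergence (stat v)
        (fun n => ((f1 n).sub (continuous_stat hvc)).aestronglyMeasurable) hsv
        (fun n => Eventually.of_forall (hfb n)) (Eventually.of_forall fun x => ?_)
      have := (f5 x).sub_const (stat v x)
      simpa using this
    refine le_of_tendsto' hlim fun n => ?_
    rw [(e n).2]
    exact hlmono _ _ fun x => by have := f3 n x; change f n x - stat v x ≤ c x; linarith
  obtain ⟨r, ⟨φ, H, h1, h2, h3, rfl⟩, hr⟩ := hl0 ε hε
  rw [map_neg] at hr
  refine ⟨_, _, h1.smul (-1), h2.smul (-1), fun x => ?_, ?_⟩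
  · rw [stat_smul, trade_smul]
    have := h3 x
    change -c x ≤ _ at this
    linarith
  · rw [val_smul]
    have := hmin ρ hMart
    linarith

end
end VM


namespace VM

/-- `r` is a subgradient selection of `χ`. -/
def Subg (χ r : ℝ → ℝ) : Prop := ∀ x y, χ x + r x * (y - x) ≤ χ y

lemma exists_subg {f : ℝ → ℝ} (hf : ConvexOn ℝ Set.univ f) : ∃ r, Subg f r := by
  refine ⟨fun x => derivWithin f (Set.Ioi x) x, fun x y => ?_⟩
  have hx : x ∈ interior (Set.univ : Set ℝ) := by simp
  rcases lt_trichotomy x y with h | h | h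
  · have := hf.rightDeriv_le_slope_of_mem_interior hx (Set.mem_univ y) h
    rw [slope_def_field, le_div_iff₀ (by linarith)] at this
    linarith
  · subst h; simp
  · have h1 := hf.slope_le_leftDeriv_of_mem_interior (Set.mem_univ y) hx h
    have h2 := h1.trans (hf.leftDeriv_le_rightDeriv_of_mem_interior hx)
    rw [slope_def_field, div_le_iff₀ (by linarith)] at h2
    linarith

lemma Subg.mono {χ r : ℝ → ℝ} (h : Subg χ r) : Monotone r := by
  intro x y hxy
  rcases hxy.eq_or_lt with rfl | hlt
  · exact le_rfl
  · have h1 := h x y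
    have h2 := h y x
    have : 0 ≤ (r y - r x) * (y - x) := by nlinarith
    have := nonneg_of_mul_nonneg_left this (by linarith)
    linarith

lemma Subg.convex {χ r : ℝ → ℝ} (h : Subg χ r) : ConvexOn ℝ Set.univ χ := by
  refine ⟨convex_univ, fun x _ y _ a b ha hb hab => ?_⟩
  simp only [smul_eq_mul]
  have h1 := mul_le_mul_of_nonneg_left (h (a * x + b * y) x) ha
  have h2 := mul_le_mul_of_nonneg_left (h (a * x + b * y) y) hb
  have : a * (x - (a * x + b * y)) + b * (y - (a * x + b * y)) = 0 := by
    obtain rfl : b = 1 - a := by linarith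
    ring
  have h3 : a * (r (a * x + b * y) * (x - (a * x + b * y))) + b * (r (a * x + b * y) * (y - (a * x + b * y))) = 0 := by
    linear_combination r (a * x + b * y) * this
  have h4 : a * χ (a * x + b * y) + b * χ (a * x + b * y) = χ (a * x + b * y) := by
    rw [← add_mul, hab, one_mul]
  linarith

lemma Subg.continuous {χ r : ℝ → ℝ} (h : Subg χ r) : Continuous χ := by
  have := h.convex.continuousOn isOpen_univ
  rwa [continuousOn_univ] at this

/-- Concave envelope through affine majorants. -/
lemma exists_envelope {ψ : ℝ → ℝ} {x0 p q : ℝ} (h0 : ∀ y, ψ y ≤ p + q * (y - x0)) :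
    ∃ g : ℝ → ℝ, ConvexOn ℝ Set.univ (fun y => - g y) ∧ (∀ y, ψ y ≤ g y) ∧
      ∀ p q x, (∀ y, ψ y ≤ p + q * (y - x)) → g x ≤ p := by
  let A := {a : ℝ × ℝ // ∀ y, ψ y ≤ a.1 + a.2 * y}
  let g : ℝ → ℝ := fun y => ⨅ a : A, (a.1.1 + a.1.2 * y)
  have hne : Nonempty A := ⟨⟨(p - q * x0, q), fun y => by have := h0 y; simp only; linarith⟩⟩
  have hb : ∀ y, BddBelow (Set.range fun a : A => a.1.1 + a.1.2 * y) := fun y =>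
    ⟨ψ y, by rintro _ ⟨a, rfl⟩; exact a.2 y⟩
  refine ⟨g, ⟨convex_univ, fun x _ y _ a b ha hb' hab => ?_⟩, fun y => le_ciInf fun a => a.2 y, ?_⟩
  · simp only [smul_eq_mul]
    have : a * g x + b * g y ≤ g (a * x + b * y) := by
      refine le_ciInf fun e => ?_
      have h1 := mul_le_mul_of_nonneg_left (ciInf_le (hb x) e) ha
      have h2 := mul_le_mul_of_nonneg_left (ciInf_le (hb y) e) hb'
      have h3 : e.1.1 + e.1.2 * (a * x + b * y) =
          a * (e.1.1 + e.1.2 * x) + b * (e.1.1 + e.1.2 * y) := by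
        obtain rfl : b = 1 - a := by linarith
        ring
      rw [h3]
      exact add_le_add h1 h2
    linarith
  · intro p q x h
    have := ciInf_le (hb x) (⟨(p - q * x, q), fun y => by have := h y; simp only; linarith⟩ : A)
    simp only at this
    exact this.trans (by linarith)

/-- Backward induction: a one-dimensional semi-static superhedge of zero splits. -/
lemma decomp (n : ℕ) : ∀ (ψ : ℕ → ℝ → ℝ) (h : ℕ → (ℕ → ℝ) → ℝ) (C : ℝ),
    (∀ t z z', (∀ s ≤ t, z s = z' s) → h t z = h t z') →
    (∀ z : ℕ → ℝ, ∑ t ∈ Finset.range (n + 1), ψ t (z t) +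
      ∑ t ∈ Finset.range n, h t z * (z (t + 1) - z t) ≤ C) →
    ∃ χ : ℕ → ℝ → ℝ, (∀ t, ConvexOn ℝ Set.univ (χ t)) ∧ (∀ y, χ 0 y = 0) ∧
      (∀ y, χ (n + 1) y = 0) ∧
      ∀ t ≤ n, ∀ y, ψ t y ≤ (if t = 0 then C else 0) + χ (t + 1) y - χ t y := by
  induction n with
  | zero =>
    intro ψ h C _ hle
    refine ⟨fun _ _ => 0, fun _ => convexOn_const _ convex_univ, fun _ => rfl, fun _ => rfl,
      fun t ht y => ?_⟩
    obtain rfl : t = 0 := by omega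
    have := hle fun _ => y
    simpa using this
  | succ n ih =>
    intro ψ h C hh hle
    have hmaj : ∀ z : ℕ → ℝ, ∀ y, ψ (n + 1) y ≤ (C - ∑ t ∈ Finset.range (n + 1), ψ t (z t) -
        ∑ t ∈ Finset.range n, h t z * (z (t + 1) - z t)) + (- h n z) * (y - z n) := by
      intro z y
      have h1 := hle (Function.update z (n + 1) y)
      rw [Finset.sum_range_succ, Finset.sum_range_succ (fun t => h t _ * _)] at h1
      have e1 : ∑ t ∈ Finset.range (n + 1), ψ t (Function.update z (n + 1) y t) =
          ∑ t ∈ Finset.range (n + 1), ψ t (z t) := by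
        refine Finset.sum_congr rfl fun t ht => ?_
        rw [Function.update_of_ne (by have := Finset.mem_range.1 ht; omega)]
      have eh : ∀ t ≤ n, h t (Function.update z (n + 1) y) = h t z := fun t ht => by
        refine hh t _ _ fun s hs => ?_
        rw [Function.update_of_ne (by omega)]
      have e2 : ∑ t ∈ Finset.range n, h t (Function.update z (n + 1) y) *
            (Function.update z (n + 1) y (t + 1) - Function.update z (n + 1) y t) =
          ∑ t ∈ Finset.range n, h t z * (z (t + 1) - z t) := by
        refine Finset.sum_congr rfl fun t ht => ?_
        have := Finset.mem_range.1 ht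
        rw [Function.update_of_ne (by omega), Function.update_of_ne (by omega), eh t (by omega)]
      rw [e1, e2, eh n le_rfl, Function.update_self, Function.update_of_ne (by omega)] at h1
      linarith
    obtain ⟨g, g1, g2, g3⟩ := exists_envelope (hmaj fun _ => 0)
    obtain ⟨χ, c1, c2, c3, c4⟩ := ih (fun t y => ψ t y + if t = n then g y else 0) h C hh (by
      intro z
      have h1 := g3 _ _ _ (hmaj z)
      rw [Finset.sum_add_distrib, Finset.sum_ite_eq' (Finset.range (n+1)) n (fun t => g (z t)),
        if_pos (Finset.self_mem_range_succ n)]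
      linarith)
    refine ⟨fun t => if t ≤ n then χ t else if t = n + 1 then fun y => - g y else fun _ => 0,
      fun t => ?_, fun y => ?_, fun y => ?_, fun t ht y => ?_⟩
    · beta_reduce
      split_ifs
      · exact c1 t
      · exact g1
      · exact convexOn_const _ convex_univ
    · simp [c2]
    · simp
    · beta_reduce
      rcases Nat.lt_or_ge t n with h1 | h1
      · have := c4 t h1.le y
        rw [if_neg (by omega : ¬ t = n), add_zero] at this
        rwa [if_pos (by omega : t + 1 ≤ n), if_pos (by omega : t ≤ n)]
      · rcases h1.eq_or_lt with rfl | h2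
        · have := c4 n le_rfl y
          rw [if_pos rfl, c3] at this
          rw [if_neg (by omega : ¬ n + 1 ≤ n), if_pos rfl, if_pos le_rfl]
          linarith
        · obtain rfl : t = n + 1 := by omega
          have := g2 y
          simp
          linarith

end VM


namespace VM

section
variable {N d : ℕ} {μ : ℕ → Fin d → Measure ℝ} {π : Measure (Pth N d)}

lemma slack (hπ : Mart μ π) {t : ℕ} (ht : t + 1 < N) (i : Fin d) {F : Pth N d → ℝ}
    (hF : Integrable F π) {r : ℝ → ℝ} (hr : Monotone r)
    (h : ∀ x, r (X t i x) * (X (t + 1) i x - X t i x) ≤ F x) :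
    0 ≤ ∫ x, F x ∂π ∧
    ∫⁻ x, ENNReal.ofReal (F x - r (X t i x) * (X (t + 1) i x - X t i x)) ∂π ≤
      ENNReal.ofReal (∫ x, F x ∂π) := by
  have hrm : Measurable r := hr.measurable
  -- truncation
  let A : ℕ → Set (Pth N d) := fun n => {x | |X t i x| ≤ n}
  have hA : ∀ n, MeasurableSet (A n) := fun n =>
    measurableSet_le (measurable_X t i).abs measurable_const
  let T : ℕ → Pth N d → ℝ := fun n => (A n).indicator fun _ => 1
  have hTm : ∀ n, Measurable (T n) := fun n => measurable_const.indicator (hA n)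
  have hT1 : ∀ n x, T n x = 0 ∨ T n x = 1 := fun n x => by
    by_cases hx : x ∈ A n
    · right; exact Set.indicator_of_mem hx _
    · left; exact Set.indicator_of_notMem hx _
  have hTe : ∀ x, ∀ᶠ n in atTop, T n x = 1 := fun x => by
    obtain ⟨n0, hn0⟩ := exists_nat_ge |X t i x|
    filter_upwards [eventually_ge_atTop n0] with n hn
    refine Set.indicator_of_mem ?_ _
    exact hn0.trans (by exact_mod_cast hn)
  let D : Pth N d → ℝ := fun x => F x - r (X t i x) * (X (t + 1) i x - X t i x)
  have hD0 : ∀ x, 0 ≤ D x := fun x => sub_nonneg.2 (h x)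
  have hbd : ∀ n, ∃ C, ∀ x, |T n x * r (X t i x)| ≤ C := by
    intro n
    refine ⟨|r (-n)| + |r n|, fun x => ?_⟩
    by_cases hx : x ∈ A n
    · have e : T n x = 1 := Set.indicator_of_mem hx _
      rw [e, one_mul]
      have hx' := abs_le.1 (show |X t i x| ≤ n from hx)
      have h1 := hr hx'.1
      have h2 := hr hx'.2
      have := neg_abs_le (r (-n)); have := le_abs_self (r n)
      have := abs_nonneg (r (-n)); have := abs_nonneg (r n)
      rw [abs_le]
      constructor <;> linarith
    · have e : T n x = 0 := Set.indicator_of_notMem hx _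
      rw [e, zero_mul, abs_zero]
      positivity
  have hAdT : ∀ n, Adp t (fun x => T n x * r (X t i x)) := by
    intro n x y hxy
    have e := adp_X (le_refl t) i x y hxy
    have : T n x = T n y := by
      simp only [T, A, Set.indicator, Set.mem_ofPred_eq, e]
    simp only [this, e]
  have hmr : ∀ n, Measurable (fun x => T n x * r (X t i x)) := fun n =>
    (hTm n).mul (hrm.comp (measurable_X t i))
  have hTF : ∀ n, Integrable (fun x => T n x * F x) π := fun n =>
    hF.bdd_mul (c := 1) (hTm n).aestronglyMeasurable (Eventually.of_forall fun x => by
      rcases hT1 n x with e | e <;> simp [e])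
  have hI := fun n => hπ.integrable_incr ht i (hmr n) (hbd n)
  have hTD : ∀ n, Integrable (fun x => T n x * D x) π ∧ ∫ x, T n x * D x ∂π = ∫ x, T n x * F x ∂π := by
    intro n
    have e : (fun x => T n x * D x) = fun x => T n x * F x -
        T n x * r (X t i x) * (X (t + 1) i x - X t i x) := by
      funext x; simp only [D]; ring
    rw [e]
    refine ⟨(hTF n).sub (hI n), ?_⟩
    rw [integral_sub (hTF n) (hI n), hπ.mart t ht i _ (hmr n) (hAdT n) (hbd n), sub_zero]
  have hTD0 : ∀ n x, 0 ≤ T n x * D x := fun n x => by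
    rcases hT1 n x with e | e <;> simp [e, hD0]
  have hlim : Tendsto (fun n => ∫ x, T n x * F x ∂π) atTop (nhds (∫ x, F x ∂π)) := by
    refine tendsto_integral_of_dominated_convergence (fun x => |F x|)
      (fun n => (hTF n).1) hF.abs (fun n => Eventually.of_forall fun x => ?_)
      (Eventually.of_forall fun x => ?_)
    · rcases hT1 n x with e | e <;> simp [e]
    · refine tendsto_const_nhds.congr' ?_
      filter_upwards [hTe x] with n hn
      rw [hn, one_mul]
  constructor
  · refine ge_of_tendsto' hlim fun n => ?_
    rw [← (hTD n).2]
    exact integral_nonneg (hTD0 n)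
  · have h1 : ∀ x, ENNReal.ofReal (D x) = liminf (fun n => ENNReal.ofReal (T n x * D x)) atTop := by
      intro x
      refine (Tendsto.liminf_eq ?_).symm
      refine tendsto_const_nhds.congr' ?_
      filter_upwards [hTe x] with n hn
      rw [hn, one_mul]
    have h2 : ∫⁻ x, ENNReal.ofReal (D x) ∂π ≤
        liminf (fun n => ∫⁻ x, ENNReal.ofReal (T n x * D x) ∂π) atTop := by
      simp only [h1]
      exact lintegral_liminf_le' fun n => (hTD n).1.1.aemeasurable.ennreal_ofReal
    refine h2.trans (le_of_eq ?_)
    refine Tendsto.liminf_eq ?_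
    have e : (fun n => ∫⁻ x, ENNReal.ofReal (T n x * D x) ∂π) =
        fun n => ENNReal.ofReal (∫ x, T n x * F x ∂π) := by
      funext n
      rw [← (hTD n).2, ofReal_integral_eq_lintegral_ofReal (hTD n).1
        (Eventually.of_forall (hTD0 n))]
    rw [e]
    exact (ENNReal.continuous_ofReal.tendsto _).comp hlim

/-- Jensen-type integrability transfer. -/
lemma subg_int (hπ : Mart μ π) {t : ℕ} (ht : t + 1 < N) (i : Fin d) {χ r : ℝ → ℝ}
    (hs : Subg χ r) (h0 : ∀ y, 0 ≤ χ y) (hi : Integrable χ (μ (t + 1) i)) :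
    Integrable χ (μ t i) := by
  have hc := hs.continuous
  have hY := hπ.integrable_comp ht i hi
  have h1 := (slack hπ ht i hY hs.mono fun x => by
    have := hs (X t i x) (X (t+1) i x)
    have := h0 (X t i x)
    linarith).2
  rw [← hπ.marg t (by omega) i]
  refine (integrable_map_measure hc.aestronglyMeasurable (measurable_X t i).aemeasurable).2 ?_
  refine ⟨(hc.measurable.comp (measurable_X t i)).aestronglyMeasurable, ?_⟩
  change HasFiniteIntegral (fun x => χ (X t i x)) π
  rw [hasFiniteIntegral_iff_ofReal (Eventually.of_forall fun x => h0 _)]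
  refine lt_of_le_of_lt (lintegral_mono fun x => ENNReal.ofReal_le_ofReal ?_)
    (h1.trans_lt ENNReal.ofReal_lt_top)
  have := hs (X t i x) (X (t+1) i x)
  linarith

/-- Normalized approximate dual optimizers. -/
structure Adm (μ : ℕ → Fin d → Measure ℝ) (c : Pth N d → ℝ) (v : ℕ → Fin d → ℝ → ℝ)
    (m : ℕ → Fin d → ℝ) (C P ε : ℝ) (φ : ℕ → Fin d → ℝ → ℝ) (H : ℕ → Fin d → Pth N d → ℝ)
    (χ r : ℕ → Fin d → ℝ → ℝ) : Prop where
  gp : GoodP N μ φ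
  gh : GoodH H
  le : ∀ x, stat φ x + trade H x ≤ c x
  va : P - ε ≤ val N μ φ
  sub : ∀ t i, Subg (χ t i) (r t i)
  zc : ∀ t i, χ t i (m t i) = 0
  zr : ∀ t i, r t i (m t i) = 0
  z0 : ∀ i y, χ 0 i y = 0
  zN : ∀ i y, χ N i y = 0
  int : ∀ t < N, ∀ i, Integrable (χ t i) (μ t i) ∧ Integrable (χ (t + 1) i) (μ t i)
  dom : ∀ t < N, ∀ i y, φ t i y - v t i y ≤ C + χ (t + 1) i y - χ t i y

lemma Adm.nonneg {c : Pth N d → ℝ} {v : ℕ → Fin d → ℝ → ℝ}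
    {m : ℕ → Fin d → ℝ} {C P ε : ℝ} {φ : ℕ → Fin d → ℝ → ℝ} {H : ℕ → Fin d → Pth N d → ℝ}
    {χ r : ℕ → Fin d → ℝ → ℝ} (h : Adm μ c v m C P ε φ H χ r) (t : ℕ) (i : Fin d) (y : ℝ) :
    0 ≤ χ t i y := by
  have := h.sub t i (m t i) y
  rwa [h.zc, h.zr, zero_mul, add_zero] at this

end
end VM


namespace VM

section
variable {N d : ℕ} {μ : ℕ → Fin d → Measure ℝ} {π : Measure (Pth N d)}

/-- Replace coordinate `i` by a deterministic path. -/
def repl (i : Fin d) (z : ℕ → ℝ) (x : Pth N d) : Pth N d := fun s j => if j = i then z s else x s j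

lemma X_repl_self {t : ℕ} (ht : t < N) (i : Fin d) (z : ℕ → ℝ) (x : Pth N d) :
    X t i (repl i z x) = z t := by simp [X, repl, ht]

lemma X_repl_ne (t : ℕ) {i j : Fin d} (h : j ≠ i) (z : ℕ → ℝ) (x : Pth N d) :
    X t j (repl i z x) = X t j x := by simp [X, repl, h]

lemma measurable_repl (i : Fin d) (z : ℕ → ℝ) : Measurable (repl (N := N) i z) := by
  unfold repl
  refine measurable_pi_lambda _ fun s => measurable_pi_lambda _ fun j => ?_
  split_ifs
  · fun_prop
  · fun_prop

lemma Mart.probμ (hπ : Mart μ π) {t : ℕ} (ht : t < N) (i : Fin d) :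
    IsProbabilityMeasure (μ t i) := by
  have := hπ.prob
  rw [← hπ.marg t ht i]
  exact Measure.isProbabilityMeasure_map (measurable_X t i).aemeasurable

lemma Mart.intμ (hπ : Mart μ π) {t : ℕ} (ht : t < N) (i : Fin d) :
    Integrable (fun y : ℝ => y) (μ t i) := by
  rw [← hπ.marg t ht i]
  exact (integrable_map_measure (by fun_prop) (measurable_X t i).aemeasurable).2 (hπ.int t ht i)

/-- Marginalization of a semi-static hedge to one asset. -/
lemma marginalize (hπ : Mart μ π) {ψ : ℕ → Fin d → ℝ → ℝ} {H : ℕ → Fin d → Pth N d → ℝ}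
    (hψ : GoodP N μ ψ) (hH : GoodH H) (hle : ∀ x, stat ψ x + trade H x ≤ 0) (i : Fin d) :
    ∃ h : ℕ → (ℕ → ℝ) → ℝ, (∀ t z z', (∀ s ≤ t, z s = z' s) → h t z = h t z') ∧
      ∀ z : ℕ → ℝ, ∑ t ∈ Finset.range N, ψ t i (z t) +
        ∑ t ∈ Finset.range (N - 1), h t z * (z (t + 1) - z t) ≤
        -(val N μ ψ - ∑ t ∈ Finset.range N, ∫ y, ψ t i y ∂(μ t i)) := by
  have hp := hπ.prob
  refine ⟨fun t z => ∫ x, H t i (repl i z x) ∂π, fun t z z' hz => ?_, fun z => ?_⟩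
  · refine integral_congr_ae (Eventually.of_forall fun x => ?_)
    refine (hH t i).2.1 _ _ fun s hs => ?_
    funext j
    simp only [repl, hz s hs]
  · let ψz : ℕ → Fin d → ℝ → ℝ := fun t j y => if j = i then ψ t i (z t) else ψ t j y
    let Hz : ℕ → Fin d → Pth N d → ℝ := fun t j x => if j = i then 0 else H t j (repl i z x)
    have gz : GoodP N μ ψz := by
      intro t j
      by_cases h : j = i
      · simp only [ψz, h, if_true]
        refine ⟨measurable_const, fun ht => ?_⟩
        have := hπ.probμ ht i
        exact integrable_const _
      · simp only [ψz, h, if_false]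
        exact hψ t j
    have gH : GoodH Hz := by
      intro t j
      by_cases h : j = i
      · simp only [Hz, h, if_true]
        exact ⟨measurable_const, fun _ _ _ => rfl, 0, fun _ => by simp⟩
      · simp only [Hz, h, if_false]
        refine ⟨(hH t j).1.comp (measurable_repl i z), fun x y hxy => ?_, ?_⟩
        · refine (hH t j).2.1 _ _ fun s hs => ?_
          funext k
          simp only [repl, hxy s hs]
        · exact (hH t j).2.2.imp fun C hC x => hC _
    have e1 : ∀ x : Pth N d, stat ψ (repl i z x) = stat ψz x := by
      intro x
      refine Finset.sum_congr rfl fun t ht => Finset.sum_congr rfl fun j _ => ?_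
      by_cases h : j = i
      · subst h
        simp only [ψz, if_true, X_repl_self (Finset.mem_range.1 ht)]
      · simp only [ψz, h, if_false, X_repl_ne t h]
    have e2 : ∀ x, trade H (repl i z x) = trade Hz x +
        ∑ t ∈ Finset.range (N - 1), H t i (repl i z x) * (z (t + 1) - z t) := by
      intro x
      unfold trade
      rw [← Finset.sum_add_distrib]
      refine Finset.sum_congr rfl fun t ht => ?_
      have ht' := Finset.mem_range.1 ht
      rw [← Finset.add_sum_erase _ _ (Finset.mem_univ i),
        ← Finset.add_sum_erase (a := i) Finset.univ (fun j => Hz t j x * _) (Finset.mem_univ i)]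
      rw [X_repl_self (by omega), X_repl_self (by omega)]
      have e3 : Hz t i x = 0 := by simp [Hz]
      rw [e3, zero_mul, zero_add, add_comm]
      congr 1
      refine Finset.sum_congr rfl fun j hj => ?_
      have hj' := Finset.ne_of_mem_erase hj
      simp only [Hz, hj', if_false, X_repl_ne _ hj']
    have hHi : ∀ t, Integrable (fun x => H t i (repl i z x)) π := fun t => by
      obtain ⟨h1, h2, C, h3⟩ := hH t i
      exact Integrable.of_bound (h1.comp (measurable_repl i z)).aestronglyMeasurable C
        (Eventually.of_forall fun x => h3 _)
    have hint : Integrable (fun x => ∑ t ∈ Finset.range (N - 1),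
        H t i (repl i z x) * (z (t + 1) - z t)) π :=
      integrable_finsetSum _ fun t _ => (hHi t).mul_const _
    have h1 : ∫ x, (stat ψz x + (trade Hz x + ∑ t ∈ Finset.range (N - 1),
        H t i (repl i z x) * (z (t + 1) - z t))) ∂π ≤ 0 := by
      refine integral_nonpos fun x => ?_
      have := hle (repl i z x)
      rw [e1, e2] at this
      exact this
    have hint2 : Integrable (fun x => trade Hz x + ∑ t ∈ Finset.range (N - 1),
        H t i (repl i z x) * (z (t + 1) - z t)) π := (hπ.trade gH).1.add hint
    rw [integral_add (hπ.stat gz).1 hint2,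
      integral_add (hπ.trade gH).1 hint, (hπ.stat gz).2, (hπ.trade gH).2,
      integral_finsetSum _ fun t _ => (hHi t).mul_const _] at h1
    simp only [integral_mul_const] at h1
    have e4 : val N μ ψz = val N μ ψ - ∑ t ∈ Finset.range N, ∫ y, ψ t i y ∂(μ t i) +
        ∑ t ∈ Finset.range N, ψ t i (z t) := by
      unfold val
      rw [← Finset.sum_sub_distrib, ← Finset.sum_add_distrib]
      refine Finset.sum_congr rfl fun t ht => ?_
      rw [← Finset.add_sum_erase _ _ (Finset.mem_univ i),
        ← Finset.add_sum_erase (a := i) Finset.univ (fun j => ∫ y, ψ t j y ∂(μ t j)) (Finset.mem_univ i)]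
      have := hπ.probμ (Finset.mem_range.1 ht) i
      have e5 : ∫ y, ψz t i y ∂(μ t i) = ψ t i (z t) := by simp [ψz]
      have e6 : ∑ j ∈ Finset.univ.erase i, ∫ y, ψz t j y ∂(μ t j) =
          ∑ j ∈ Finset.univ.erase i, ∫ y, ψ t j y ∂(μ t j) := by
        refine Finset.sum_congr rfl fun j hj => ?_
        have hj' := Finset.ne_of_mem_erase hj
        simp only [ψz, hj', if_false]
      rw [e5, e6]
      ring
    linarith

/-- Balance the static positions between the assets. -/
lemma balance (hπ : Mart μ π) (hN : 0 < N) (hd : 0 < d) {φ : ℕ → Fin d → ℝ → ℝ}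
    (hφ : GoodP N μ φ) (v : ℕ → Fin d → ℝ → ℝ) (hv : GoodP N μ v) :
    ∃ φ' : ℕ → Fin d → ℝ → ℝ, GoodP N μ φ' ∧ (∀ x : Pth N d, stat φ' x = stat φ x) ∧
      val N μ φ' = val N μ φ ∧
      ∀ i, ∑ t ∈ Finset.range N, ∫ y, (φ' t i y - v t i y) ∂(μ t i) =
        (val N μ φ - val N μ v) / d := by
  let S : Fin d → ℝ := fun i => ∑ t ∈ Finset.range N, ∫ y, (φ t i y - v t i y) ∂(μ t i)
  have hS : ∑ i, S i = val N μ φ - val N μ v := by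
    simp only [S, val]
    rw [Finset.sum_comm, ← Finset.sum_sub_distrib]
    refine Finset.sum_congr rfl fun t ht => ?_
    rw [← Finset.sum_sub_distrib]
    refine Finset.sum_congr rfl fun i _ => ?_
    exact integral_sub ((hφ t i).2 (Finset.mem_range.1 ht)) ((hv t i).2 (Finset.mem_range.1 ht))
  let e : Fin d → ℝ := fun i => (val N μ φ - val N μ v) / d - S i
  have he : ∑ i, e i = 0 := by
    simp only [e]
    rw [Finset.sum_sub_distrib, hS]
    simp only [Finset.sum_const, Finset.card_univ, Fintype.card_fin, nsmul_eq_mul]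
    field_simp
    ring
  have hg : GoodP N μ (fun t i y => φ t i y + if t = 0 then e i else 0) := by
    refine hφ.add fun t i => ⟨measurable_const, fun ht => ?_⟩
    have := hπ.probμ ht i
    exact integrable_const _
  have hst : ∀ x : Pth N d, stat (fun t i y => φ t i y + if t = 0 then e i else 0) x = stat φ x := by
    intro x
    have e2 : stat (N := N) (fun t i _ => if t = 0 then e i else 0) x = 0 := by
      unfold stat
      refine Finset.sum_eq_zero fun t _ => ?_
      by_cases h : t = 0
      · simp only [h, if_true, he]
      · simp [h]
    rw [stat_add φ (fun t i _ => if t = 0 then e i else 0), e2, add_zero]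
  refine ⟨_, hg, hst, ?_, fun i => ?_⟩
  · rw [← (hπ.stat hg).2, ← (hπ.stat hφ).2]
    simp only [hst]
  · have : ∀ t ∈ Finset.range N, ∫ y, (φ t i y + (if t = 0 then e i else 0) - v t i y) ∂(μ t i) =
        ∫ y, (φ t i y - v t i y) ∂(μ t i) + if t = 0 then e i else 0 := by
      intro t ht
      have hp := hπ.probμ (Finset.mem_range.1 ht) i
      have h1 : Integrable (fun y => φ t i y - v t i y) (μ t i) :=
        ((hφ t i).2 (Finset.mem_range.1 ht)).sub ((hv t i).2 (Finset.mem_range.1 ht))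
      have : (fun y => φ t i y + (if t = 0 then e i else 0) - v t i y) =
        fun y => (φ t i y - v t i y) + (if t = 0 then e i else 0) := by funext y; ring
      rw [this, integral_add h1 (integrable_const _)]
      simp
    rw [Finset.sum_congr rfl this, Finset.sum_add_distrib, Finset.sum_ite_eq' (Finset.range N) 0,
      if_pos (Finset.mem_range.2 hN)]
    simp only [e, S]
    ring

end
end VM


namespace VM

section
variable {N d : ℕ} {μ : ℕ → Fin d → Measure ℝ} {π : Measure (Pth N d)}

lemma Subg.zero_of {χ r : ℝ → ℝ} (h : Subg χ r) (h0 : ∀ y, χ y = 0) (x : ℝ) : r x = 0 := by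
  have h1 := h x (x + 1)
  have h2 := h x (x - 1)
  simp only [h0] at h1 h2
  linarith

lemma subg_center {χ r : ℝ → ℝ} (h : Subg χ r) (m : ℝ) :
    Subg (fun y => χ y - (χ m + r m * (y - m))) (fun y => r y - r m) := by
  intro x y
  have := h x y
  beta_reduce
  linarith

/-- Existence of normalized approximate optimizers. -/
lemma exists_adm {c : Pth N d → ℝ} {v : ℕ → Fin d → ℝ → ℝ} (hN : 0 < N) (hd : 0 < d)
    (hπ : Mart μ π) (hc : LowerSemicontinuous c)
    (hvc : ∀ t i, Continuous (v t i)) (hvi : ∀ t < N, ∀ i, Integrable (v t i) (μ t i))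
    (hcb : ∀ x, |c x| ≤ stat v x)
    (hmin : ∀ ρ, Mart μ ρ → ∫ x, c x ∂π ≤ ∫ x, c x ∂ρ) (m : ℕ → Fin d → ℝ)
    {ε : ℝ} (hε : 0 < ε) (hε1 : ε ≤ 1) :
    ∃ φ H χ r, Adm μ c v m (val N μ v - ∫ x, c x ∂π + 1) (∫ x, c x ∂π) ε φ H χ r := by
  obtain ⟨φ₀, H, gφ₀, gH, hle₀, hval₀⟩ := exists_subhedge hN hd hπ hc hvc hvi hcb hmin ε hε
  have gv : GoodP N μ v := fun t i => ⟨(hvc t i).measurable, fun ht => hvi t ht i⟩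
  obtain ⟨φ, gφ, hst, hval, hbal⟩ := balance hπ hN hd gφ₀ v gv
  have hle : ∀ x, stat φ x + trade H x ≤ c x := fun x => by rw [hst]; exact hle₀ x
  have hval1 : ∫ x, c x ∂π - ε < val N μ φ := by rw [hval]; exact hval₀
  let ψ : ℕ → Fin d → ℝ → ℝ := fun t i y => φ t i y + (-1) * v t i y
  have gψ : GoodP N μ ψ := gφ.add (gv.smul (-1))
  have hψle : ∀ x : Pth N d, stat ψ x + trade H x ≤ 0 := by
    intro x
    have e : stat ψ x = stat φ x + (-1) * stat v x := by
      rw [← stat_smul, ← stat_add]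
    have := hle x
    have := (le_abs_self _).trans (hcb x)
    linarith
  have eS : val N μ ψ = val N μ φ - val N μ v := by
    have := val_add gφ (gv.smul (-1))
    rw [val_smul] at this
    simp only [ψ]
    linarith
  have hS0 : val N μ ψ ≤ 0 := by
    have h1 : ∫ x, (stat ψ x + trade H x) ∂π ≤ 0 := integral_nonpos hψle
    rw [integral_add (hπ.stat gψ).1 (hπ.trade gH).1, (hπ.stat gψ).2, (hπ.trade gH).2] at h1
    linarith
  set P := ∫ x, c x ∂π with hP
  set C := val N μ v - P + 1 with hC
  have hSC : - val N μ ψ ≤ C := by linarith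
  have hC0 : 0 ≤ C := by linarith
  obtain ⟨n, rfl⟩ : ∃ n, N = n + 1 := ⟨N - 1, by omega⟩
  have hbd : ∀ i : Fin d, ∑ t ∈ Finset.range (n + 1), ∫ y, ψ t i y ∂(μ t i) = val (n + 1) μ ψ / d := by
    intro i
    rw [eS, ← hval] at *
    rw [← hbal i]
    refine Finset.sum_congr rfl fun t _ => ?_
    refine integral_congr_ae (Eventually.of_forall fun y => ?_)
    simp only [ψ]
    ring
  have hd1 : (1 : ℝ) ≤ d := by exact_mod_cast hd
  have hCi : ∀ i : Fin d, -(val (n + 1) μ ψ - ∑ t ∈ Finset.range (n + 1), ∫ y, ψ t i y ∂(μ t i)) ≤ C := by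
    intro i
    rw [hbd i]
    have : val (n + 1) μ ψ / d ≤ 0 := div_nonpos_of_nonpos_of_nonneg hS0 (by linarith)
    linarith
  have key : ∀ i : Fin d, ∃ χ : ℕ → ℝ → ℝ, (∀ t, ConvexOn ℝ Set.univ (χ t)) ∧ (∀ y, χ 0 y = 0) ∧
      (∀ y, χ (n + 1) y = 0) ∧ ∀ t ≤ n, ∀ y, ψ t i y ≤ C + χ (t + 1) y - χ t y := by
    intro i
    obtain ⟨h, hadp, hh⟩ := marginalize hπ gψ gH hψle i
    obtain ⟨χ, h1, h2, h3, h4⟩ := decomp n (fun t => ψ t i) h C hadp fun z => (hh z).trans (hCi i)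
    refine ⟨χ, h1, h2, h3, fun t ht y => (h4 t ht y).trans ?_⟩
    split_ifs <;> linarith
  choose χ hconv hχ0 hχN hdom using key
  have key2 : ∀ i t, ∃ r, Subg (χ i t) r := fun i t => exists_subg (hconv i t)
  choose r hr using key2
  let a : ℕ → Fin d → ℝ → ℝ := fun t i y => χ i t (m t i) + r i t (m t i) * (y - m t i)
  have a0 : ∀ i y, a 0 i y = 0 := fun i y => by
    simp only [a, hχ0, (hr i 0).zero_of (hχ0 i), zero_mul, add_zero]
  have aN : ∀ i y, a (n + 1) i y = 0 := fun i y => by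
    simp only [a, hχN, (hr i (n + 1)).zero_of (hχN i), zero_mul, add_zero]
  let φ' : ℕ → Fin d → ℝ → ℝ := fun t i y => φ t i y + (a t i y + (-1) * a (t + 1) i y)
  let H' : ℕ → Fin d → Pth (n + 1) d → ℝ := fun t i x => H t i x + (- r i (t + 1) (m (t + 1) i))
  have ga : ∀ t i, ∀ s < n + 1, ∀ j, Integrable (a t i) (μ s j) := fun t i s hs j => by
    have := hπ.probμ hs j
    have h2 := hπ.intμ hs j
    exact (integrable_const _).add ((h2.sub (integrable_const _)).const_mul _)
  have gφ' : GoodP (n + 1) μ φ' := by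
    refine gφ.add fun t i => ⟨?_, fun ht => ?_⟩
    · simp only [a]
      fun_prop
    · exact (ga t i t ht i).add ((ga (t + 1) i t ht i).const_mul _)
  have gH' : GoodH H' := gH.add (GoodH.const _)
  have hpay : ∀ x, stat φ' x + trade H' x = stat φ x + trade H x := by
    intro x
    have e1 : stat φ' x = stat φ x + stat (N := n + 1) (fun t i y => a t i y + (-1) * a (t + 1) i y) x :=
      stat_add _ _ x
    have e2 : trade H' x = trade H x + trade (N := n + 1) (fun t i _ => - r i (t + 1) (m (t + 1) i)) x :=
      trade_add _ _ x
    have e3 : stat (N := n + 1) (fun t i y => a t i y + (-1) * a (t + 1) i y) x +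
        trade (N := n + 1) (fun t i _ => - r i (t + 1) (m (t + 1) i)) x = 0 := by
      unfold stat trade
      simp only [Finset.sum_add_distrib, Nat.add_sub_cancel]
      rw [Finset.sum_range_succ' (fun t => ∑ i, a t i (X t i x)),
        Finset.sum_range_succ (fun t => ∑ i, (-1) * a (t + 1) i (X t i x))]
      simp only [a0, aN, Finset.sum_const_zero, mul_zero, add_zero]
      rw [← Finset.sum_add_distrib, ← Finset.sum_add_distrib]
      refine Finset.sum_eq_zero fun t _ => ?_
      rw [← Finset.sum_add_distrib, ← Finset.sum_add_distrib]
      refine Finset.sum_eq_zero fun i _ => ?_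
      simp only [a]
      ring
    linarith
  have hval' : val (n + 1) μ φ' = val (n + 1) μ φ := by
    have h1 : ∫ x, (stat φ' x + trade H' x) ∂π = ∫ x, (stat φ x + trade H x) ∂π := by
      simp only [hpay]
    rw [integral_add (hπ.stat gφ').1 (hπ.trade gH').1, (hπ.stat gφ').2, (hπ.trade gH').2,
      integral_add (hπ.stat gφ).1 (hπ.trade gH).1, (hπ.stat gφ).2, (hπ.trade gH).2] at h1
    linarith
  let χ' : ℕ → Fin d → ℝ → ℝ := fun t i y => χ i t y - a t i y
  let r' : ℕ → Fin d → ℝ → ℝ := fun t i y => r i t y - r i t (m t i)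
  have hs' : ∀ t i, Subg (χ' t i) (r' t i) := fun t i => subg_center (hr i t) (m t i)
  have zc : ∀ t i, χ' t i (m t i) = 0 := fun t i => by simp [χ', a]
  have zr : ∀ t i, r' t i (m t i) = 0 := fun t i => by simp [r']
  have hnn : ∀ t i y, 0 ≤ χ' t i y := fun t i y => by
    have := hs' t i (m t i) y
    rwa [zc, zr, zero_mul, add_zero] at this
  have zN : ∀ i y, χ' (n + 1) i y = 0 := fun i y => by simp only [χ', hχN, aN, sub_zero]
  have dom' : ∀ t < n + 1, ∀ i y, φ' t i y - v t i y ≤ C + χ' (t + 1) i y - χ' t i y := by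
    intro t ht i y
    have := hdom i t (by omega) y
    simp only [ψ] at this
    simp only [φ', χ']
    linarith
  have stp : ∀ t < n + 1, ∀ i, Integrable (χ' (t + 1) i) (μ t i) → Integrable (χ' t i) (μ t i) := by
    intro t ht i h
    have := hπ.probμ ht i
    have h2 : Integrable (fun y => C + χ' (t + 1) i y - (φ' t i y - v t i y)) (μ t i) :=
      ((integrable_const _).add h).sub (((gφ' t i).2 ht).sub (hvi t ht i))
    refine h2.mono' (hs' t i).continuous.aestronglyMeasurable (Eventually.of_forall fun y => ?_)
    rw [Real.norm_eq_abs, abs_of_nonneg (hnn t i y)]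
    linarith [dom' t ht i y]
  have int1 : ∀ i, ∀ k ≤ n, Integrable (χ' (n - k + 1) i) (μ (n - k) i) := by
    intro i k
    induction k with
    | zero =>
      intro _
      simp only [Nat.sub_zero]
      refine (integrable_zero _ _ _).congr (Eventually.of_forall fun y => ?_)
      simp [zN]
    | succ k ih =>
      intro hk
      have h1 := stp (n - k) (by omega) i (ih (by omega))
      have e : n - (k + 1) + 1 = n - k := by omega
      have h2 := subg_int hπ (t := n - (k + 1)) (by omega) i (hs' (n - k) i) (hnn _ i) (by rw [e]; exact h1)
      rw [e]
      exact h2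
  refine ⟨φ', H', χ', r', gφ', gH', fun x => (hpay x).trans_le (hle x), ?_, hs', zc, zr, fun i y => ?_,
    zN, fun t ht i => ?_, dom'⟩
  · rw [hval']
    exact hval1.le
  · simp only [χ', hχ0, a0, sub_zero]
  · have h := int1 i (n - t) (by omega)
    have e : n - (n - t) = t := by omega
    rw [e] at h
    exact ⟨stp t ht i h, h⟩

lemma Adm.anti {c : Pth N d → ℝ} {v : ℕ → Fin d → ℝ → ℝ}
    {m : ℕ → Fin d → ℝ} {C P ε ε' : ℝ} {φ : ℕ → Fin d → ℝ → ℝ} {H : ℕ → Fin d → Pth N d → ℝ}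
    {χ r : ℕ → Fin d → ℝ → ℝ} (h : Adm μ c v m C P ε φ H χ r) (he : ε ≤ ε') :
    Adm μ c v m C P ε' φ H χ r :=
  { h with va := by linarith [h.va] }

lemma Adm.mid {c : Pth N d → ℝ} {v : ℕ → Fin d → ℝ → ℝ}
    {m : ℕ → Fin d → ℝ} {C P ε : ℝ} {φ φ' : ℕ → Fin d → ℝ → ℝ} {H H' : ℕ → Fin d → Pth N d → ℝ}
    {χ χ' r r' : ℕ → Fin d → ℝ → ℝ} (h : Adm μ c v m C P ε φ H χ r)
    (h' : Adm μ c v m C P ε φ' H' χ' r') :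
    Adm μ c v m C P ε (fun t i y => (1/2) * φ t i y + (1/2) * φ' t i y)
      (fun t i y => (1/2) * H t i y + (1/2) * H' t i y)
      (fun t i y => (1/2) * χ t i y + (1/2) * χ' t i y)
      (fun t i y => (1/2) * r t i y + (1/2) * r' t i y) where
  gp := (h.gp.smul _).add (h'.gp.smul _)
  gh := (h.gh.smul _).add (h'.gh.smul _)
  le := fun x => by
    rw [stat_add, trade_add, stat_smul, stat_smul, trade_smul, trade_smul]
    linarith [h.le x, h'.le x]
  va := by
    rw [val_add (h.gp.smul _) (h'.gp.smul _), val_smul, val_smul]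
    linarith [h.va, h'.va]
  sub := fun t i x y => by
    have := h.sub t i x y
    have := h'.sub t i x y
    beta_reduce
    linarith
  zc := fun t i => by simp [h.zc, h'.zc]
  zr := fun t i => by simp [h.zr, h'.zr]
  z0 := fun t i => by simp [h.z0, h'.z0]
  zN := fun t i => by simp [h.zN, h'.zN]
  int := fun t ht i => ⟨((h.int t ht i).1.const_mul _).add ((h'.int t ht i).1.const_mul _),
    ((h.int t ht i).2.const_mul _).add ((h'.int t ht i).2.const_mul _)⟩
  dom := fun t ht i y => by
    linarith [h.dom t ht i y, h'.dom t ht i y]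

end
end VM


namespace VM

section
variable {N d : ℕ} {μ : ℕ → Fin d → Measure ℝ} {π : Measure (Pth N d)}

/-- Modified subgradient. -/
def rmod (r : ℝ → ℝ) (k e : ℝ) (x : ℝ) : ℝ :=
  if x ≤ k - e then r x + (r (k + e) - r (k - e)) / 2
  else if x < k + e then r (k - e) + (r (k + e) - r (k - e)) / 2
  else r x - (r (k + e) - r (k - e)) / 2

lemma rmod_mono {r : ℝ → ℝ} (hr : Monotone r) (k : ℝ) {e : ℝ} (he : 0 < e) : Monotone (rmod r k e) := by
  intro x y hxy
  unfold rmod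
  have h0 := hr hxy
  have h1 : r (k - e) ≤ r (k + e) := hr (by linarith)
  split_ifs with h1 h2 h3 h4 h5 h6
  · linarith
  · have := hr h1; linarith
  · have := hr h1; have := hr (not_lt.1 h3); linarith
  · linarith
  · linarith
  · have := hr (not_lt.1 h6); linarith
  · linarith
  · linarith
  · linarith

lemma rmod_ineq {χ r : ℝ → ℝ} (hs : Subg χ r) (k : ℝ) {e : ℝ} (he : 0 < e) (x y : ℝ) :
    rmod r k e x * (y - x) ≤ χ y - χ x - (r (k + e) - r (k - e)) / 2 * (|y - k| - |x - k|) +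
      3 * (r (k + e) - r (k - e)) * e := by
  have hr := hs.mono
  have hs0 : r (k - e) ≤ r (k + e) := hr (by linarith)
  set a := k - e with ha
  set b := k + e with hb
  obtain ⟨s, hse⟩ : ∃ s, s = r b - r a := ⟨_, rfl⟩
  have s0 : 0 ≤ s := by linarith
  have se0 : 0 ≤ s * e := by positivity
  unfold rmod
  rw [← ha, ← hb, ← hse]
  split_ifs with h1 h2
  · rw [abs_of_nonpos (show x - k ≤ 0 by linarith)]
    rcases le_total b y with hy | hy
    · rw [abs_of_nonneg (show 0 ≤ y - k by linarith)]
      have e1 := hs b y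
      have e2 := hs x b
      have e3 : 0 ≤ (r a - r x) * (y - b) := mul_nonneg (by linarith [hr h1]) (by linarith)
      have : b = k + e := hb
      have e4 : r b = s + r a := by linarith
      rw [e4] at e1
      rw [this] at e1 e2 e3
      nlinarith
    · have e1 := hs x y
      rcases le_total y k with hy | hy
      · rw [abs_of_nonpos (show y - k ≤ 0 by linarith)]
        nlinarith
      · rw [abs_of_nonneg (show 0 ≤ y - k by linarith)]
        have : s * (y - k) ≤ s * e := mul_le_mul_of_nonneg_left (by linarith) s0
        nlinarith
  · push Not at h1
    have hra := hr h1.le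
    have hrb := hr h2.le
    have hxk : |x - k| ≤ e := abs_le.2 ⟨by linarith, by linarith⟩
    have hxk1 : s * (k - x) ≤ s * |x - k| := mul_le_mul_of_nonneg_left (by linarith [neg_abs_le (x - k)]) s0
    rcases le_total b y with hy | hy
    · rw [abs_of_nonneg (show 0 ≤ y - k by linarith)]
      have e1 := hs b y
      have e2 := hs x b
      have e3 : 0 ≤ (r x - r a) * (b - x) := mul_nonneg (by linarith) (by linarith)
      have : b = k + e := hb
      have e4 : r b = s + r a := by linarith
      rw [e4] at e1
      rw [this] at e1 e2 e3
      nlinarith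
    · have e1 := hs x y
      have hyk : s * (|y - k| + (y - k)) ≤ s * (2 * e) := by
        refine mul_le_mul_of_nonneg_left ?_ s0
        rcases abs_cases (y - k) with h | h <;> linarith
      rcases le_total x y with hxy | hxy
      · have : 0 ≤ (r x - r a) * (y - x) := mul_nonneg (by linarith) (by linarith)
        nlinarith
      · rcases le_total a y with hay | hay
        · have : (r x - r a) * (x - y) ≤ s * (2 * e) := mul_le_mul (by linarith) (by linarith) (by linarith) s0
          nlinarith
        · rw [abs_of_nonpos (show y - k ≤ 0 by linarith)]
          have e2 := hs a y
          have e3 := hs x a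
          have : (r x - r a) * (x - a) ≤ s * (2 * e) := mul_le_mul (by linarith) (by linarith) (by linarith) s0
          nlinarith
  · push Not at h1 h2
    rw [abs_of_nonneg (show 0 ≤ x - k by linarith)]
    rcases le_total y a with hy | hy
    · rw [abs_of_nonpos (show y - k ≤ 0 by linarith)]
      have e1 := hs a y
      have e2 := hs x a
      have e3 : 0 ≤ (r x - r b) * (a - y) := mul_nonneg (by linarith [hr h2]) (by linarith)
      have : a = k - e := ha
      have e4 : r a = r b - s := by linarith
      rw [e4] at e1
      rw [this] at e1 e2 e3
      nlinarith
    · have e1 := hs x y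
      rcases le_total y k with hy | hy
      · rw [abs_of_nonpos (show y - k ≤ 0 by linarith)]
        have : s * (k - y) ≤ s * e := mul_le_mul_of_nonneg_left (by linarith) s0
        nlinarith
      · rw [abs_of_nonneg (show 0 ≤ y - k by linarith)]
        nlinarith

/-- Convex functions with bounded martingale gap. -/
def Gap (μ ν : Measure ℝ) (C : ℝ) (χ r : ℝ → ℝ) : Prop :=
  Subg χ r ∧ Integrable χ μ ∧ Integrable χ ν ∧ ∫ y, χ y ∂ν - ∫ y, χ y ∂μ ≤ C

lemma abs_int (hπ : Mart μ π) {t : ℕ} (ht : t < N) (i : Fin d) (k : ℝ) :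
    Integrable (fun x => |X t i x - k|) π ∧ ∫ x, |X t i x - k| ∂π = potentialFn (μ t i) k := by
  have := hπ.prob
  refine ⟨((hπ.int t ht i).sub (integrable_const k)).abs, ?_⟩
  rw [hπ.integral_comp ht i (f := fun y => |y - k|) (by fun_prop)]
  unfold potentialFn
  simp only [abs_sub_comm]

/-- Local bound on the oscillation of subgradients. -/
lemma gap_local (hπ : Mart μ π) {t : ℕ} (ht : t + 1 < N) (i : Fin d) {C k : ℝ}
    (hk : potentialFn (μ t i) k < potentialFn (μ (t + 1) i) k) :
    ∃ e > 0, ∃ K, ∀ χ r, Gap (μ t i) (μ (t + 1) i) C χ r → r (k + e) - r (k - e) ≤ K := by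
  have hp := hπ.prob
  set D := potentialFn (μ (t + 1) i) k - potentialFn (μ t i) k with hD
  have hD0 : 0 < D := by linarith
  refine ⟨D / 12, by positivity, 4 * C / D, fun χ r ⟨hs, hi1, hi2, hg⟩ => ?_⟩
  set e := D / 12 with he
  have he0 : 0 < e := by positivity
  obtain ⟨s, hse⟩ : ∃ s, s = r (k + e) - r (k - e) := ⟨_, rfl⟩
  have ht' : t < N := by omega
  have i1 : Integrable (fun x => χ (X (t + 1) i x) - χ (X t i x)) π :=
    (hπ.integrable_comp ht i hi2).sub (hπ.integrable_comp ht' i hi1)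
  have i2 : Integrable (fun x => |X (t + 1) i x - k| - |X t i x - k|) π :=
    (abs_int hπ ht i k).1.sub (abs_int hπ ht' i k).1
  have i3 : Integrable (fun x => χ (X (t + 1) i x) - χ (X t i x) -
    s / 2 * (|X (t + 1) i x - k| - |X t i x - k|)) π := i1.sub (i2.const_mul _)
  have h := (slack hπ ht i (F := fun x => χ (X (t + 1) i x) - χ (X t i x) -
    s / 2 * (|X (t + 1) i x - k| - |X t i x - k|) + 3 * s * e)
    (i3.add (integrable_const _)) (rmod_mono hs.mono k he0) fun x => by
      have := rmod_ineq hs k he0 (X t i x) (X (t + 1) i x)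
      rw [hse]; exact this).1
  rw [integral_add i3 (integrable_const _), integral_sub i1 (i2.const_mul _),
    integral_const_mul, integral_sub (hπ.integrable_comp ht i hi2) (hπ.integrable_comp ht' i hi1),
    integral_sub (abs_int hπ ht i k).1 (abs_int hπ ht' i k).1, (abs_int hπ ht i k).2,
    (abs_int hπ ht' i k).2, hπ.integral_comp ht i hs.continuous.measurable,
    hπ.integral_comp ht' i hs.continuous.measurable, ← hD] at h
  simp only [integral_const, probReal_univ, one_smul] at h
  rw [← hse, le_div_iff₀ hD0]
  rw [he] at h
  linarith

lemma gap_bdd (hπ : Mart μ π) {t : ℕ} (ht : t + 1 < N) (i : Fin d) (C : ℝ)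
    (hI : IsPreconnected {x | potentialFn (μ t i) x < potentialFn (μ (t + 1) i) x}) {x y : ℝ}
    (hx : potentialFn (μ t i) x < potentialFn (μ (t + 1) i) x)
    (hy : potentialFn (μ t i) y < potentialFn (μ (t + 1) i) y) :
    ∃ K, ∀ χ r, Gap (μ t i) (μ (t + 1) i) C χ r → |r x - r y| ≤ K := by
  refine hI.induction₂ (fun x y => ∃ K, ∀ χ r, Gap (μ t i) (μ (t + 1) i) C χ r → |r x - r y| ≤ K)
    (fun k hk => ?_) (fun x y z _ _ _ ⟨K, hK⟩ ⟨K', hK'⟩ => ?_) (fun x y _ _ ⟨K, hK⟩ => ?_) hx hy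
  · obtain ⟨e, he, K, hK⟩ := gap_local hπ ht i (C := C) hk
    refine mem_nhdsWithin_of_mem_nhds ?_
    filter_upwards [Ioo_mem_nhds (show k - e < k by linarith) (show k < k + e by linarith)] with y hy
    refine ⟨K, fun χ r hg => ?_⟩
    have := hK χ r hg
    have hm := hg.1.mono
    have h1 := hm hy.1.le
    have h2 := hm hy.2.le
    have h3 := hm (show k - e ≤ k by linarith)
    have h4 := hm (show k ≤ k + e by linarith)
    exact abs_le.2 ⟨by linarith, by linarith⟩
  · refine ⟨K + K', fun χ r hg => ?_⟩
    have := abs_sub_le (r x) (r y) (r z)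
    linarith [hK χ r hg, hK' χ r hg]
  · exact ⟨K, fun χ r hg => by rw [abs_sub_comm]; exact hK χ r hg⟩

/-- Slack of the static position. -/
def sl (v : ℕ → Fin d → ℝ → ℝ) (C : ℝ) (φ χ : ℕ → Fin d → ℝ → ℝ) (t : ℕ) (i : Fin d) (y : ℝ) : ℝ :=
  C + χ (t + 1) i y - χ t i y - (φ t i y - v t i y)

variable {c : Pth N d → ℝ} {v : ℕ → Fin d → ℝ → ℝ}
    {m : ℕ → Fin d → ℝ} {C P ε : ℝ} {φ : ℕ → Fin d → ℝ → ℝ} {H : ℕ → Fin d → Pth N d → ℝ}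
    {χ r : ℕ → Fin d → ℝ → ℝ}

lemma Adm.sl_nonneg (h : Adm μ c v m C P ε φ H χ r) {t : ℕ} (ht : t < N) (i : Fin d) (y : ℝ) :
    0 ≤ sl v C φ χ t i y := by
  unfold sl
  linarith [h.dom t ht i y]

lemma Adm.budget (hπ : Mart μ π) (hN : 0 < N) (gv : GoodP N μ v) (h : Adm μ c v m C P ε φ H χ r)
    (hε : ε ≤ 1) :
    (∀ t < N, ∀ i, Integrable (sl v C φ χ t i) (μ t i) ∧
      ∫ y, sl v C φ χ t i y ∂(μ t i) ≤ N * d * C + (val N μ v - P + 1)) ∧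
    (∀ t, t + 1 < N → ∀ i, Gap (μ t i) (μ (t + 1) i) (N * d * C + (val N μ v - P + 1))
      (χ (t + 1) i) (r (t + 1) i)) := by
  obtain ⟨n, rfl⟩ : ∃ n, N = n + 1 := ⟨N - 1, by omega⟩
  have hsi : ∀ t < n + 1, ∀ i, Integrable (sl v C φ χ t i) (μ t i) := by
    intro t ht i
    have := hπ.probμ ht i
    exact (((integrable_const _).add (h.int t ht i).2).sub (h.int t ht i).1).sub
      (((h.gp t i).2 ht).sub ((gv t i).2 ht))
  have hsv : ∀ t < n + 1, ∀ i, ∫ y, sl v C φ χ t i y ∂(μ t i) =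
      C + ∫ y, χ (t + 1) i y ∂(μ t i) - ∫ y, χ t i y ∂(μ t i) -
        (∫ y, φ t i y ∂(μ t i) - ∫ y, v t i y ∂(μ t i)) := by
    intro t ht i
    have := hπ.probμ ht i
    have i1 : Integrable (fun y => C + χ (t + 1) i y) (μ t i) := (integrable_const _).add (h.int t ht i).2
    have i2 : Integrable (fun y => C + χ (t + 1) i y - χ t i y) (μ t i) := i1.sub (h.int t ht i).1
    have i3 : Integrable (fun y => φ t i y - v t i y) (μ t i) := ((h.gp t i).2 ht).sub ((gv t i).2 ht)
    unfold sl
    rw [integral_sub i2 i3, integral_sub i1 (h.int t ht i).1,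
      integral_add (integrable_const _) (h.int t ht i).2,
      integral_sub ((h.gp t i).2 ht) ((gv t i).2 ht)]
    simp
  have hA0 : ∀ t < n + 1, ∀ i, 0 ≤ ∫ y, sl v C φ χ t i y ∂(μ t i) := fun t ht i =>
    integral_nonneg fun y => h.sl_nonneg ht i y
  have hG0 : ∀ t, t < n → ∀ i, 0 ≤ ∫ y, χ (t + 1) i y ∂(μ (t + 1) i) - ∫ y, χ (t + 1) i y ∂(μ t i) := by
    intro t ht i
    have hs := h.sub (t + 1) i
    have hi1 := hπ.integrable_comp (show t + 1 < n + 1 by omega) i (h.int (t + 1) (by omega) i).1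
    have hi2 := hπ.integrable_comp (show t < n + 1 by omega) i (h.int t (by omega) i).2
    have := (slack hπ (show t + 1 < n + 1 by omega) i (hi1.sub hi2) hs.mono fun x => by
      have := hs (X t i x) (X (t + 1) i x)
      simp only [Pi.sub_apply]
      linarith).1
    simp only [Pi.sub_apply] at this
    rwa [integral_sub hi1 hi2, hπ.integral_comp (by omega) i hs.continuous.measurable,
      hπ.integral_comp (by omega) i hs.continuous.measurable] at this
  have tot : ∑ t ∈ Finset.range (n + 1), ∑ i, ∫ y, sl v C φ χ t i y ∂(μ t i) +
      ∑ t ∈ Finset.range n, ∑ i, (∫ y, χ (t + 1) i y ∂(μ (t + 1) i) - ∫ y, χ (t + 1) i y ∂(μ t i)) =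
      ((n + 1 : ℕ) : ℝ) * d * C + (val (n + 1) μ v - val (n + 1) μ φ) := by
    have e1 : ∑ t ∈ Finset.range (n + 1), ∑ i, ∫ y, sl v C φ χ t i y ∂(μ t i) =
        ∑ t ∈ Finset.range (n + 1), ∑ i : Fin d, C +
        ∑ t ∈ Finset.range (n + 1), ∑ i, ∫ y, χ (t + 1) i y ∂(μ t i) -
        ∑ t ∈ Finset.range (n + 1), ∑ i, ∫ y, χ t i y ∂(μ t i) -
        (val (n + 1) μ φ - val (n + 1) μ v) := by
      unfold val
      simp only [← Finset.sum_add_distrib, ← Finset.sum_sub_distrib]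
      exact Finset.sum_congr rfl fun t ht => Finset.sum_congr rfl fun i _ =>
        hsv t (Finset.mem_range.1 ht) i
    rw [e1, Finset.sum_range_succ (fun t => ∑ i, ∫ y, χ (t + 1) i y ∂(μ t i)),
      Finset.sum_range_succ' (fun t => ∑ i, ∫ y, χ t i y ∂(μ t i))]
    simp only [h.z0, h.zN, integral_zero, Finset.sum_const_zero, add_zero, Finset.sum_sub_distrib,
      Finset.sum_const, Finset.card_univ, Fintype.card_fin, nsmul_eq_mul, Finset.card_range]
    ring
  have hva := h.va
  have hA1 : ∀ t < n + 1, ∀ i, ∫ y, sl v C φ χ t i y ∂(μ t i) ≤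
      ∑ t ∈ Finset.range (n + 1), ∑ i, ∫ y, sl v C φ χ t i y ∂(μ t i) := by
    intro t ht i
    refine (Finset.single_le_sum (f := fun i => ∫ y, sl v C φ χ t i y ∂(μ t i)) (fun j _ => hA0 t ht j) (Finset.mem_univ i)).trans ?_
    exact Finset.single_le_sum (f := fun t => ∑ i, ∫ y, sl v C φ χ t i y ∂(μ t i))
      (fun s hs => Finset.sum_nonneg fun j _ => hA0 s (Finset.mem_range.1 hs) j) (Finset.mem_range.2 ht)
  have hG1 : ∀ t < n, ∀ i, ∫ y, χ (t + 1) i y ∂(μ (t + 1) i) - ∫ y, χ (t + 1) i y ∂(μ t i) ≤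
      ∑ t ∈ Finset.range n, ∑ i, (∫ y, χ (t + 1) i y ∂(μ (t + 1) i) - ∫ y, χ (t + 1) i y ∂(μ t i)) := by
    intro t ht i
    refine (Finset.single_le_sum (f := fun i => ∫ y, χ (t + 1) i y ∂(μ (t + 1) i) - ∫ y, χ (t + 1) i y ∂(μ t i)) (fun j _ => hG0 t ht j) (Finset.mem_univ i)).trans ?_
    exact Finset.single_le_sum (f := fun t => ∑ i, (∫ y, χ (t + 1) i y ∂(μ (t + 1) i) - ∫ y, χ (t + 1) i y ∂(μ t i)))
      (fun s hs => Finset.sum_nonneg fun j _ => hG0 s (Finset.mem_range.1 hs) j) (Finset.mem_range.2 ht)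
  have hAs : 0 ≤ ∑ t ∈ Finset.range (n + 1), ∑ i, ∫ y, sl v C φ χ t i y ∂(μ t i) :=
    Finset.sum_nonneg fun t ht => Finset.sum_nonneg fun i _ => hA0 t (Finset.mem_range.1 ht) i
  have hGs : 0 ≤ ∑ t ∈ Finset.range n, ∑ i, (∫ y, χ (t + 1) i y ∂(μ (t + 1) i) - ∫ y, χ (t + 1) i y ∂(μ t i)) :=
    Finset.sum_nonneg fun t ht => Finset.sum_nonneg fun i _ => hG0 t (Finset.mem_range.1 ht) i
  refine ⟨fun t ht i => ⟨hsi t ht i, ?_⟩, fun t ht i => ⟨h.sub (t + 1) i, (h.int t (by omega) i).2,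
    (h.int (t + 1) ht i).1, ?_⟩⟩
  · have := hA1 t ht i
    linarith
  · have := hG1 t (by omega) i
    linarith

end
end VM


namespace VM

/-- Komlos type selection by means of strict convexity. -/
lemma komlos {Ω E : Type*} [MeasurableSpace Ω] (ν : Measure Ω) [IsFiniteMeasure ν] (K : ℕ → Set E)
    (hanti : Antitone K) (hne : ∀ n, (K n).Nonempty) (f : E → Ω → ℝ)
    (hm : ∀ k ∈ K 0, Measurable (f k)) (h0 : ∀ k ∈ K 0, ∀ ω, 0 ≤ f k ω)
    (hmid : ∀ n, ∀ k ∈ K n, ∀ k' ∈ K n, ∃ k'' ∈ K n, ∀ ω, f k'' ω = (f k ω + f k' ω) / 2) :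
    ∃ k : ℕ → E, (∀ n, k n ∈ K n) ∧ ∀ᵐ ω ∂ν, ∃ l : ℝ,
      Tendsto (fun n => Real.exp (-(f (k n) ω) / 2)) atTop (nhds l) := by
  let J : E → ℝ := fun k => ∫ ω, Real.exp (-(f k ω)) ∂ν
  have hJ0 : ∀ k, 0 ≤ J k := fun k => integral_nonneg fun ω => (Real.exp_pos _).le
  have hi1 : ∀ k ∈ K 0, ∀ k' ∈ K 0, Integrable (fun ω => Real.exp (-(f k ω) / 2) * Real.exp (-(f k' ω) / 2)) ν := by
    intro k hk k' hk'
    have m1 := hm k hk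
    have m2 := hm k' hk'
    refine Integrable.of_bound (by fun_prop) 1 (Eventually.of_forall fun ω => ?_)
    rw [Real.norm_eq_abs, abs_of_nonneg (by positivity), ← Real.exp_add]
    exact Real.exp_le_one_iff.2 (by linarith [h0 k hk ω, h0 k' hk' ω])
  have hsq : ∀ k, (fun ω => Real.exp (-(f k ω) / 2) * Real.exp (-(f k ω) / 2)) = fun ω => Real.exp (-(f k ω)) := by
    intro k
    funext ω
    rw [← Real.exp_add]
    congr 1
    ring
  have hJ1 : ∀ k ∈ K 0, J k ≤ ν.real Set.univ := by
    intro k hk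
    have : J k ≤ ∫ _, (1:ℝ) ∂ν := by
      refine integral_mono ?_ (integrable_const _) fun ω => ?_
      · have := hi1 k hk k hk
        rwa [hsq] at this
      · exact Real.exp_le_one_iff.2 (by linarith [h0 k hk ω])
    simpa using this
  let I : ℕ → ℝ := fun n => sInf (J '' K n)
  have hbdd : ∀ n, BddBelow (J '' K n) := fun n => ⟨0, by rintro _ ⟨k, _, rfl⟩; exact hJ0 k⟩
  have hImono : Monotone I := fun n n' hn =>
    csInf_le_csInf (hbdd n) ((hne n').image J) (Set.image_mono (hanti hn))
  have hIle : ∀ n, I n ≤ ν.real Set.univ := fun n => by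
    obtain ⟨k, hk⟩ := hne n
    exact (csInf_le (hbdd n) ⟨k, hk, rfl⟩).trans (hJ1 k (hanti (Nat.zero_le n) hk))
  obtain ⟨Il, hIl⟩ : ∃ l, Tendsto I atTop (nhds l) :=
    ⟨_, tendsto_atTop_ciSup hImono ⟨_, by rintro _ ⟨n, rfl⟩; exact hIle n⟩⟩
  have hIlle : ∀ n, I n ≤ Il := fun n => hImono.ge_of_tendsto hIl n
  have hg : ∀ n : ℕ, ∃ k ∈ K n, J k < I n + 1 / ((n : ℝ) + 1) := by
    intro n
    obtain ⟨_, ⟨k, hk, rfl⟩, h⟩ := exists_lt_of_csInf_lt ((hne n).image J)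
      (show sInf (J '' K n) < I n + 1 / ((n : ℝ) + 1) from lt_add_of_pos_right _ (by positivity))
    exact ⟨k, hk, h⟩
  choose g hgK hgJ using hg
  let a : ℕ → Ω → ℝ := fun n ω => Real.exp (-(f (g n) ω) / 2)
  have hgK0 : ∀ n, g n ∈ K 0 := fun n => hanti (Nat.zero_le n) (hgK n)
  have ham : ∀ n, Measurable (a n) := fun n => by
    have := hm _ (hgK0 n)
    fun_prop
  let η : ℕ → ℝ := fun n => (Il - I n) + 2 * (1 / ((n : ℝ) + 1))
  have hη : Tendsto η atTop (nhds 0) := by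
    have h1 : Tendsto (fun n => Il - I n) atTop (nhds (Il - Il)) := tendsto_const_nhds.sub hIl
    have h2 := (tendsto_one_div_add_atTop_nhds_zero_nat (𝕜 := ℝ)).const_mul 2
    have := h1.add h2
    simpa [η] using this
  have hiaa : ∀ n n', Integrable (fun ω => a n ω * a n' ω) ν := fun n n' => hi1 _ (hgK0 n) _ (hgK0 n')
  have hidiff : ∀ n n', Integrable (fun ω => (a n ω - a n' ω) ^ 2) ν := fun n n' => by
    have := ((hiaa n n).add (hiaa n' n')).sub ((hiaa n n').const_mul 2)
    refine this.congr (Eventually.of_forall fun ω => ?_)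
    simp only [Pi.add_apply, Pi.sub_apply]
    ring
  have key : ∀ n n', n ≤ n' → ∫ ω, (a n ω - a n' ω) ^ 2 ∂ν ≤ η n := by
    intro n n' hn
    have e : (fun ω => (a n ω - a n' ω) ^ 2) = fun ω => (a n ω * a n ω + a n' ω * a n' ω) - 2 * (a n ω * a n' ω) := by
      funext ω; ring
    have hadd : Integrable (fun ω => a n ω * a n ω + a n' ω * a n' ω) ν := (hiaa n n).add (hiaa n' n')
    rw [e, integral_sub hadd ((hiaa n n').const_mul 2), integral_add (hiaa n n) (hiaa n' n'),
      integral_const_mul]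
    have e1 : ∫ ω, a n ω * a n ω ∂ν = J (g n) := by simp only [a, hsq, J]
    have e2 : ∫ ω, a n' ω * a n' ω ∂ν = J (g n') := by simp only [a, hsq, J]
    obtain ⟨k, hk, hkf⟩ := hmid n (g n) (hgK n) (g n') (hanti hn (hgK n'))
    have e3 : ∫ ω, a n ω * a n' ω ∂ν = J k := by
      refine integral_congr_ae (Eventually.of_forall fun ω => ?_)
      simp only [a]
      rw [← Real.exp_add, hkf]
      congr 1
      ring
    have h3 : I n ≤ J k := csInf_le (hbdd n) ⟨k, hk, rfl⟩
    have h1 := hgJ n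
    have h2 := hgJ n'
    have h4 := hIlle n'
    have h5 : 1 / ((n' : ℝ) + 1) ≤ 1 / ((n : ℝ) + 1) := by
      have : (n : ℝ) ≤ n' := by exact_mod_cast hn
      gcongr
    rw [e1, e2, e3]
    simp only [η]
    linarith
  obtain ⟨σ, hσ, hση⟩ := extraction_forall_of_eventually (P := fun j k => ∀ k' ≥ k, η k' < (1 / 4 : ℝ) ^ j)
    fun j => by
      have : ∀ᶠ k in atTop, η k < (1 / 4 : ℝ) ^ j := hη.eventually (gt_mem_nhds (by positivity))
      obtain ⟨k0, hk0⟩ := eventually_atTop.1 this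
      exact eventually_atTop.2 ⟨k0, fun k hk k' hk' => hk0 k' (hk.trans hk')⟩
  refine ⟨fun j => g (σ j), fun j => hanti (hσ.id_le j) (hgK _), ?_⟩
  set V := ν.real Set.univ with hV
  have hV0 : 0 ≤ V := measureReal_nonneg
  have key2 : ∀ j n n', σ j ≤ n → n ≤ n' → ∫ ω, |a n ω - a n' ω| ∂ν ≤ (1 / 2 : ℝ) ^ j * ((V + 1) / 2) := by
    intro j n n' hj hn
    have h1 : ∫ ω, (a n ω - a n' ω) ^ 2 ∂ν ≤ (1 / 4 : ℝ) ^ j := (key n n' hn).trans (hση j n hj).le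
    have h2 : ∫ ω, |a n ω - a n' ω| ∂ν ≤ ∫ ω, ((1 / 2 : ℝ) ^ j / 2 + 2 ^ j / 2 * (a n ω - a n' ω) ^ 2) ∂ν := by
      have hi : Integrable (fun ω => (1 / 2 : ℝ) ^ j / 2 + 2 ^ j / 2 * (a n ω - a n' ω) ^ 2) ν :=
        (integrable_const _).add ((hidiff n n').const_mul _)
      have hp : ∀ ω, |a n ω - a n' ω| ≤ (1 / 2 : ℝ) ^ j / 2 + 2 ^ j / 2 * (a n ω - a n' ω) ^ 2 := by
        intro ω
        rw [← sq_abs (a n ω - a n' ω)]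
        set u := |a n ω - a n' ω|
        have hp2 : (1 / 2 : ℝ) ^ j * 2 ^ j = 1 := by rw [← mul_pow]; norm_num
        have h2j : (0:ℝ) < 2 ^ j := by positivity
        have h2j' : (0:ℝ) < (1/2) ^ j := by positivity
        have : 0 ≤ 2 ^ j * (u - (1 / 2 : ℝ) ^ j) ^ 2 := by positivity
        have e : 2 ^ j * (u - (1 / 2 : ℝ) ^ j) ^ 2 = 2 ^ j * u ^ 2 - 2 * ((1 / 2 : ℝ) ^ j * 2 ^ j) * u + ((1 / 2 : ℝ) ^ j * 2 ^ j) * (1/2:ℝ)^j := by ring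
        rw [hp2] at e
        linarith
      refine integral_mono_of_nonneg (Eventually.of_forall fun ω => abs_nonneg _) hi (Eventually.of_forall hp)
    rw [integral_add (integrable_const _) ((hidiff n n').const_mul _), integral_const_mul] at h2
    simp only [integral_const, smul_eq_mul] at h2
    have h3 : (2:ℝ) ^ j / 2 * ∫ ω, (a n ω - a n' ω) ^ 2 ∂ν ≤ 2 ^ j / 2 * (1 / 4 : ℝ) ^ j :=
      mul_le_mul_of_nonneg_left h1 (by positivity)
    have h4 : (2:ℝ) ^ j * (1 / 4 : ℝ) ^ j = (1/2)^j := by rw [← mul_pow]; norm_num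
    rw [← hV] at h2
    linarith
  have hfin : ∀ j n n', j ≤ n → j ≤ n' →
      eLpNorm (a (σ n) - a (σ n')) 1 ν < ENNReal.ofReal ((1 / 2 : ℝ) ^ j * (V + 1)) := by
    have main : ∀ j n n', j ≤ n → n ≤ n' →
        eLpNorm (a (σ n) - a (σ n')) 1 ν < ENNReal.ofReal ((1 / 2 : ℝ) ^ j * (V + 1)) := by
      intro j n n' hj hn
      rw [eLpNorm_one_eq_lintegral_enorm]
      have hint : Integrable (fun ω => |a (σ n) ω - a (σ n') ω|) ν := by
        refine Integrable.of_bound ((ham _).sub (ham _)).abs.aestronglyMeasurable 1 (Eventually.of_forall fun ω => ?_)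
        have hb : ∀ k, 0 ≤ a k ω ∧ a k ω ≤ 1 := fun k => ⟨(Real.exp_pos _).le,
          Real.exp_le_one_iff.2 (by linarith [h0 _ (hgK0 k) ω])⟩
        rw [Real.norm_eq_abs, abs_abs, abs_le]
        constructor <;> linarith [(hb (σ n)).1, (hb (σ n')).1, (hb (σ n)).2, (hb (σ n')).2]
      have e : ∫⁻ ω, ‖(a (σ n) - a (σ n')) ω‖ₑ ∂ν = ENNReal.ofReal (∫ ω, |a (σ n) ω - a (σ n') ω| ∂ν) := by
        rw [ofReal_integral_eq_lintegral_ofReal hint (Eventually.of_forall fun ω => abs_nonneg _)]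
        refine lintegral_congr fun ω => ?_
        rw [Real.enorm_eq_ofReal_abs]
        rfl
      rw [e]
      refine (ENNReal.ofReal_lt_ofReal_iff (by positivity)).2 ?_
      refine (key2 j _ _ (hσ.monotone hj) (hσ.monotone hn)).trans_lt ?_
      have : (0:ℝ) < (1/2)^j := by positivity
      nlinarith
    intro j n n' hn hn'
    rcases le_total n n' with h | h
    · exact main j n n' hn h
    · rw [eLpNorm_sub_comm]
      exact main j n' n hn' h
  refine Lp.ae_tendsto_of_cauchy_eLpNorm (f := fun n => a (σ n)) (fun n => (ham _).aestronglyMeasurable) le_rfl ?_ hfin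
  rw [← ENNReal.ofReal_tsum_of_nonneg (fun j => by positivity)]
  · exact ENNReal.ofReal_ne_top
  · exact (summable_geometric_of_lt_one (by norm_num) (by norm_num)).mul_right _

end VM


namespace VM

lemma freq_of_lint {Ω : Type*} [MeasurableSpace Ω] {ν : Measure Ω} {g : ℕ → Ω → ℝ}
    (hg : ∀ n, Measurable (g n)) {C : ℝ} (h : ∀ n, ∫⁻ ω, ENNReal.ofReal (g n ω) ∂ν ≤ ENNReal.ofReal C) :
    ∀ᵐ ω ∂ν, ∃ K, ∃ᶠ n in atTop, g n ω ≤ K := by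
  have h1 : ∫⁻ ω, liminf (fun n => ENNReal.ofReal (g n ω)) atTop ∂ν ≤ ENNReal.ofReal C := by
    refine (lintegral_liminf_le fun n => (hg n).ennreal_ofReal).trans ?_
    refine liminf_le_of_frequently_le' (Eventually.frequently (Eventually.of_forall h))
  have hmeas : Measurable (fun ω => liminf (fun n => ENNReal.ofReal (g n ω)) atTop) :=
    Measurable.liminf fun n => (hg n).ennreal_ofReal
  have h2 := ae_lt_top hmeas (h1.trans_lt ENNReal.ofReal_lt_top).ne
  filter_upwards [h2] with ω hω
  obtain ⟨K, hK⟩ := ENNReal.lt_iff_exists_nnreal_btwn.1 hω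
  refine ⟨K, ?_⟩
  have h3 := frequently_lt_of_liminf_lt (by isBoundedDefault) hK.1
  refine h3.mono fun n hn => ?_
  by_contra hcon
  push Not at hcon
  have := ENNReal.ofReal_le_ofReal hcon.le
  rw [ENNReal.ofReal_coe_nnreal] at this
  exact absurd hn (not_lt.2 this)

lemma tendsto_of_exp {f : ℕ → ℝ} {l : ℝ} (h : Tendsto (fun n => Real.exp (-(f n) / 2)) atTop (nhds l))
    (hK : ∃ K, ∃ᶠ n in atTop, f n ≤ K) : ∃ l', Tendsto f atTop (nhds l') := by
  obtain ⟨K, hK⟩ := hK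
  have hl : Real.exp (-K / 2) ≤ l := by
    refine ge_of_tendsto_of_frequently h (hK.mono fun n hn => ?_)
    exact Real.exp_le_exp.2 (by linarith)
  have hl0 : l ≠ 0 := ((Real.exp_pos _).trans_le hl).ne'
  refine ⟨-2 * Real.log l, ?_⟩
  have := ((Real.continuousAt_log hl0).tendsto.comp h).const_mul (-2)
  refine this.congr fun n => ?_
  simp only [Function.comp, Real.log_exp]
  ring

section
variable {N d : ℕ} {μ : ℕ → Fin d → Measure ℝ} {π : Measure (Pth N d)}

/-- The functions used for the selection. -/
def sel (v : ℕ → Fin d → ℝ → ℝ) (C : ℝ) (φ χ : ℕ → Fin d → ℝ → ℝ) (b : Fin 3) (t : ℕ) (i : Fin d)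
    (y : ℝ) : ℝ :=
  if b = 0 then sl v C φ χ t i y else if b = 1 then χ t i y else χ (t + 1) i y

/-- Selection of a convergent sequence of approximate optimizers. -/
lemma exists_seq {c : Pth N d → ℝ} {v : ℕ → Fin d → ℝ → ℝ} (hN : 0 < N) (hd : 0 < d)
    (hπ : Mart μ π) (hc : LowerSemicontinuous c)
    (hvc : ∀ t i, Continuous (v t i)) (hvi : ∀ t < N, ∀ i, Integrable (v t i) (μ t i))
    (hcb : ∀ x, |c x| ≤ stat v x)
    (hmin : ∀ ρ, Mart μ ρ → ∫ x, c x ∂π ≤ ∫ x, c x ∂ρ)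
    (hirr : ∀ t, t + 1 < N → ∀ i, IrreduciblePair (μ t i) (μ (t + 1) i)) :
    ∃ (φ : ℕ → ℕ → Fin d → ℝ → ℝ) (H : ℕ → ℕ → Fin d → Pth N d → ℝ),
      (∀ n, GoodP N μ (φ n) ∧ GoodH (H n) ∧ (∀ x, stat (φ n) x + trade (H n) x ≤ c x) ∧
        ∫ x, c x ∂π - (1 / 2 : ℝ) ^ n ≤ val N μ (φ n)) ∧
      ∀ t < N, ∀ i, ∀ᵐ y ∂(μ t i), ∃ l : ℝ, Tendsto (fun n => φ n t i y) atTop (nhds l) := by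
  have hp := hπ.prob
  have gv : GoodP N μ v := fun t i => ⟨(hvc t i).measurable, fun ht => hvi t ht i⟩
  have hm : ∀ (t : ℕ) (i : Fin d), ∃ y : ℝ, ∀ s, t = s + 1 → t < N →
      potentialFn (μ s i) y < potentialFn (μ (s + 1) i) y := by
    intro t i
    by_cases h : ∃ s, t = s + 1 ∧ t < N
    · obtain ⟨s, rfl, hs⟩ := h
      have h1 := (hirr s hs i).2
      obtain ⟨y, hy⟩ : {x | potentialFn (μ s i) x < potentialFn (μ (s + 1) i) x}.Nonempty := by
        by_contra h
        rw [Set.not_nonempty_iff_eq_empty] at h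
        rw [h] at h1
        simp at h1
      refine ⟨y, fun s' hs' _ => ?_⟩
      obtain rfl : s = s' := by omega
      exact hy
    · exact ⟨0, fun s h1 h2 => absurd ⟨s, h1, h2⟩ h⟩
  choose m hm using hm
  set P := ∫ x, c x ∂π with hP
  set C := val N μ v - P + 1 with hC
  set C' := N * d * C + (val N μ v - P + 1) with hC'
  let E := (ℕ → Fin d → ℝ → ℝ) × (ℕ → Fin d → Pth N d → ℝ) × (ℕ → Fin d → ℝ → ℝ) × (ℕ → Fin d → ℝ → ℝ)
  let K : ℕ → Set E := fun n => {k | Adm μ c v m C P ((1 / 2 : ℝ) ^ n) k.1 k.2.1 k.2.2.1 k.2.2.2}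
  let f : E → (Pth N d × (Fin N × Fin d × Fin 3)) → ℝ := fun k w =>
    sel v C k.1 k.2.2.1 w.2.2.2 w.2.1 w.2.2.1 (X w.2.1 w.2.2.1 w.1)
  have hmsel : ∀ k ∈ K 0, ∀ b t i, Measurable (sel v C k.1 k.2.2.1 b t i) := by
    rintro ⟨φ, H, χ, r⟩ hk b t i
    have h1 : ∀ t i, Measurable (χ t i) := fun t i => (hk.sub t i).continuous.measurable
    have h2 : Measurable (φ t i) := (hk.gp t i).1
    have h3 : Measurable (v t i) := (gv t i).1
    have h4 := h1 t i
    have h5 := h1 (t + 1) i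
    unfold sel sl
    simp only
    split_ifs <;> fun_prop
  obtain ⟨k, hkK, hklim⟩ := komlos (π.prod (Measure.count : Measure (Fin N × Fin d × Fin 3))) K
    (fun n n' hn k hk => Adm.anti hk (pow_le_pow_of_le_one (by norm_num) (by norm_num) hn))
    (fun n => by
      obtain ⟨φ, H, χ, r, h⟩ := exists_adm hN hd hπ hc hvc hvi hcb hmin m
        (ε := (1 / 2 : ℝ) ^ n) (by positivity) (pow_le_one₀ (by norm_num) (by norm_num))
      exact ⟨(φ, H, χ, r), h⟩) f
    (fun k hk => by
      refine measurable_from_prod_countable_left fun j => ?_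
      exact (hmsel k hk j.2.2 j.1 j.2.1).comp (measurable_X (j.1 : ℕ) j.2.1))
    (fun k hk w => by
      simp only [f]
      unfold sel
      split_ifs
      · exact Adm.sl_nonneg hk w.2.1.2 _ _
      · exact Adm.nonneg hk _ _ _
      · exact Adm.nonneg hk _ _ _)
    (fun n k hk k' hk' => ⟨(_, _, _, _), Adm.mid hk hk', fun w => by
      simp only [f]
      unfold sel sl
      split_ifs <;> ring⟩)
  have hkA : ∀ n, Adm μ c v m C P ((1 / 2 : ℝ) ^ n) (k n).1 (k n).2.1 (k n).2.2.1 (k n).2.2.2 := hkK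
  have hkB := fun n => (hkA n).budget hπ hN gv (pow_le_one₀ (by norm_num) (by norm_num))
  refine ⟨fun n => (k n).1, fun n => (k n).2.1, fun n => ⟨(hkA n).gp, (hkA n).gh, (hkA n).le, (hkA n).va⟩, ?_⟩
  have hlim : ∀ᵐ x ∂π, ∀ j : Fin N × Fin d × Fin 3, ∃ l : ℝ,
      Tendsto (fun n => Real.exp (-(f (k n) (x, j)) / 2)) atTop (nhds l) := by
    filter_upwards [Measure.ae_ae_of_ae_prod hklim] with x hx
    exact Measure.ae_count_iff.1 hx
  -- slack
  have hsl : ∀ t < N, ∀ i, ∀ᵐ x ∂π, ∃ K, ∃ᶠ n in atTop, sl v C (k n).1 (k n).2.2.1 t i (X t i x) ≤ K := by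
    intro t ht i
    have hsm : ∀ n, Measurable (sl v C (k n).1 (k n).2.2.1 t i) := fun n => hmsel (k n)
      ((hkA n).anti (pow_le_pow_of_le_one (by norm_num) (by norm_num) (Nat.zero_le n))) 0 t i
    refine freq_of_lint (C := C') (fun n => ?_) fun n => ?_
    · exact (hsm n).comp (measurable_X t i)
    · have hb := (hkB n).1 t ht i
      have hi := hπ.integrable_comp ht i hb.1
      rw [← ofReal_integral_eq_lintegral_ofReal hi (Eventually.of_forall fun x => (hkA n).sl_nonneg ht i _)]
      refine ENNReal.ofReal_le_ofReal ?_
      rw [hπ.integral_comp ht i (hsm n)]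
      exact hb.2
  -- bounds before
  have hpre : ∀ t, t + 1 < N → ∀ i, ∀ᵐ x ∂π, ∃ K, ∀ n, |(k n).2.2.2 (t + 1) i (X t i x)| ≤ K ∧
      (k n).2.2.1 (t + 1) i (X t i x) ≤ K := by
    intro t ht i
    have hpm := hπ.probμ (show t < N by omega) i
    have hmeasI : MeasurableSet {x | potentialFn (μ t i) x < potentialFn (μ (t + 1) i) x} :=
      (hirr t ht i).1.ordConnected.measurableSet
    have h1 : ∀ᵐ y ∂(μ t i), y ∈ {x | potentialFn (μ t i) x < potentialFn (μ (t + 1) i) x} :=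
      (mem_ae_iff_prob_eq_one hmeasI).2 (hirr t ht i).2
    rw [← hπ.marg t (by omega) i] at h1
    have h2 := ae_of_ae_map (measurable_X t i).aemeasurable h1
    rw [hπ.marg t (by omega) i] at h2
    filter_upwards [h2] with x hx
    obtain ⟨K, hK⟩ := gap_bdd hπ ht i C' (hirr t ht i).1 hx (hm (t + 1) i t rfl ht)
    refine ⟨max K (K * |X t i x - m (t + 1) i|), fun n => ?_⟩
    have h3 := hK _ _ ((hkB n).2 t ht i)
    rw [(hkA n).zr, sub_zero] at h3
    refine ⟨h3.trans (le_max_left _ _), le_trans ?_ (le_max_right _ _)⟩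
    have h4 := (hkA n).sub (t + 1) i (X t i x) (m (t + 1) i)
    rw [(hkA n).zc] at h4
    have h5 : (k n).2.2.2 (t + 1) i (X t i x) * (X t i x - m (t + 1) i) ≤ K * |X t i x - m (t + 1) i| := by
      refine (le_abs_self _).trans ?_
      rw [abs_mul]
      exact mul_le_mul_of_nonneg_right h3 (abs_nonneg _)
    linarith
  have hpost : ∀ t, t + 1 < N → ∀ i, ∀ᵐ x ∂π, ∃ K, ∃ᶠ n in atTop, (k n).2.2.1 (t + 1) i (X (t + 1) i x) ≤ K := by
    intro t ht i
    have h1 : ∀ᵐ x ∂π, ∃ K, ∃ᶠ n in atTop, (k n).2.2.1 (t + 1) i (X (t + 1) i x) -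
        (k n).2.2.1 (t + 1) i (X t i x) - (k n).2.2.2 (t + 1) i (X t i x) * (X (t + 1) i x - X t i x) ≤ K := by
      refine freq_of_lint (C := C') (fun n => ?_) fun n => ?_
      · have m1 := ((hkA n).sub (t + 1) i).continuous.measurable
        have m2 := ((hkA n).sub (t + 1) i).mono.measurable
        fun_prop
      · obtain ⟨hs, i1, i2, hg⟩ := (hkB n).2 t ht i
        have j1 := hπ.integrable_comp (show t < N by omega) i i1
        have j2 := hπ.integrable_comp ht i i2
        have := (slack hπ ht i (j2.sub j1) hs.mono fun x => by
          have := hs (X t i x) (X (t + 1) i x)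
          simp only [Pi.sub_apply]
          linarith).2
        simp only [Pi.sub_apply] at this
        refine this.trans (ENNReal.ofReal_le_ofReal ?_)
        rw [integral_sub j2 j1, hπ.integral_comp ht i hs.continuous.measurable,
          hπ.integral_comp (by omega) i hs.continuous.measurable]
        exact hg
    filter_upwards [h1, hpre t ht i] with x ⟨K, hK⟩ ⟨K', hK'⟩
    refine ⟨K + K' + K' * |X (t + 1) i x - X t i x|, hK.mono fun n hn => ?_⟩
    obtain ⟨h3, h4⟩ := hK' n
    have h5 : (k n).2.2.2 (t + 1) i (X t i x) * (X (t + 1) i x - X t i x) ≤ K' * |X (t + 1) i x - X t i x| := by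
      refine (le_abs_self _).trans ?_
      rw [abs_mul]
      exact mul_le_mul_of_nonneg_right h3 (abs_nonneg _)
    linarith
  intro t ht i
  have hms : MeasurableSet {y | ∃ l, Tendsto (fun n => (k n).1 t i y) atTop (nhds l)} :=
    measurableSet_exists_tendsto fun n => ((hkA n).gp t i).1
  have h1 : ∀ᵐ x ∂π, ∃ l', Tendsto (fun n => (k n).2.2.1 t i (X t i x)) atTop (nhds l') := by
    rcases Nat.eq_zero_or_pos t with h0 | h0
    · subst h0
      refine Eventually.of_forall fun x => ⟨0, ?_⟩
      simp only [(hkA _).z0]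
      exact tendsto_const_nhds
    · obtain ⟨s, rfl⟩ : ∃ s, t = s + 1 := ⟨t - 1, by omega⟩
      filter_upwards [hlim, hpost s ht i] with x hx hx'
      obtain ⟨l, hl⟩ := hx (⟨s + 1, ht⟩, i, 1)
      simp only [f, sel, one_ne_zero, if_true, if_false] at hl
      exact tendsto_of_exp hl hx'
  have h2 : ∀ᵐ x ∂π, ∃ l', Tendsto (fun n => (k n).2.2.1 (t + 1) i (X t i x)) atTop (nhds l') := by
    rcases (Nat.succ_le_of_lt ht).eq_or_lt with h0 | h0
    · refine Eventually.of_forall fun x => ⟨0, ?_⟩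
      have : ∀ n y, (k n).2.2.1 (t + 1) i y = 0 := fun n y => by
        have e : t + 1 = N := h0
        rw [e]
        exact (hkA n).zN i y
      simp only [this]
      exact tendsto_const_nhds
    · filter_upwards [hlim, hpre t h0 i] with x hx ⟨K, hK⟩
      obtain ⟨l, hl⟩ := hx (⟨t, ht⟩, i, 2)
      have e1 : (2 : Fin 3) ≠ 0 := by decide
      have e2 : (2 : Fin 3) ≠ 1 := by decide
      simp only [f, sel, e1, e2, if_false] at hl
      exact tendsto_of_exp hl ⟨K, Eventually.frequently (Eventually.of_forall fun n => (hK n).2)⟩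
  have h3 : ∀ᵐ x ∂π, ∃ l', Tendsto (fun n => sl v C (k n).1 (k n).2.2.1 t i (X t i x)) atTop (nhds l') := by
    filter_upwards [hlim, hsl t ht i] with x hx hx'
    obtain ⟨l, hl⟩ := hx (⟨t, ht⟩, i, 0)
    simp only [f, sel, if_true] at hl
    exact tendsto_of_exp hl hx'
  rw [← hπ.marg t ht i]
  refine (ae_map_iff (measurable_X t i).aemeasurable hms).2 ?_
  filter_upwards [h1, h2, h3] with x ⟨l1, hl1⟩ ⟨l2, hl2⟩ ⟨l3, hl3⟩
  refine ⟨v t i (X t i x) + C + l2 - l1 - l3, ?_⟩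
  refine (((hl2.const_add (v t i (X t i x) + C)).sub hl1).sub hl3).congr fun n => ?_
  unfold sl
  ring

end
end VM


namespace VM

lemma meas_diag {Ω β : Type*} [MeasurableSpace Ω] [MeasurableSpace β] {g : ℕ → Ω → β}
    (hg : ∀ n, Measurable (g n)) {s : Ω → ℕ} (hs : Measurable s) : Measurable fun ω => g (s ω) ω := by
  have h : Measurable (fun p : ℕ × Ω => g p.1 p.2) := measurable_from_prod_countable_right fun n => hg n
  exact h.comp (hs.prodMk measurable_id)

/-- Measurable extraction of a convergent subsequence. -/
lemma exists_sub1 : ∃ S : ℕ → (ℕ → ℝ) → ℕ, (∀ n, Measurable (S n)) ∧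
    ∀ u, (∃ C, ∀ n, |u n| ≤ C) → Tendsto (fun n => S n u) atTop atTop ∧
      ∃ l, Tendsto (fun n => u (S n u)) atTop (nhds l) := by
  classical
  let l : (ℕ → ℝ) → ℝ := fun u => limsup u atTop
  have hl : Measurable l := Measurable.limsup fun n => measurable_pi_apply n
  let q : ℕ → (ℕ → ℝ) → ℕ → Prop := fun n u k => n ≤ k ∧ |u k - l u| < 1 / ((n : ℝ) + 1)
  let p : ℕ → (ℕ → ℝ) → ℕ → Prop := fun n u k => n ≤ k ∧ (q n u k ∨ ¬ ∃ j, q n u j)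
  have hp : ∀ n u, ∃ k, p n u k := by
    intro n u
    by_cases h : ∃ j, q n u j
    · obtain ⟨j, hj⟩ := h
      exact ⟨j, hj.1, Or.inl hj⟩
    · exact ⟨n, le_rfl, Or.inr h⟩
  have hq : ∀ n k, MeasurableSet {u | q n u k} := by
    intro n k
    have : Measurable fun u : ℕ → ℝ => |u k - l u| := ((measurable_pi_apply k).sub hl).abs
    exact (MeasurableSet.const _).inter (measurableSet_lt this measurable_const)
  refine ⟨fun n u => Nat.find (hp n u), fun n => ?_, fun u ⟨C, hC⟩ => ?_⟩
  · refine measurable_find (hp n) fun k => ?_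
    refine (MeasurableSet.const _).inter ((hq n k).union ?_)
    have : {u | ∃ j, q n u j} = ⋃ j, {u | q n u j} := by ext u; simp
    refine MeasurableSet.compl ?_
    change MeasurableSet {u | ∃ j, q n u j}
    rw [this]
    exact MeasurableSet.iUnion fun j => hq n j
  · have hspec := fun n => Nat.find_spec (hp n u)
    have hba : IsBoundedUnder (· ≤ ·) atTop u := ⟨C, eventually_map.2 (Eventually.of_forall fun n => (abs_le.1 (hC n)).2)⟩
    have hbb : IsBoundedUnder (· ≥ ·) atTop u := ⟨-C, eventually_map.2 (Eventually.of_forall fun n => (abs_le.1 (hC n)).1)⟩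
    have hex : ∀ n, ∃ j, q n u j := by
      intro n
      have he : (0:ℝ) < 1 / ((n : ℝ) + 1) := by positivity
      have h1 : ∃ᶠ k in atTop, l u - 1 / ((n : ℝ) + 1) < u k :=
        frequently_lt_of_lt_limsup hbb.isCoboundedUnder_le (by simp only [l]; linarith)
      have h2 : ∀ᶠ k in atTop, u k < l u + 1 / ((n : ℝ) + 1) :=
        eventually_lt_of_limsup_lt (by simp only [l]; linarith) hba
      obtain ⟨k, hk1, hk2, hk3⟩ := (h1.and_eventually (h2.and (eventually_ge_atTop n))).exists
      exact ⟨k, hk3, abs_lt.2 ⟨by linarith, by linarith⟩⟩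
    refine ⟨tendsto_atTop_mono (fun n => (hspec n).1) tendsto_id, l u, ?_⟩
    rw [tendsto_iff_dist_tendsto_zero]
    refine squeeze_zero (fun n => dist_nonneg) (fun n => ?_) (tendsto_one_div_add_atTop_nhds_zero_nat (𝕜 := ℝ))
    rw [Real.dist_eq]
    rcases (hspec n).2 with h | h
    · exact h.2.le
    · exact absurd (hex n) h

lemma exists_subd (d : ℕ) : ∃ S : ℕ → (ℕ → Fin d → ℝ) → ℕ, (∀ n, Measurable (S n)) ∧
    ∀ u, (∃ C, ∀ n i, |u n i| ≤ C) → Tendsto (fun n => S n u) atTop atTop ∧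
      ∀ i, ∃ l, Tendsto (fun n => u (S n u) i) atTop (nhds l) := by
  obtain ⟨S1, hS1, hS1'⟩ := exists_sub1
  have key : ∀ k ≤ d, ∃ S : ℕ → (ℕ → Fin d → ℝ) → ℕ, (∀ n, Measurable (S n)) ∧
    ∀ u, (∃ C, ∀ n i, |u n i| ≤ C) → Tendsto (fun n => S n u) atTop atTop ∧
      ∀ i : Fin d, (i : ℕ) < k → ∃ l, Tendsto (fun n => u (S n u) i) atTop (nhds l) := by
    intro k
    induction k with
    | zero =>
      intro _
      exact ⟨fun n _ => n, fun n => measurable_const, fun u _ => ⟨tendsto_id, fun i hi => absurd hi (by omega)⟩⟩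
    | succ k ih =>
      intro hk
      obtain ⟨S, hS, hS'⟩ := ih (by omega)
      let g : (ℕ → Fin d → ℝ) → ℕ → ℝ := fun u j => u (S j u) ⟨k, hk⟩
      have hg : Measurable g := by
        refine measurable_pi_lambda _ fun j => ?_
        exact meas_diag (g := fun n (u : ℕ → Fin d → ℝ) => u n ⟨k, hk⟩) (fun n => by fun_prop) (hS j)
      refine ⟨fun n u => S (S1 n (g u)) u, fun n => ?_, fun u ⟨C, hC⟩ => ?_⟩
      · exact meas_diag hS ((hS1 n).comp hg)
      · obtain ⟨h1, h2⟩ := hS' u ⟨C, hC⟩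
        obtain ⟨h3, h4⟩ := hS1' (g u) ⟨C, fun n => hC _ _⟩
        refine ⟨h1.comp h3, fun i hi => ?_⟩
        rcases (Nat.lt_succ_iff.1 hi).lt_or_eq with h | h
        · obtain ⟨l, hl⟩ := h2 i h
          exact ⟨l, hl.comp h3⟩
        · obtain ⟨l, hl⟩ := h4
          refine ⟨l, ?_⟩
          have : i = ⟨k, hk⟩ := Fin.ext h
          rw [this]
          exact hl
  obtain ⟨S, hS, hS'⟩ := key d le_rfl
  exact ⟨S, hS, fun u hu => ⟨(hS' u hu).1, fun i => (hS' u hu).2 i i.2⟩⟩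

end VM


namespace VM

section
variable {N d : ℕ} {μ : ℕ → Fin d → Measure ℝ} {π : Measure (Pth N d)}

/-- In the irreducible domain the second marginal charges both sides. -/
lemma both_sides (hπ : Mart μ π) {t : ℕ} (ht : t + 1 < N) (i : Fin d) {y : ℝ}
    (hy : potentialFn (μ t i) y < potentialFn (μ (t + 1) i) y) {B : Set ℝ}
    (hB : ∀ᵐ z ∂(μ (t + 1) i), z ∈ B) : ∃ a ∈ B, ∃ b ∈ B, a < y ∧ y < b := by
  have hp := hπ.prob
  have ht' : t < N := by omega
  have hp1 := hπ.probμ ht' i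
  have hp2 := hπ.probμ ht i
  have i1 := hπ.intμ ht' i
  have i2 := hπ.intμ ht i
  have hmean : ∫ z, z ∂(μ (t + 1) i) = ∫ z, z ∂(μ t i) := by
    have h := hπ.mart t ht i (fun _ => 1) measurable_const (fun _ _ _ => rfl) ⟨1, fun _ => by simp⟩
    simp only [one_mul] at h
    rw [integral_sub (hπ.int _ ht i) (hπ.int _ ht' i), hπ.integral_comp ht i (f := fun y => y) measurable_id,
      hπ.integral_comp ht' i (f := fun y => y) measurable_id] at h
    linarith
  have j1 : Integrable (fun z => |y - z|) (μ t i) := ((integrable_const y).sub i1).abs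
  have k1 : Integrable (fun z => y - z) (μ t i) := (integrable_const y).sub i1
  have k2 : Integrable (fun z => y - z) (μ (t + 1) i) := (integrable_const y).sub i2
  have e1 : ∫ z, (y - z) ∂(μ t i) = y - ∫ z, z ∂(μ t i) := by
    rw [integral_sub (integrable_const y) i1]; simp
  have e2 : ∫ z, (y - z) ∂(μ (t + 1) i) = y - ∫ z, z ∂(μ t i) := by
    rw [integral_sub (integrable_const y) i2, hmean]; simp
  have l1 : ∫ z, (y - z) ∂(μ t i) ≤ potentialFn (μ t i) y :=
    integral_mono k1 j1 fun z => le_abs_self _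
  have l2 : - ∫ z, (y - z) ∂(μ t i) ≤ potentialFn (μ t i) y := by
    rw [← integral_neg]
    exact integral_mono k1.neg j1 fun z => neg_le_abs _
  have ha : ∃ a ∈ B, a < y := by
    by_contra hcon
    push Not at hcon
    have : potentialFn (μ (t + 1) i) y = - ∫ z, (y - z) ∂(μ (t + 1) i) := by
      unfold potentialFn
      rw [← integral_neg]
      refine integral_congr_ae ?_
      filter_upwards [hB] with z hz
      exact abs_of_nonpos (by linarith [hcon z hz])
    linarith
  have hb : ∃ b ∈ B, y < b := by
    by_contra hcon
    push Not at hcon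
    have : potentialFn (μ (t + 1) i) y = ∫ z, (y - z) ∂(μ (t + 1) i) := by
      unfold potentialFn
      refine integral_congr_ae ?_
      filter_upwards [hB] with z hz
      exact abs_of_nonneg (by linarith [hcon z hz])
    linarith
  obtain ⟨a, ha, ha'⟩ := ha
  obtain ⟨b, hb, hb'⟩ := hb
  exact ⟨a, ha, b, hb, ha', hb'⟩

/-- Gains up to time `t`. -/
def gain (H : ℕ → Fin d → Pth N d → ℝ) (t : ℕ) (x : Pth N d) : ℝ :=
  ∑ s ∈ Finset.range t, ∑ i, H s i x * (X (s + 1) i x - X s i x)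

lemma gain_adp {H : ℕ → Fin d → Pth N d → ℝ} (hH : ∀ t i, Adp t (H t i)) (t : ℕ) : Adp t (gain H t) := by
  intro x y hxy
  unfold gain
  refine Finset.sum_congr rfl fun s hs => Finset.sum_congr rfl fun i _ => ?_
  have hs' := Finset.mem_range.1 hs
  rw [hH s i x y fun r hr => hxy r (by omega), adp_X (show s + 1 ≤ t by omega) i x y hxy,
    adp_X (show s ≤ t by omega) i x y hxy]

/-- Replace the position at time `t`. -/
def upd (t : ℕ) (w : Fin d → ℝ) (x : Pth N d) : Pth N d := fun s => if (s : ℕ) = t then w else x s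

lemma X_upd_self {t : ℕ} (ht : t < N) (w : Fin d → ℝ) (x : Pth N d) (i : Fin d) :
    X t i (upd t w x) = w i := by simp [X, upd, ht]

lemma X_upd_ne {s t : ℕ} (h : s ≠ t) (w : Fin d → ℝ) (x : Pth N d) (i : Fin d) :
    X s i (upd t w x) = X s i x := by simp [X, upd, h]

lemma upd_agree {t : ℕ} (w : Fin d → ℝ) (x : Pth N d) (s : Fin N) (hs : (s : ℕ) ≤ t) :
    upd (t + 1) w x s = x s := by
  have : (s : ℕ) ≠ t + 1 := by omega
  simp [upd, this]

variable {A : ℕ → Fin d → Set ℝ} {H : ℕ → ℕ → Fin d → Pth N d → ℝ}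

lemma gain_step (hH : ∀ n t i, Adp t (H n t i)) {t : ℕ} (ht : t + 1 < N)
    (hA : ∀ i, ∀ y ∈ A t i, ∃ a ∈ A (t + 1) i, ∃ b ∈ A (t + 1) i, a < y ∧ y < b)
    (hP : ∀ x, (∀ s < t + 2, ∀ i, X s i x ∈ A s i) → ∃ C, ∀ n, gain (H n) (t + 1) x ≤ C)
    (x : Pth N d) (hx : ∀ s < t + 1, ∀ i, X s i x ∈ A s i) :
    ∃ C δ, 0 < δ ∧ ∀ n, gain (H n) t x + δ * ∑ i, |H n t i x| ≤ C := by
  have hA' := fun i => hA i _ (hx t (by omega) i)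
  choose a ha b hb hab using hA'
  let w : (Fin d → Bool) → Fin d → ℝ := fun κ i => if κ i then b i else a i
  have hκ : ∀ κ, ∃ C, ∀ n, gain (H n) t x + ∑ i, H n t i x * (w κ i - X t i x) ≤ C := by
    intro κ
    obtain ⟨C, hC⟩ := hP (upd (t + 1) (w κ) x) (fun s hs i => by
      rcases eq_or_ne s (t + 1) with h | h
      · subst h
        rw [X_upd_self ht]
        simp only [w]
        split_ifs
        · exact hb i
        · exact ha i
      · rw [X_upd_ne h]
        exact hx s (by omega) i)
    refine ⟨C, fun n => le_trans (le_of_eq ?_) (hC n)⟩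
    have hag := upd_agree (N := N) (t := t) (w κ) x
    have e1 : gain (H n) (t + 1) (upd (t + 1) (w κ) x) = gain (H n) t (upd (t + 1) (w κ) x) +
        ∑ i, H n t i (upd (t + 1) (w κ) x) * (X (t + 1) i (upd (t + 1) (w κ) x) - X t i (upd (t + 1) (w κ) x)) :=
      Finset.sum_range_succ _ _
    rw [e1, gain_adp (hH n) t _ x hag]
    congr 1
    refine Finset.sum_congr rfl fun i _ => ?_
    rw [hH n t i _ x hag, X_upd_self ht, X_upd_ne (by omega)]
  choose C hC using hκ
  obtain ⟨δ, hδ, hδ'⟩ : ∃ δ > 0, ∀ i, δ ≤ X t i x - a i ∧ δ ≤ b i - X t i x := by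
    have : ∀ s : Finset (Fin d), ∃ δ > 0, ∀ i ∈ s, δ ≤ X t i x - a i ∧ δ ≤ b i - X t i x := by
      intro s
      induction s using Finset.induction_on with
      | empty => exact ⟨1, one_pos, by simp⟩
      | insert j s hj ih =>
        obtain ⟨δ, hδ, h⟩ := ih
        refine ⟨min δ (min (X t j x - a j) (b j - X t j x)), lt_min hδ (lt_min (by linarith [(hab j).1]) (by linarith [(hab j).2])), fun i hi => ?_⟩
        rcases Finset.mem_insert.1 hi with rfl | hi
        · exact ⟨(min_le_right _ _).trans (min_le_left _ _), (min_le_right _ _).trans (min_le_right _ _)⟩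
        · exact ⟨(min_le_left _ _).trans (h i hi).1, (min_le_left _ _).trans (h i hi).2⟩
    obtain ⟨δ, h1, h2⟩ := this Finset.univ
    exact ⟨δ, h1, fun i => h2 i (Finset.mem_univ i)⟩
  refine ⟨∑ κ, |C κ|, δ, hδ, fun n => ?_⟩
  let κ : Fin d → Bool := fun i => decide (0 ≤ H n t i x)
  have h1 := hC κ n
  have h2 : C κ ≤ ∑ κ, |C κ| := (le_abs_self _).trans
    (Finset.single_le_sum (f := fun κ => |C κ|) (fun κ _ => abs_nonneg _) (Finset.mem_univ κ))
  have h3 : δ * ∑ i, |H n t i x| ≤ ∑ i, H n t i x * (w κ i - X t i x) := by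
    rw [Finset.mul_sum]
    refine Finset.sum_le_sum fun i _ => ?_
    by_cases h : 0 ≤ H n t i x
    · have : w κ i = b i := by simp [w, κ, h]
      rw [this, abs_of_nonneg h, mul_comm]
      exact mul_le_mul_of_nonneg_left (hδ' i).2 h
    · have : w κ i = a i := by simp [w, κ, h]
      push Not at h
      rw [this, abs_of_neg h]
      nlinarith [(hδ' i).1]
  linarith

lemma gain_bdd (hH : ∀ n t i, Adp t (H n t i)) {n0 : ℕ} (hN : N = n0 + 1)
    (hA : ∀ t, t + 1 < N → ∀ i, ∀ y ∈ A t i, ∃ a ∈ A (t + 1) i, ∃ b ∈ A (t + 1) i, a < y ∧ y < b)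
    (hP : ∀ x, (∀ s < N, ∀ i, X s i x ∈ A s i) → ∃ C, ∀ n, gain (H n) n0 x ≤ C) :
    ∀ t < n0, ∀ x : Pth N d, (∀ s < t + 1, ∀ i, X s i x ∈ A s i) →
      ∃ C δ, 0 < δ ∧ ∀ n, gain (H n) t x + δ * ∑ i, |H n t i x| ≤ C := by
  have key : ∀ k ≤ n0, ∀ x : Pth N d, (∀ s < n0 - k + 1, ∀ i, X s i x ∈ A s i) →
      ∃ C, ∀ n, gain (H n) (n0 - k) x ≤ C := by
    intro k
    induction k with
    | zero =>
      intro _ x hx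
      exact hP x fun s hs => hx s (by omega)
    | succ k ih =>
      intro hk x hx
      obtain ⟨C, δ, hδ, h⟩ := gain_step hH (t := n0 - (k + 1)) (by omega) (hA _ (by omega))
        (fun y hy => by
          have e : n0 - (k + 1) + 1 = n0 - k := by omega
          rw [e]
          exact ih (by omega) y fun s hs => hy s (by omega)) x hx
      refine ⟨C, fun n => le_trans ?_ (h n)⟩
      have : 0 ≤ δ * ∑ i, |H n (n0 - (k + 1)) i x| :=
        mul_nonneg hδ.le (Finset.sum_nonneg fun i _ => abs_nonneg _)
      linarith
  intro t ht x hx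
  refine gain_step hH (by omega) (hA t (by omega)) (fun y hy => ?_) x hx
  have := key (n0 - (t + 1)) (by omega) y
  have e : n0 - (n0 - (t + 1)) = t + 1 := by omega
  rw [e] at this
  exact this hy

end
end VM


namespace VM

section
variable {N d : ℕ} {μ : ℕ → Fin d → Measure ℝ} {π : Measure (Pth N d)}
variable {A : ℕ → Fin d → Set ℝ} {H : ℕ → ℕ → Fin d → Pth N d → ℝ}

lemma lim_strat (hH : ∀ n t i, Adp t (H n t i)) (hm : ∀ n t i, Measurable (H n t i)) {n0 : ℕ}
    (hB : ∀ t < n0, ∀ x : Pth N d, (∀ s < t + 1, ∀ i, X s i x ∈ A s i) →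
      ∃ C δ, 0 < δ ∧ ∀ n, gain (H n) t x + δ * ∑ i, |H n t i x| ≤ C) :
    ∀ t ≤ n0, ∃ (σ : ℕ → Pth N d → ℕ) (L : ℕ → Fin d → Pth N d → ℝ),
      (∀ n, Measurable (σ n)) ∧
      (∀ n x y, (∀ s : Fin N, (s : ℕ) < t → x s = y s) → σ n x = σ n y) ∧
      (∀ s i, Measurable (L s i)) ∧ (∀ s i, Adp s (L s i)) ∧
      ∀ x, (∀ s < t, ∀ i, X s i x ∈ A s i) → Tendsto (fun n => σ n x) atTop atTop ∧
        ∀ s < t, ∀ i, Tendsto (fun n => H (σ n x) s i x) atTop (nhds (L s i x)) := by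
  obtain ⟨S, hS, hS'⟩ := exists_subd d
  intro t
  induction t with
  | zero =>
    intro _
    exact ⟨fun n _ => n, fun _ _ _ => 0, fun n => measurable_const, fun _ _ _ _ => rfl,
      fun _ _ => measurable_const, fun _ _ _ _ _ => rfl, fun x _ => ⟨tendsto_id, fun s hs => absurd hs (by omega)⟩⟩
  | succ t ih =>
    intro ht
    obtain ⟨σ, L, h1, h2, h3, h4, h5⟩ := ih (by omega)
    let u : Pth N d → ℕ → Fin d → ℝ := fun x k i => H (σ k x) t i x
    have hu : Measurable u := by
      refine measurable_pi_lambda _ fun k => measurable_pi_lambda _ fun i => ?_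
      exact meas_diag (fun n => hm n t i) (h1 k)
    let τ : ℕ → Pth N d → ℕ := fun n x => σ (S n (u x)) x
    have hτ : ∀ n, Measurable (τ n) := fun n => meas_diag h1 ((hS n).comp hu)
    have uadp : ∀ x y, (∀ s : Fin N, (s : ℕ) < t + 1 → x s = y s) → u x = u y := by
      intro x y hxy
      funext k i
      simp only [u]
      rw [h2 k x y fun s hs => hxy s (by omega), hH _ t i x y fun s hs => hxy s (by omega)]
    have τadp : ∀ n x y, (∀ s : Fin N, (s : ℕ) < t + 1 → x s = y s) → τ n x = τ n y := by
      intro n x y hxy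
      simp only [τ]
      rw [uadp x y hxy, h2 _ x y fun s hs => hxy s (by omega)]
    let L' : ℕ → Fin d → Pth N d → ℝ := fun s i x =>
      if s = t then limsup (fun n => H (τ n x) t i x) atTop else L s i x
    refine ⟨τ, L', hτ, τadp, fun s i => ?_, fun s i x y hxy => ?_, fun x hx => ?_⟩
    · by_cases h : s = t
      · simp only [L', h, if_true]
        exact Measurable.limsup fun n => meas_diag (fun n => hm n t i) (hτ n)
      · simp only [L', h, if_false]
        exact h3 s i
    · by_cases h : s = t
      · subst h
        simp only [L', if_true]
        have : (fun n => H (τ n x) s i x) = fun n => H (τ n y) s i y := by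
          funext n
          rw [τadp n x y fun r hr => hxy r (by omega), hH _ s i x y hxy]
        rw [this]
      · simp only [L', h, if_false]
        exact h4 s i x y hxy
    · obtain ⟨g1, g2⟩ := h5 x fun s hs => hx s (by omega)
      obtain ⟨C, δ, hδ, hC⟩ := hB t (by omega) x hx
      have hgl : Tendsto (fun n => gain (H (σ n x)) t x) atTop
          (nhds (∑ s ∈ Finset.range t, ∑ i, L s i x * (X (s + 1) i x - X s i x))) := by
        unfold gain
        refine tendsto_finsetSum _ fun s hs => tendsto_finsetSum _ fun i _ => ?_
        exact (g2 s (Finset.mem_range.1 hs) i).mul_const _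
      obtain ⟨B, hBb⟩ := hgl.bddBelow_range
      have hub : ∃ C, ∀ n i, |u x n i| ≤ C := by
        refine ⟨(C - B) / δ, fun n i => ?_⟩
        rw [le_div_iff₀ hδ]
        have e1 := hC (σ n x)
        have e2 : B ≤ gain (H (σ n x)) t x := hBb ⟨n, rfl⟩
        have e3 : |H (σ n x) t i x| ≤ ∑ i, |H (σ n x) t i x| :=
          Finset.single_le_sum (f := fun i => |H (σ n x) t i x|) (fun j _ => abs_nonneg _) (Finset.mem_univ i)
        have e4 := mul_le_mul_of_nonneg_left e3 hδ.le
        simp only [u]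
        linarith
      obtain ⟨k1, k2⟩ := hS' (u x) hub
      refine ⟨g1.comp k1, fun s hs i => ?_⟩
      by_cases h : s = t
      · subst h
        obtain ⟨l, hl⟩ := k2 i
        have hl' : Tendsto (fun n => H (τ n x) s i x) atTop (nhds l) := hl
        simp only [L', if_true]
        rw [hl'.limsup_eq]
        exact hl'
      · simp only [L', h, if_false]
        exact (g2 s (by omega) i).comp k1

/-- Dual attainment, internal version. -/
lemma attain {c : Pth N d → ℝ} {v : ℕ → Fin d → ℝ → ℝ} (hN : 0 < N) (hd : 0 < d)
    (hπ : Mart μ π) (hc : LowerSemicontinuous c)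
    (hvc : ∀ t i, Continuous (v t i)) (hvi : ∀ t < N, ∀ i, Integrable (v t i) (μ t i))
    (hcb : ∀ x, |c x| ≤ stat v x)
    (hmin : ∀ ρ, Mart μ ρ → ∫ x, c x ∂π ≤ ∫ x, c x ∂ρ)
    (hirr : ∀ t, t + 1 < N → ∀ i, IrreduciblePair (μ t i) (μ (t + 1) i)) :
    ∃ (A : ℕ → Fin d → Set ℝ) (φ : ℕ → Fin d → ℝ → ℝ) (L : ℕ → Fin d → Pth N d → ℝ),
      (∀ t i, MeasurableSet (A t i)) ∧ (∀ t < N, ∀ i, ∀ᵐ y ∂(μ t i), y ∈ A t i) ∧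
      (∀ t i, Measurable (φ t i)) ∧ (∀ t i, Measurable (L t i)) ∧ (∀ t i, Adp t (L t i)) ∧
      (∀ x : Pth N d, (∀ s < N, ∀ i, X s i x ∈ A s i) → stat φ x + trade L x ≤ c x) ∧
      ∀ ρ, Mart μ ρ → ∫ x, c x ∂ρ ≤ ∫ x, c x ∂π → ∀ᵐ x ∂ρ, stat φ x + trade L x = c x := by
  obtain ⟨φ, H, hgood, hlim⟩ := exists_seq hN hd hπ hc hvc hvi hcb hmin hirr
  obtain ⟨n0, hn0⟩ : ∃ n0, N = n0 + 1 := ⟨N - 1, by omega⟩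
  have hHa : ∀ n t i, Adp t (H n t i) := fun n t i => ((hgood n).2.1 t i).2.1
  have hHm : ∀ n t i, Measurable (H n t i) := fun n t i => ((hgood n).2.1 t i).1
  let A : ℕ → Fin d → Set ℝ := fun t i => {y | ∃ l, Tendsto (fun n => φ n t i y) atTop (nhds l)} ∩
    {y | t + 1 < N → potentialFn (μ t i) y < potentialFn (μ (t + 1) i) y}
  have hIm : ∀ t i, MeasurableSet {y | t + 1 < N → potentialFn (μ t i) y < potentialFn (μ (t + 1) i) y} := by
    intro t i
    by_cases h : t + 1 < N
    · simp only [h, forall_true_left]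
      exact (hirr t h i).1.ordConnected.measurableSet
    · simp [h]
  have hAm : ∀ t i, MeasurableSet (A t i) := fun t i =>
    (measurableSet_exists_tendsto fun n => ((hgood n).1 t i).1).inter (hIm t i)
  have hAf : ∀ t < N, ∀ i, ∀ᵐ y ∂(μ t i), y ∈ A t i := by
    intro t ht i
    have hp := hπ.probμ ht i
    have h2 : ∀ᵐ y ∂(μ t i), t + 1 < N → potentialFn (μ t i) y < potentialFn (μ (t + 1) i) y := by
      by_cases h : t + 1 < N
      · have hmeasI : MeasurableSet {x | potentialFn (μ t i) x < potentialFn (μ (t + 1) i) x} :=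
          (hirr t h i).1.ordConnected.measurableSet
        have h1 : ∀ᵐ y ∂(μ t i), y ∈ {x | potentialFn (μ t i) x < potentialFn (μ (t + 1) i) x} :=
          (mem_ae_iff_prob_eq_one hmeasI).2 (hirr t h i).2
        filter_upwards [h1] with y hy _ using hy
      · exact Eventually.of_forall fun y hy => absurd hy h
    filter_upwards [hlim t ht i, h2] with y h1 h2 using ⟨h1, h2⟩
  have hAs : ∀ t, t + 1 < N → ∀ i, ∀ y ∈ A t i, ∃ a ∈ A (t + 1) i, ∃ b ∈ A (t + 1) i, a < y ∧ y < b :=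
    fun t ht i y hy => both_sides hπ ht i (hy.2 ht) (hAf (t + 1) ht i)
  let Φ : ℕ → Fin d → ℝ → ℝ := fun t i y => limsup (fun n => φ n t i y) atTop
  have hΦm : ∀ t i, Measurable (Φ t i) := fun t i => Measurable.limsup fun n => ((hgood n).1 t i).1
  have hΦ : ∀ t i, ∀ y ∈ A t i, Tendsto (fun n => φ n t i y) atTop (nhds (Φ t i y)) := by
    intro t i y hy
    obtain ⟨l, hl⟩ := hy.1
    simp only [Φ]
    rwa [hl.limsup_eq]
  have hstat : ∀ x : Pth N d, (∀ s < N, ∀ i, X s i x ∈ A s i) →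
      Tendsto (fun n => stat (φ n) x) atTop (nhds (stat Φ x)) := by
    intro x hx
    unfold stat
    exact tendsto_finsetSum _ fun t ht => tendsto_finsetSum _ fun i _ =>
      hΦ t i _ (hx t (Finset.mem_range.1 ht) i)
  have egain : ∀ (K : ℕ → Fin d → Pth N d → ℝ) x, trade K x = gain K n0 x := by
    intro K x
    have : N - 1 = n0 := by omega
    unfold trade gain
    rw [this]
  have hP : ∀ x : Pth N d, (∀ s < N, ∀ i, X s i x ∈ A s i) → ∃ C, ∀ n, gain (H n) n0 x ≤ C := by
    intro x hx
    obtain ⟨B, hB⟩ := (hstat x hx).bddBelow_range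
    refine ⟨c x - B, fun n => ?_⟩
    have h1 := (hgood n).2.2.1 x
    rw [egain] at h1
    have h2 : B ≤ stat (φ n) x := hB ⟨n, rfl⟩
    linarith
  obtain ⟨σ, L, hσ1, hσ2, hL1, hL2, hL3⟩ := lim_strat hHa hHm (gain_bdd hHa hn0 hAs hP) n0 le_rfl
  have hconv : ∀ x : Pth N d, (∀ s < N, ∀ i, X s i x ∈ A s i) → Tendsto (fun n => σ n x) atTop atTop ∧
      Tendsto (fun n => stat (φ (σ n x)) x + trade (H (σ n x)) x) atTop (nhds (stat Φ x + trade L x)) := by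
    intro x hx
    obtain ⟨h1, h2⟩ := hL3 x fun s hs => hx s (by omega)
    refine ⟨h1, ((hstat x hx).comp h1).add ?_⟩
    unfold trade
    refine tendsto_finsetSum _ fun t ht => tendsto_finsetSum _ fun i _ => ?_
    have := Finset.mem_range.1 ht
    exact (h2 t (by omega) i).mul_const _
  refine ⟨A, Φ, L, hAm, hAf, hΦm, hL1, hL2, fun x hx => ?_, fun ρ hρ hle => ?_⟩
  · exact le_of_tendsto (hconv x hx).2 (Eventually.of_forall fun n => (hgood _).2.2.1 x)
  · have hpρ := hρ.prob
    have hgoodx : ∀ᵐ x ∂ρ, ∀ s < N, ∀ i, X s i x ∈ A s i := by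
      rw [ae_all_iff]
      intro s
      by_cases hs : s < N
      · simp only [hs, forall_true_left]
        rw [ae_all_iff]
        intro i
        have := hAf s hs i
        rw [← hρ.marg s hs i] at this
        exact ae_of_ae_map (measurable_X s i).aemeasurable this
      · simp [hs]
    have gv : GoodP N μ v := fun t i => ⟨(hvc t i).measurable, fun ht => hvi t ht i⟩
    have hci : Integrable c ρ := (hρ.stat gv).1.mono' hc.measurable.aestronglyMeasurable
      (Eventually.of_forall fun x => hcb x)
    have hgap : ∀ n, Integrable (fun x => c x - (stat (φ n) x + trade (H n) x)) ρ ∧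
        ∫ x, (c x - (stat (φ n) x + trade (H n) x)) ∂ρ ≤ (1 / 2 : ℝ) ^ n := by
      intro n
      obtain ⟨g1, g2, g3, g4⟩ := hgood n
      have i1 : Integrable (fun x => stat (φ n) x + trade (H n) x) ρ := (hρ.stat g1).1.add (hρ.trade g2).1
      refine ⟨hci.sub i1, ?_⟩
      rw [integral_sub hci i1, integral_add (hρ.stat g1).1 (hρ.trade g2).1, (hρ.stat g1).2, (hρ.trade g2).2]
      linarith
    have hto : ∀ᵐ x ∂ρ, Tendsto (fun n => c x - (stat (φ n) x + trade (H n) x)) atTop (nhds 0) := by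
      have hmz : ∀ n, AEMeasurable (fun x => ENNReal.ofReal (c x - (stat (φ n) x + trade (H n) x))) ρ :=
        fun n => (hgap n).1.1.aemeasurable.ennreal_ofReal
      have h1 : ∫⁻ x, ∑' n, ENNReal.ofReal (c x - (stat (φ n) x + trade (H n) x)) ∂ρ ≠ ⊤ := by
        rw [lintegral_tsum hmz]
        have : ∑' n, ∫⁻ x, ENNReal.ofReal (c x - (stat (φ n) x + trade (H n) x)) ∂ρ ≤
            ∑' n, ENNReal.ofReal ((1 / 2 : ℝ) ^ n) := by
          refine ENNReal.tsum_le_tsum fun n => ?_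
          rw [← ofReal_integral_eq_lintegral_ofReal (hgap n).1
            (Eventually.of_forall fun x => sub_nonneg.2 ((hgood n).2.2.1 x))]
          exact ENNReal.ofReal_le_ofReal (hgap n).2
        refine ne_top_of_le_ne_top ?_ this
        rw [← ENNReal.ofReal_tsum_of_nonneg (fun j => by positivity)
          (summable_geometric_of_lt_one (by norm_num) (by norm_num))]
        exact ENNReal.ofReal_ne_top
      have h2 := ae_lt_top' (AEMeasurable.tsum hmz) h1
      filter_upwards [h2] with x hx
      have h3 := ENNReal.tendsto_atTop_zero_of_tsum_ne_top hx.ne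
      have h4 := (ENNReal.tendsto_toReal ENNReal.zero_ne_top).comp h3
      rw [ENNReal.toReal_zero] at h4
      refine h4.congr fun n => ?_
      simp only [Function.comp]
      exact ENNReal.toReal_ofReal (sub_nonneg.2 ((hgood n).2.2.1 x))
    filter_upwards [hgoodx, hto] with x hx hx2
    obtain ⟨h1, h2⟩ := hconv x hx
    have h3 := hx2.comp h1
    have h4 := h2.const_sub (c x)
    have h5 := tendsto_nhds_unique h4 h3
    linarith

end
end VM


namespace VM

lemma ereal_coe_sum {ι : Type*} (s : Finset ι) (f : ι → ℝ) :
    ((∑ i ∈ s, f i : ℝ) : EReal) = ∑ i ∈ s, (f i : EReal) := by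
  classical
  induction s using Finset.induction_on with
  | empty => simp
  | insert a s ha ih => rw [Finset.sum_insert ha, Finset.sum_insert ha, EReal.coe_add, ih]

lemma ereal_sum_bot {ι : Type*} (s : Finset ι) (f : ι → EReal) (a : ι) (ha : a ∈ s)
    (h : f a = ⊥) : ∑ i ∈ s, f i = ⊥ := by
  classical
  rw [← Finset.add_sum_erase s f ha, h, EReal.bot_add]

section
variable {N d : ℕ}

lemma payout_real (φ : Fin N → Fin d → ℝ → EReal)
    (h : (t : ℕ) → Fin d → (Fin t → Fin d → ℝ) → ℝ) (x : Pth N d) (g : Fin N → Fin d → ℝ)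
    (hg : ∀ t i, φ t i (x t i) = (g t i : EReal)) :
    portfolioPayout N d φ h x = ((∑ t : Fin N, ∑ i : Fin d, (g t i +
      (if ht : (t : ℕ) + 1 < N then
          h ((t : ℕ) + 1) i (fun s => x ⟨s.val, by have := s.isLt; have := t.isLt; omega⟩) *
            (x ⟨(t : ℕ) + 1, ht⟩ i - x t i)
        else 0)) : ℝ) : EReal) := by
  unfold portfolioPayout
  rw [ereal_coe_sum]
  refine Finset.sum_congr rfl fun t _ => ?_
  rw [ereal_coe_sum]
  refine Finset.sum_congr rfl fun i _ => ?_
  rw [hg, EReal.coe_add]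

lemma payout_bot (φ : Fin N → Fin d → ℝ → EReal)
    (h : (t : ℕ) → Fin d → (Fin t → Fin d → ℝ) → ℝ) (x : Pth N d) (t : Fin N) (i : Fin d)
    (hg : φ t i (x t i) = ⊥) : portfolioPayout N d φ h x = ⊥ := by
  unfold portfolioPayout
  refine ereal_sum_bot _ _ t (Finset.mem_univ _) ?_
  refine ereal_sum_bot _ _ i (Finset.mem_univ _) ?_
  rw [hg, EReal.bot_add]

lemma X_fin (t : Fin N) (i : Fin d) (x : Pth N d) : X (t : ℕ) i x = x t i := by
  simp [X]

/-- Strategies in terms of the past. -/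
def strat (L : ℕ → Fin d → Pth N d → ℝ) : (t : ℕ) → Fin d → (Fin t → Fin d → ℝ) → ℝ
  | 0, _, _ => 0
  | (t + 1), i, z => L t i (extd N (t + 1) z)

lemma measurable_strat {L : ℕ → Fin d → Pth N d → ℝ} (hL : ∀ t i, Measurable (L t i)) (t : ℕ)
    (i : Fin d) : Measurable (strat L t i) := by
  cases t with
  | zero => exact measurable_const
  | succ t => exact (hL t i).comp (measurable_extd (t + 1))

lemma payout_strat (φ : Fin N → Fin d → ℝ → EReal) {L : ℕ → Fin d → Pth N d → ℝ}
    (hA : ∀ t i, Adp t (L t i)) (x : Pth N d) (f : ℕ → Fin d → ℝ → ℝ)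
    (hg : ∀ (t : Fin N) i, φ t i (x t i) = (f t i (x t i) : EReal)) :
    portfolioPayout N d φ (strat L) x = ((stat f x + trade L x : ℝ) : EReal) := by
  rw [payout_real φ (strat L) x (fun t i => f t i (x t i)) hg]
  congr 1
  simp only [Finset.sum_add_distrib]
  congr 1
  · rw [stat, Finset.sum_range]
    simp only [X_fin]
  · have key : ∀ t : Fin N, (∑ i : Fin d, (if ht : (t : ℕ) + 1 < N then
          strat L ((t : ℕ) + 1) i
            (fun s => x ⟨s.val, by have := s.isLt; have := t.isLt; omega⟩) *
            (x ⟨(t : ℕ) + 1, ht⟩ i - x t i)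
        else 0)) = (fun t : ℕ => if t + 1 < N then
          ∑ i, L t i x * (X (t + 1) i x - X t i x) else 0) t := by
      intro t
      beta_reduce
      split_ifs with ht
      · refine Finset.sum_congr rfl fun i _ => ?_
        rw [X_fin]
        congr 1
        · rw [← extd_rest (hA t i) x]
          change L t i (extd N (t + 1) _) = _
          congr 2
          funext s j
          simp [rest, X, show (s : ℕ) < N from by have := s.isLt; omega]
        · simp [X, ht]
      · simp
    rw [Finset.sum_congr rfl fun t _ => key t, ← Finset.sum_range (fun t : ℕ => if t + 1 < N then
          ∑ i, L t i x * (X (t + 1) i x - X t i x) else 0), trade]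
    symm
    refine Finset.sum_subset_zero_on_sdiff ?_ ?_ ?_
    · intro t ht
      simp only [Finset.mem_range] at ht ⊢
      omega
    · intro t ht
      simp only [Finset.mem_sdiff, Finset.mem_range] at ht
      rw [if_neg (by omega)]
    · intro t ht
      simp only [Finset.mem_range] at ht
      rw [if_pos (by omega)]

end
end VM

theorem dual_attainment_min (N d : ℕ) (hN : 2 ≤ N) (hd : 1 ≤ d)
    (μ : Fin N → Fin d → Measure ℝ)
    (hprob : ∀ t i, IsProbabilityMeasure (μ t i))
    (hmom : ∀ t i, Integrable id (μ t i))
    (hord : ∀ (t : ℕ) (ht : t + 1 < N) (i : Fin d),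
      ConvexOrder1 (μ ⟨t, by omega⟩ i) (μ ⟨t + 1, ht⟩ i) ∧
      IrreduciblePair (μ ⟨t, by omega⟩ i) (μ ⟨t + 1, ht⟩ i))
    (c : (Fin N → Fin d → ℝ) → ℝ)
    (hc : LowerSemicontinuous c)
    (v : Fin N → Fin d → ℝ → ℝ)
    (hv : ∀ t i, Continuous (v t i) ∧ Integrable (v t i) (μ t i))
    (hcbound : ∀ x, |c x| ≤ ∑ t : Fin N, ∑ i : Fin d, v t i (x t i)) :
    ∃ (φ : Fin N → Fin d → ℝ → EReal)
      (h : (t : ℕ) → Fin d → (Fin t → Fin d → ℝ) → ℝ),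
      (∀ t i, Measurable (φ t i)) ∧
      (∀ t i x, φ t i x ≠ ⊤) ∧
      (∀ t i, ∀ᵐ y ∂(μ t i), φ t i y ≠ ⊥) ∧
      (∀ t i, Measurable (h t i)) ∧
      (∀ x, portfolioPayout N d φ h x ≤ (c x : EReal)) ∧
      (∀ π ∈ VMT N d μ, (∀ π' ∈ VMT N d μ, ∫ x, c x ∂π ≤ ∫ x, c x ∂π') →
        ∀ᵐ x ∂π, portfolioPayout N d φ h x = (c x : EReal)) := by
  classical
  by_cases hex : ∃ π ∈ VMT N d μ, ∀ π' ∈ VMT N d μ, ∫ x, c x ∂π ≤ ∫ x, c x ∂π'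
  · obtain ⟨π, hπ, hmin⟩ := hex
    have hmu : ∀ t (ht : t < N) i, VM.muN μ t i = μ ⟨t, ht⟩ i := fun t ht i => by
      simp [VM.muN, ht]
    obtain ⟨A, f, L, hAm, hAf, hfm, hLm, hLA, hle, heq⟩ :=
      VM.attain (μ := VM.muN μ) (π := π) (c := c)
        (v := fun t i => if h : t < N then v ⟨t, h⟩ i else fun _ => 0) (by omega) (by omega)
        (VM.mart_of_vmt hmom hπ) hc
        (fun t i => by
          by_cases h : t < N
          · simpa [h] using (hv ⟨t, h⟩ i).1
          · simpa [h] using continuous_const)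
        (fun t h i => by
          rw [hmu t h i]
          simpa [h] using (hv ⟨t, h⟩ i).2)
        (fun x => by
          refine (hcbound x).trans (le_of_eq ?_)
          rw [VM.stat, Finset.sum_range]
          refine Finset.sum_congr rfl fun t _ => Finset.sum_congr rfl fun i _ => ?_
          simp [VM.X_fin])
        (fun ρ hρ => hmin ρ (VM.vmt_of_mart hρ))
        (fun t ht i => by
          rw [hmu t (by omega) i, hmu (t + 1) ht i]
          exact (hord t ht i).2)
    have hgood : ∀ x : Fin N → Fin d → ℝ, (∀ s < N, ∀ i, VM.X s i x ∈ A s i) →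
        portfolioPayout N d (fun t i y => if y ∈ A t i then (f t i y : EReal) else ⊥)
          (VM.strat L) x = ((VM.stat f x + VM.trade L x : ℝ) : EReal) := by
      intro x hx
      refine VM.payout_strat _ hLA x f fun t i => ?_
      have := hx t t.isLt i
      rw [VM.X_fin] at this
      rw [if_pos this]
    refine ⟨fun t i y => if y ∈ A t i then (f t i y : EReal) else ⊥, VM.strat L, ?_, ?_, ?_, ?_,
      ?_, ?_⟩
    · intro t i
      exact Measurable.ite (hAm t i) (measurable_coe_real_ereal.comp (hfm t i)) measurable_const
    · intro t i x
      beta_reduce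
      split_ifs
      · exact EReal.coe_ne_top _
      · exact bot_ne_top
    · intro t i
      have := hAf t t.isLt i
      rw [hmu t t.isLt i] at this
      filter_upwards [this] with y hy
      rw [if_pos hy]
      exact EReal.coe_ne_bot _
    · exact VM.measurable_strat hLm
    · intro x
      by_cases hx : ∀ s < N, ∀ i, VM.X s i x ∈ A s i
      · rw [hgood x hx]
        exact EReal.coe_le_coe_iff.2 (hle x hx)
      · push Not at hx
        obtain ⟨s, hs, i, hi⟩ := hx
        rw [VM.payout_bot _ _ x ⟨s, hs⟩ i]
        · exact bot_le
        · have := VM.X_fin ⟨s, hs⟩ i x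
          rw [← this]
          exact if_neg hi
    · intro ρ hρ hρm
      have hρM := VM.mart_of_vmt hmom hρ
      have hgoodx : ∀ᵐ x ∂ρ, ∀ s < N, ∀ i, VM.X s i x ∈ A s i := by
        rw [ae_all_iff]
        intro s
        by_cases hs : s < N
        · simp only [hs, forall_true_left]
          rw [ae_all_iff]
          intro i
          have := hAf s hs i
          rw [← hρM.marg s hs i] at this
          exact ae_of_ae_map (VM.measurable_X s i).aemeasurable this
        · simp [hs]
      filter_upwards [hgoodx, heq ρ hρM (hρm π hπ)] with x h1 h2
      rw [hgood x h1, h2]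
  · refine ⟨fun t i y => ((-v t i y : ℝ) : EReal), fun _ _ _ => 0, ?_, ?_, ?_, ?_, ?_, ?_⟩
    · intro t i
      exact measurable_coe_real_ereal.comp (hv t i).1.measurable.neg
    · intro t i x
      exact EReal.coe_ne_top _
    · intro t i
      exact Eventually.of_forall fun y => EReal.coe_ne_bot _
    · intro t i
      exact measurable_const
    · intro x
      rw [VM.payout_real _ _ x (fun t i => -v t i (x t i)) fun t i => rfl]
      refine EReal.coe_le_coe_iff.2 ?_
      have := (abs_le.1 (hcbound x)).1
      simpa using this
    · intro ρ hρ hρm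
      exact absurd ⟨ρ, hρ, hρm⟩ hex
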